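/- Let f be a homeomorphism of the open annulus A = (ℝ/ℤ) × (0,1) that is isotopic to the identity and satisfies the intersection property (every essential simple closed curve C ⊂ A meets f(C)). Let F be a lift of f to ℝ × (0,1) commuting with T(x,y) = (x+1,y), and suppose there exist positively recurrent points z₁, z₂ of f with rotation numbers ρ₁ < ρ₂ (in ℝ) for F. Then for every rational number p/q ∈ (ρ₁, ρ₂) written in irreducible form with q ≥ 1, there exists a point z of minimal period q under f admitting a lift z̃ with F^[q](z̃) = z̃ + (p, 0) (a q-prime-periodic point with rotation number p/q). -/

import Mathlib

open Filter Topology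

/-- The circle `ℝ/ℤ`. -/
abbrev Circle1 : Type := AddCircle (1 : ℝ)

/-- The open annulus `(ℝ/ℤ) × (0,1)`. -/
abbrev AnnO : Type := Circle1 × ↥(Set.Ioo (0 : ℝ) 1)

/-- The universal covering space `ℝ × (0,1)` of the open annulus. -/
abbrev StripO : Type := ℝ × ↥(Set.Ioo (0 : ℝ) 1)

/-- The covering map `π(x, y) = (x mod 1, y)`. -/
noncomputable def projO : StripO → AnnO := fun p => ((p.1 : Circle1), p.2)

/-- The deck transformation `T(x, y) = (x + 1, y)`. -/
def deckO : StripO → StripO := fun p => (p.1 + 1, p.2)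

/-- `f` is isotopic to the identity. -/
def IsotopicToIdO (f : AnnO → AnnO) : Prop :=
  ∃ H : ↥(Set.Icc (0 : ℝ) 1) × AnnO → AnnO, Continuous H ∧
    (∀ z, H (⟨0, by norm_num⟩, z) = z) ∧
    (∀ z, H (⟨1, by norm_num⟩, z) = f z) ∧
    (∀ t, ∃ g : AnnO ≃ₜ AnnO, ∀ z, H (t, z) = g z)

/-- `z` is positively recurrent for `f`. -/
def PosRecurrentO (f : AnnO → AnnO) (z : AnnO) : Prop :=
  ∀ U ∈ 𝓝 z, ∀ N : ℕ, ∃ n ≥ N, f^[n] z ∈ U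

/-- The positively recurrent point `z` has rotation number `ρ` for the lift `F`. -/
def HasRotNumO (f : AnnO → AnnO) (F : StripO → StripO) (z : AnnO) (ρ : ℝ) : Prop :=
  ∀ zt : StripO, projO zt = z →
    ∀ n : ℕ → ℕ, StrictMono n → (∀ j, 0 < n j) →
      Tendsto (fun j => f^[n j] z) atTop (𝓝 z) →
      Tendsto (fun j => ((F^[n j] zt).1 - zt.1) / (n j : ℝ)) atTop (𝓝 ρ)

namespace FLC

/-- log lift -/
theorem log_lift {A : Type*} [TopologicalSpace A] [SimplyConnectedSpace A]
    [LocallyPathConnectedSpace A] (f : A → ℂ) (hf : Continuous f) (h0 : ∀ a, f a ≠ 0) :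
    ∃ L : A → ℂ, Continuous L ∧ ∀ a, Complex.exp (L a) = f a := by
  obtain ⟨a₀⟩ : Nonempty A := inferInstance
  obtain ⟨L, ⟨-, hL⟩, -⟩ := Complex.isCoveringMapOn_exp.existsUnique_continuousMap_lifts
    (⟨f, hf⟩ : C(A, ℂ)) (a₀ := a₀) (e₀ := Complex.log (f a₀)) (Complex.exp_log (h0 a₀))
    (fun a => h0 a)
  exact ⟨L, L.continuous, fun a => congrFun hL a⟩

theorem log_lift_C (f : ℂ → ℂ) (hf : Continuous f) (h0 : ∀ a, f a ≠ 0) :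
    ∃ L : ℂ → ℂ, Continuous L ∧ ∀ a, Complex.exp (L a) = f a := log_lift f hf h0

theorem log_lift_RR (f : ℝ × ℝ → ℂ) (hf : Continuous f) (h0 : ∀ a, f a ≠ 0) :
    ∃ L : ℝ × ℝ → ℂ, Continuous L ∧ ∀ a, Complex.exp (L a) = f a := log_lift f hf h0

/-- A continuous function on a preconnected space with constant exponential is constant. -/
theorem exp_const {A : Type*} [TopologicalSpace A] [PreconnectedSpace A] (g : A → ℂ)
    (hg : Continuous g) (c : ℂ) (h : ∀ a, Complex.exp (g a) = c) (a b : A) : g a = g b := by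
  have key : ∀ a, ∃ n : ℤ, (g a - g b) = n * (2 * Real.pi * Complex.I) := by
    intro a
    have := (Complex.exp_eq_exp_iff_exists_int (x := g a) (y := g b)).1 (by rw [h, h])
    obtain ⟨n, hn⟩ := this
    exact ⟨n, by rw [hn]; ring⟩
  choose n hn using key
  have hr : ∀ a, ((n a : ℤ) : ℝ) = (g a - g b).im / (2 * Real.pi) := by
    intro a
    rw [hn a]
    have := Real.pi_pos
    simp
  have hc : Continuous n := by
    have : Continuous (fun a => ((n a : ℤ) : ℝ)) := by
      simp_rw [hr]
      fun_prop
    exact Int.isClosedEmbedding_coe_real.isInducing.continuous_iff.2 this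
  have := PreconnectedSpace.constant (inferInstance : PreconnectedSpace A) hc (x := a) (y := b)
  have hb : n b = 0 := by
    have := hr b
    simp at this
    exact this
  have h2 := hn a
  rw [this, hb] at h2
  simpa [sub_eq_zero] using h2

/-- Isotopic to the identity (through injective maps). -/
def Iso (h : ℂ → ℂ) : Prop :=
  ∃ H : ℝ × ℂ → ℂ, Continuous H ∧ (∀ z, H (0, z) = z) ∧ (∀ z, H (1, z) = h z) ∧
    ∀ t, Function.Injective (fun z => H (t, z))

theorem Iso.comp {g h : ℂ → ℂ} (hg : Iso g) (hh : Iso h) : Iso (fun z => g (h z)) := by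
  obtain ⟨H, hc, h0, h1, hi⟩ := hg
  obtain ⟨H', hc', h0', h1', hi'⟩ := hh
  refine ⟨fun p => H (p.1, H' p), by fun_prop, fun z => by simp [h0, h0'], fun z => by
    simp [h1, h1'], fun t => ?_⟩
  exact (hi t).comp (hi' t)

theorem Iso.iterate {g : ℂ → ℂ} (hg : Iso g) (n : ℕ) : Iso (g^[n]) := by
  induction n with
  | zero => exact ⟨fun p => p.2, by fun_prop, fun z => rfl, fun z => rfl, fun t a b h => h⟩
  | succ n ih => have h := Iso.comp ih hg; exact h

/-- id plus a contraction. -/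
theorem contraction_homeo (g : ℂ → ℂ) (K : NNReal) (hK : K < 1) (hg : LipschitzWith K g) :
    ∃ φ : ℂ ≃ₜ ℂ, ∀ x, φ x = x + g x := by
  have ha : ApproximatesLinearOn (fun x => x + g x)
      ((ContinuousLinearEquiv.refl ℝ ℂ : ℂ ≃L[ℝ] ℂ) : ℂ →L[ℝ] ℂ) Set.univ K := by
    rw [ApproximatesLinearOn.approximatesLinearOn_iff_lipschitzOnWith]
    have : ((fun x => x + g x) - ⇑((ContinuousLinearEquiv.refl ℝ ℂ : ℂ ≃L[ℝ] ℂ) : ℂ →L[ℝ] ℂ)) = g := by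
      funext x; simp
    rw [this]
    exact hg.lipschitzOnWith
  refine ⟨ha.toHomeomorph _ (Or.inr ?_), fun x => rfl⟩
  refine lt_of_lt_of_le hK ?_
  have : ‖(((ContinuousLinearEquiv.refl ℝ ℂ : ℂ ≃L[ℝ] ℂ).symm : ℂ ≃L[ℝ] ℂ) : ℂ →L[ℝ] ℂ)‖₊ = 1 := by
    have : (((ContinuousLinearEquiv.refl ℝ ℂ : ℂ ≃L[ℝ] ℂ).symm : ℂ ≃L[ℝ] ℂ) : ℂ →L[ℝ] ℂ)
      = ContinuousLinearMap.id ℝ ℂ := rfl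
    rw [this]
    ext
    simp
  rw [this]; simp

theorem contraction_inj (g : ℂ → ℂ) (K : NNReal) (hK : K < 1) (hg : LipschitzWith K g) :
    Function.Injective (fun x => x + g x) := by
  obtain ⟨φ, hφ⟩ := contraction_homeo g K hK hg
  have : (fun x => x + g x) = φ := by funext x; rw [hφ]
  rw [this]; exact φ.injective

theorem bump_lip (c v : ℂ) (r : ℝ) (hr : 0 < r) :
    LipschitzWith (‖v‖₊ / r.toNNReal) (fun x : ℂ => ((max 0 (1 - ‖x - c‖ / r) : ℝ) : ℂ) * v) := by
  apply LipschitzWith.of_dist_le_mul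
  intro x y
  rw [dist_eq_norm, dist_eq_norm, ← sub_mul, norm_mul, ← Complex.ofReal_sub, Complex.norm_real,
    NNReal.coe_div, coe_nnnorm, Real.coe_toNNReal r hr.le, Real.norm_eq_abs]
  have h1 : |max 0 (1 - ‖x - c‖ / r) - max 0 (1 - ‖y - c‖ / r)| ≤ ‖x - y‖ / r := by
    have h2 : |(1 - ‖x - c‖ / r) - (1 - ‖y - c‖ / r)| ≤ ‖x - y‖ / r := by
      have : (1 - ‖x - c‖ / r) - (1 - ‖y - c‖ / r) = (‖y - c‖ - ‖x - c‖) / r := by ring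
      rw [this, abs_div, abs_of_pos hr]
      gcongr
      have := abs_norm_sub_norm_le (y - c) (x - c)
      rw [show y - c - (x - c) = -(x - y) by ring, norm_neg] at this
      exact this
    refine le_trans ?_ h2
    have := abs_max_sub_max_le_abs (1 - ‖x - c‖ / r) (1 - ‖y - c‖ / r) 0
    rw [max_comm 0, max_comm 0]
    exact this
  calc _ ≤ ‖x - y‖ / r * ‖v‖ := by gcongr
    _ = _ := by ring

theorem local_push (c v : ℂ) (r : ℝ) (hv : ‖v‖ < r) :
    ∃ φ : ℂ ≃ₜ ℂ, Iso φ ∧ (∀ x, x ∉ Metric.ball c r → φ x = x) ∧ φ c = c + v := by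
  have hr : 0 < r := lt_of_le_of_lt (norm_nonneg _) hv
  have hK : ‖v‖₊ / r.toNNReal < 1 := by
    rw [← NNReal.coe_lt_coe, NNReal.coe_div, coe_nnnorm, Real.coe_toNNReal r hr.le, NNReal.coe_one,
      div_lt_one hr]
    exact hv
  obtain ⟨φ, hφ⟩ := contraction_homeo _ _ hK (bump_lip c v r hr)
  refine ⟨φ, ⟨fun p => p.2 + ((max 0 (1 - ‖p.2 - c‖ / r) : ℝ) : ℂ) *
    (((max 0 (min 1 p.1) : ℝ) : ℂ) * v), by fun_prop, fun z => by simp, fun z => by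
      simp [hφ], fun t => ?_⟩, fun x hx => ?_, by simp [hφ]⟩
  · refine contraction_inj _ (‖((max 0 (min 1 t) : ℝ) : ℂ) * v‖₊ / r.toNNReal) ?_
      (bump_lip c _ r hr)
    refine lt_of_le_of_lt ?_ hK
    gcongr
    rw [← NNReal.coe_le_coe, coe_nnnorm, coe_nnnorm, norm_mul, Complex.norm_real, Real.norm_eq_abs,
      abs_of_nonneg (le_max_left _ _)]
    have : max 0 (min 1 t) ≤ 1 := max_le zero_le_one (min_le_left _ _)
    nlinarith [norm_nonneg v]
  · rw [hφ]
    rw [Metric.mem_ball, not_lt, dist_eq_norm] at hx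
    have : 1 - ‖x - c‖ / r ≤ 0 := by
      rw [sub_nonpos, le_div_iff₀ hr]; linarith
    rw [max_eq_left this]; simp

/-- Pushes supported in `O`. -/
def PushRel (O : Set ℂ) (a b : ℂ) : Prop :=
  ∃ φ : ℂ ≃ₜ ℂ, Iso φ ∧ (∀ x, x ∉ O → φ x = x) ∧ φ a = b

theorem PushRel.trans {O : Set ℂ} {a b c : ℂ} (h1 : PushRel O a b) (h2 : PushRel O b c) :
    PushRel O a c := by
  obtain ⟨φ, i, s, e⟩ := h1
  obtain ⟨ψ, i', s', e'⟩ := h2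
  refine ⟨φ.trans ψ, (Iso.comp i' i :), fun x hx => ?_, by simp [e, e']⟩
  simp [s x hx, s' x hx]

theorem local_push_rel {O : Set ℂ} (hO : IsOpen O) {a : ℂ} (ha : a ∈ O) :
    ∃ r > 0, Metric.ball a r ⊆ O ∧ ∀ x ∈ Metric.ball a r, PushRel O a x ∧ PushRel O x a := by
  obtain ⟨r, hr, hb⟩ := Metric.isOpen_iff.1 hO a ha
  refine ⟨r / 2, by positivity, (Metric.ball_subset_ball (by linarith)).trans hb, fun x hx => ?_⟩
  rw [Metric.mem_ball, dist_eq_norm] at hx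
  constructor
  · obtain ⟨φ, i, s, e⟩ := local_push a (x - a) (r / 2) hx
    refine ⟨φ, i, fun y hy => s y fun hy' => hy (hb (Metric.ball_subset_ball (by linarith) hy')),
      by rw [e]; ring⟩
  · obtain ⟨φ, i, s, e⟩ := local_push x (a - x) (r / 2) (by rw [norm_sub_rev]; exact hx)
    refine ⟨φ, i, fun y hy => s y fun hy' => hy (hb ?_), by rw [e]; ring⟩
    rw [Metric.mem_ball, dist_eq_norm] at hy' ⊢
    calc ‖y - a‖ = ‖(y - x) + (x - a)‖ := by ring_nf
      _ ≤ _ := norm_add_le _ _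
      _ < r := by linarith

theorem push {O : Set ℂ} (hO : IsOpen O) (hc : IsPreconnected O) {a b : ℂ} (ha : a ∈ O)
    (hb : b ∈ O) : PushRel O a b := by
  have h1 : IsOpen {x | x ∈ O ∧ PushRel O a x} := by
    rw [Metric.isOpen_iff]
    rintro x ⟨hx, hp⟩
    obtain ⟨r, hr, hs, hpr⟩ := local_push_rel hO hx
    exact ⟨r, hr, fun y hy => ⟨hs hy, hp.trans (hpr y hy).1⟩⟩
  have h2 : IsOpen {x | x ∈ O ∧ ¬ PushRel O a x} := by
    rw [Metric.isOpen_iff]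
    rintro x ⟨hx, hp⟩
    obtain ⟨r, hr, hs, hpr⟩ := local_push_rel hO hx
    exact ⟨r, hr, fun y hy => ⟨hs hy, fun h => hp (h.trans (hpr y hy).2)⟩⟩
  by_contra hn
  obtain ⟨x, hx, hx1, hx2⟩ := hc _ _ h1 h2
    (fun x hx => by by_cases h : PushRel O a x; exacts [Or.inl ⟨hx, h⟩, Or.inr ⟨hx, h⟩])
    ⟨a, ha, ha, by
      obtain ⟨r, hr, hs, hpr⟩ := local_push_rel hO ha
      exact (hpr a (Metric.mem_ball_self hr)).1⟩ ⟨b, hb, hb, hn⟩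
  exact hx2.2 hx1.2

end FLC

namespace FLC

theorem no_per2 (h : ℂ ≃ₜ ℂ) (hI : Iso h) (hf : ∀ z, h z ≠ z) (x : ℂ) : h (h x) ≠ x := by
  intro hx
  obtain ⟨H, Hc, H0, H1, Hi⟩ := hI
  obtain ⟨L, Lc, hL⟩ := log_lift_C (fun z => h z - z) (by fun_prop) (fun z => sub_ne_zero.2 (hf z))
  set y := h x with hy
  let α : ℝ → ℂ := fun t => x + t * (y - x)
  have hα : Continuous α := by fun_prop
  have α0 : α 0 = x := by simp [α]
  have α1 : α 1 = y := by simp [α]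
  obtain ⟨M, Mc, hM⟩ := log_lift_RR (fun p => H (p.1, h (α p.2)) - H (p.1, α p.2))
    (by fun_prop) (fun p => sub_ne_zero.2 fun e => hf _ (Hi p.1 e))
  have e0 := exp_const (fun t : ℝ => M (0, t) - L (α t)) (by fun_prop) 1
    (fun t => by rw [Complex.exp_sub, hM, hL]; simp [H0, div_self (sub_ne_zero.2 (hf _))]) 0 1
  have e1 := exp_const (fun t : ℝ => M (1, t) - L (h (α t))) (by fun_prop) 1
    (fun t => by rw [Complex.exp_sub, hM, hL]; simp [H1, div_self (sub_ne_zero.2 (hf _))]) 0 1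
  have hne : ∀ s, H (s, y) - H (s, x) ≠ 0 := fun s => sub_ne_zero.2 fun e => hf x (Hi s e)
  have hm1 : ∀ s, Complex.exp (M (s, 1) - M (s, 0)) = -1 := fun s => by
    rw [Complex.exp_sub, hM, hM]
    simp only [α0, α1, hx, ← hy]
    rw [div_eq_iff (hne s)]; ring
  have e2 := exp_const (fun s : ℝ => M (s, 1) - M (s, 0)) (by fun_prop) (-1) hm1 0 1
  simp only [α0, α1, hx, ← hy] at e0 e1 e2
  have h0 : M (0, 1) - M (0, 0) = 0 := by linear_combination (1/2) * e2 - (1/2) * e0 - (1/2) * e1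
  have := hm1 0
  rw [h0] at this
  norm_num at this

/-- A set is free for `h`. -/
def Free (h : ℂ → ℂ) (D : Set ℂ) : Prop := ∀ z ∈ D, h z ∉ D

theorem supp_maps {φ : ℂ ≃ₜ ℂ} {D : Set ℂ} (hs : ∀ x, x ∉ D → φ x = x) {x : ℂ} (hx : x ∈ D) :
    φ x ∈ D := by
  by_contra hn
  have := φ.injective (hs _ hn)
  rw [this] at hn
  exact hn hx

theorem push_fpf {h φ : ℂ ≃ₜ ℂ} {D : Set ℂ} (hf : ∀ z, h z ≠ z) (hD : Free h D)
    (hs : ∀ x, x ∉ D → φ x = x) (z : ℂ) : (h.trans φ) z ≠ z := by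
  simp only [Homeomorph.trans_apply]
  by_cases hz : h z ∈ D
  · intro e
    have h1 := supp_maps hs hz
    rw [e] at h1
    exact hD z h1 hz
  · rw [hs _ hz]; exact hf z

theorem push_iterate {h φ : ℂ ≃ₜ ℂ} {p : ℂ} {j : ℕ}
    (hp : ∀ i, 1 ≤ i → i ≤ j → φ (h^[i] p) = h^[i] p) :
    (h.trans φ)^[j] p = h^[j] p := by
  induction j with
  | zero => rfl
  | succ j ih =>
    rw [Function.iterate_succ_apply', ih (fun i h1 h2 => hp i h1 (by omega)),
      Function.iterate_succ_apply', Homeomorph.trans_apply]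
    have := hp (j + 1) (by omega) le_rfl
    rw [Function.iterate_succ_apply'] at this
    exact this

theorem push_iterate_last {h φ : ℂ ≃ₜ ℂ} {p : ℂ} {j : ℕ}
    (hp : ∀ i, 1 ≤ i → i ≤ j → φ (h^[i] p) = h^[i] p) :
    (h.trans φ)^[j + 1] p = φ (h^[j + 1] p) := by
  rw [Function.iterate_succ_apply', push_iterate hp, Function.iterate_succ_apply',
    Homeomorph.trans_apply]

theorem thickening_preconn {K : Set ℂ} (hK : IsPreconnected K) (δ : ℝ) :
    IsPreconnected (Metric.thickening δ K) := by
  rcases le_or_gt δ 0 with hδ | hδ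
  · rw [Metric.thickening_of_nonpos hδ]; exact isPreconnected_empty
  rcases K.eq_empty_or_nonempty with rfl | ⟨x, hx⟩
  · rw [Metric.thickening_empty]; exact isPreconnected_empty
  refine isPreconnected_of_forall x fun y hy => ?_
  obtain ⟨z, hz, hyz⟩ := Metric.mem_thickening_iff.1 hy
  refine ⟨K ∪ Metric.ball z δ, Set.union_subset (Metric.self_subset_thickening hδ K)
    (Metric.ball_subset_thickening hz δ), Or.inl hx, Or.inr hyz,
    IsPreconnected.union z hz (Metric.mem_ball_self hδ) hK (convex_ball z δ).isPreconnected⟩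

theorem thin_nbhd {h : ℂ ≃ₜ ℂ} {K U : Set ℂ} (hK : IsCompact K) (hKc : IsPreconnected K)
    (hU : IsOpen U) (hKU : K ⊆ U) (hfree : Free h K) :
    ∃ O, IsOpen O ∧ IsPreconnected O ∧ K ⊆ O ∧ O ⊆ U ∧ Free h O := by
  obtain ⟨A, B, hA, hB, hKA, hKB, hAB⟩ := SeparatedNhds.of_isCompact_isCompact hK
    (hK.image h.continuous) (Set.disjoint_left.2 fun z hz ⟨w, hw, e⟩ => hfree w hw (e ▸ hz))
  have hV : IsOpen (U ∩ A ∩ h ⁻¹' B) := (hU.inter hA).inter (hB.preimage h.continuous)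
  obtain ⟨δ, hδ, hs⟩ := hK.exists_thickening_subset_open hV
    (fun z hz => ⟨⟨hKU hz, hKA hz⟩, hKB ⟨z, hz, rfl⟩⟩)
  refine ⟨Metric.thickening δ K, Metric.isOpen_thickening, thickening_preconn hKc δ,
    Metric.self_subset_thickening hδ K, fun z hz => (hs hz).1.1, fun z hz hz' => ?_⟩
  exact Set.disjoint_left.1 hAB (hs hz').1.2 (hs hz).2

theorem free_disjoint_iter {n : ℕ}
    (IH : ∀ m, 1 ≤ m → m < n → ∀ h : ℂ ≃ₜ ℂ, Iso h → (∀ z, h z ≠ z) → ∀ x, h^[m] x ≠ x)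
    {h : ℂ ≃ₜ ℂ} (hI : Iso h) (hf : ∀ z, h z ≠ z) {D : Set ℂ} (hD : IsOpen D)
    (hc : IsPreconnected D) (hfr : Free h D) :
    ∀ j, 1 ≤ j → j < n → ∀ p ∈ D, h^[j] p ∉ D := by
  intro j
  induction j using Nat.strong_induction_on with
  | _ j ih =>
    intro h1 hn p hp hjp
    obtain ⟨φ, φI, φs, φe⟩ := push hD hc hjp hp
    obtain ⟨k, rfl⟩ : ∃ k, j = k + 1 := ⟨j - 1, by omega⟩
    refine IH (k + 1) h1 hn (h.trans φ) (Iso.comp φI hI :) (push_fpf hf hfr φs) p ?_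
    rw [push_iterate_last, φe]
    intro i hi hik
    exact φs _ (ih i (by omega) hi (by omega) p hp)

theorem exists_contact {h : ℂ ≃ₜ ℂ} (hf : ∀ z, h z ≠ z) (x : ℂ) :
    ∃ r > 0, ∃ u, Free h (Metric.ball x r) ∧ dist u x = r ∧ dist (h u) x = r := by
  let S : Set ℝ := {r | Free h (Metric.ball x r)}
  have hbd : ∀ r ∈ S, r ≤ dist (h x) x := by
    intro r hr
    by_contra hn
    push Not at hn
    exact hr x (Metric.mem_ball_self (dist_nonneg.trans_lt hn)) hn
  have hne : ∃ r > 0, r ∈ S := by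
    obtain ⟨O, hO, -, hxO, -, hfr⟩ := thin_nbhd (h := h) (isCompact_singleton (x := x))
      isPreconnected_singleton isOpen_univ (Set.subset_univ _)
      (by rintro z rfl; exact hf _)
    obtain ⟨r, hr, hb⟩ := Metric.isOpen_iff.1 hO x (hxO rfl)
    exact ⟨r, hr, fun z hz hz' => hfr z (hb hz) (hb hz')⟩
  obtain ⟨r0, hr0, hr0S⟩ := hne
  have hB : BddAbove S := ⟨_, hbd⟩
  set r := sSup S with hr
  have hr0' : 0 < r := lt_of_lt_of_le hr0 (le_csSup hB hr0S)
  have hfr : Free h (Metric.ball x r) := by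
    intro z hz hz'
    have hlt : max (dist z x) (dist (h z) x) < r := max_lt hz hz'
    obtain ⟨s, hs, hlt'⟩ := exists_lt_of_lt_csSup ⟨r0, hr0S⟩ hlt
    exact hs z ((le_max_left _ _).trans_lt hlt') ((le_max_right _ _).trans_lt hlt')
  have hcon : ∃ u ∈ Metric.closedBall x r, h u ∈ Metric.closedBall x r := by
    by_contra hn
    push Not at hn
    obtain ⟨O, hO, -, hxO, -, hfrO⟩ := thin_nbhd (h := h) (isCompact_closedBall x r)
      (convex_closedBall x r).isPreconnected isOpen_univ (Set.subset_univ _) hn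
    obtain ⟨δ, hδ, hs⟩ := (isCompact_closedBall x r).exists_thickening_subset_open hO hxO
    have : Metric.ball x (r + δ) ⊆ O := by
      rwa [thickening_closedBall hδ hr0'.le, add_comm] at hs
    have h2 : r + δ ∈ S := fun z hz hz' => hfrO z (this hz) (this hz')
    have := le_csSup hB h2
    linarith
  obtain ⟨u, hu, hhu⟩ := hcon
  refine ⟨r, hr0', u, hfr, le_antisymm hu ?_, le_antisymm hhu ?_⟩
  · by_contra hn
    push Not at hn
    have h1 : h '' (Metric.ball x r) ∈ 𝓝 (h u) :=
      (h.isOpenMap _ Metric.isOpen_ball).mem_nhds ⟨u, hn, rfl⟩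
    have h2 : h u ∈ closure (Metric.ball x r) := by
      rw [closure_ball x hr0'.ne']; exact hhu
    obtain ⟨w, ⟨v, hv, rfl⟩, hw⟩ := mem_closure_iff_nhds.1 h2 _ h1
    exact hfr v hv hw
  · by_contra hn
    push Not at hn
    have h1 : h ⁻¹' (Metric.ball x r) ∈ 𝓝 u :=
      (Metric.isOpen_ball.preimage h.continuous).mem_nhds hn
    have h2 : u ∈ closure (Metric.ball x r) := by
      rw [closure_ball x hr0'.ne']; exact hu
    obtain ⟨w, hv, hw⟩ := mem_closure_iff_nhds.1 h2 _ h1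
    exact hfr w hw hv

/-- radial segment -/
def rad (x v : ℂ) (τ : ℝ) : Set ℂ := (fun t : ℝ => x + t * (v - x)) '' Set.Icc τ 1

theorem rad_compact (x v : ℂ) (τ : ℝ) : IsCompact (rad x v τ) :=
  isCompact_Icc.image (by fun_prop)

theorem rad_preconn (x v : ℂ) (τ : ℝ) : IsPreconnected (rad x v τ) :=
  isPreconnected_Icc.image _ (by fun_prop)

theorem rad_mem_end (x v : ℂ) {τ : ℝ} (h : τ ≤ 1) : v ∈ rad x v τ :=
  ⟨1, ⟨h, le_rfl⟩, by simp⟩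

theorem rad_mem_start (x v : ℂ) : x ∈ rad x v 0 := ⟨0, ⟨le_rfl, zero_le_one⟩, by simp⟩

theorem rad_cases {x v z : ℂ} {r τ : ℝ} (hr : 0 < r) (hv : dist v x = r) (hτ : 0 ≤ τ)
    (hz : z ∈ rad x v τ) : z ∈ Metric.ball x r ∨ z = v := by
  obtain ⟨t, ⟨h0, h1⟩, rfl⟩ := hz
  rcases eq_or_lt_of_le h1 with rfl | h1
  · right; simp
  · left
    rw [Metric.mem_ball, dist_eq_norm, add_sub_cancel_left, norm_mul, Complex.norm_real,
      Real.norm_eq_abs, abs_of_nonneg (hτ.trans h0), ← dist_eq_norm, hv]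
    nlinarith

theorem rad_disj {x u v z : ℂ} {r τ : ℝ} (hr : 0 < r) (hu : dist u x = r) (hv : dist v x = r)
    (huv : u ≠ v) (hτ : 0 < τ) (hz : z ∈ rad x v 0) (hz' : z ∈ rad x u τ) : False := by
  obtain ⟨t, ⟨h0, h1⟩, rfl⟩ := hz
  obtain ⟨s, ⟨h2, h3⟩, e⟩ := hz'
  have e : (s : ℂ) * (u - x) = t * (v - x) := by simpa using e
  have hn : s * r = t * r := by
    have := congrArg norm e
    rw [norm_mul, norm_mul, Complex.norm_real, Complex.norm_real, Real.norm_eq_abs,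
      Real.norm_eq_abs, abs_of_nonneg (hτ.le.trans h2), abs_of_nonneg h0, ← dist_eq_norm,
      ← dist_eq_norm, hu, hv] at this
    exact this
  have hst : s = t := mul_right_cancel₀ hr.ne' hn
  subst hst
  have hs : (s : ℂ) ≠ 0 := by exact_mod_cast (lt_of_lt_of_le hτ h2).ne'
  have := mul_left_cancel₀ hs e
  exact huv (by linear_combination this)

theorem brouwer_step {n : ℕ} (hn : 3 ≤ n)
    (IH : ∀ m, 1 ≤ m → m < n → ∀ h : ℂ ≃ₜ ℂ, Iso h → (∀ z, h z ≠ z) → ∀ x, h^[m] x ≠ x)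
    (h : ℂ ≃ₜ ℂ) (hI : Iso h) (hf : ∀ z, h z ≠ z) (x : ℂ) : h^[n] x ≠ x := by
  intro hx
  obtain ⟨r, hr, u, hfr, hu, hhu⟩ := exists_contact hf x
  set D := Metric.ball x r with hD
  have hDo : IsOpen D := Metric.isOpen_ball
  have hDc : IsPreconnected D := (convex_ball x r).isPreconnected
  have hxD : x ∈ D := Metric.mem_ball_self hr
  have Fj := free_disjoint_iter IH hI hf hDo hDc hfr
  have huD : u ∉ D := by simp [hD, hu]
  have hhuD : h u ∉ D := by simp [hD, hhu]
  have hucl : u ∈ closure D := by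
    rw [hD, closure_ball x hr.ne']; exact hu.le
  have F2 : ∀ w ∈ D, h w ≠ h u := fun w hw e => huD (h.injective e ▸ hw)
  have F3 : h (h u) ∉ D := by
    intro hh
    have h1 : (fun z => h (h z)) ⁻¹' D ∈ 𝓝 u :=
      (hDo.preimage (by fun_prop)).mem_nhds hh
    obtain ⟨w, hv, hw⟩ := mem_closure_iff_nhds.1 hucl _ h1
    exact Fj 2 (by norm_num) (by omega) w hw hv
  have F4 : ∀ w ∈ D, h w ≠ u := by
    intro w hw e
    have h1 : h '' D ∈ 𝓝 u := (h.isOpenMap _ hDo).mem_nhds ⟨w, hw, e⟩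
    obtain ⟨_, ⟨v, hv, rfl⟩, hw⟩ := mem_closure_iff_nhds.1 hucl _ h1
    exact hfr v hv hw
  have F5 : ∀ w ∈ D, h (h w) ∉ D := fun w hw => Fj 2 (by norm_num) (by omega) w hw
  set P1 := rad x (h u) 0 with hP1
  have hP1f : Free h P1 := by
    intro z hz hz'
    rcases rad_cases hr hhu le_rfl hz with h1 | rfl <;>
    rcases rad_cases hr hhu le_rfl hz' with h2 | h2
    · exact hfr z h1 h2
    · exact F2 z h1 h2
    · exact F3 h2
    · exact hf _ h2
  have K1 : ∀ i, 2 ≤ i → i < n → h^[i] x ≠ h u := by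
    intro i h2 hin e
    obtain ⟨O, hO, hOc, hPO, -, hOf⟩ := thin_nbhd (h := h) (rad_compact x (h u) 0)
      (rad_preconn x (h u) 0) isOpen_univ (Set.subset_univ _) hP1f
    refine free_disjoint_iter IH hI hf hO hOc hOf i (by omega) hin x (hPO (rad_mem_start _ _)) ?_
    rw [e]; exact hPO (rad_mem_end _ _ zero_le_one)
  have K2 : ∀ i, 2 ≤ i → i < n → h^[i] x ∉ P1 ∪ h '' (rad x u 0) := by
    rintro i h2 hin (hm | ⟨w, hw, e⟩)
    · rcases rad_cases hr hhu le_rfl hm with h1 | h1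
      · exact Fj i (by omega) hin x hxD h1
      · exact K1 i h2 hin h1
    · obtain ⟨k, rfl⟩ : ∃ k, i = k + 1 := ⟨i - 1, by omega⟩
      rw [Function.iterate_succ_apply'] at e
      have e := h.injective e
      rcases rad_cases hr hu le_rfl hw with h1 | h1
      · rw [e] at h1
        exact Fj k (by omega) (by omega) x hxD h1
      · apply K1 (k + 1) h2 hin
        rw [Function.iterate_succ_apply', ← e, h1]
  have hE0 : IsClosed (P1 ∪ h '' (rad x u 0)) :=
    (rad_compact x (h u) 0).isClosed.union ((rad_compact x u 0).image h.continuous).isClosed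
  -- the ball B
  have hBex : ∃ ε > 0, Free h (Metric.closedBall (h x) ε) ∧
      (∀ z ∈ Metric.closedBall (h x) ε, h z ∉ P1 ∪ h '' (rad x u 0)) ∧
      ∀ i, 2 ≤ i → i < n → h^[i] x ∉ Metric.closedBall (h x) ε := by
    obtain ⟨O, hO, -, hPO, -, hOf⟩ := thin_nbhd (h := h) (isCompact_singleton (x := h x))
      isPreconnected_singleton isOpen_univ (Set.subset_univ _)
      (by rintro z rfl; exact hf _)
    have hfin : IsOpen ((fun i => h^[i] x) '' (Set.Ico 2 n))ᶜ :=
      ((Set.finite_Ico 2 n).image _).isClosed.isOpen_compl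
    have hV : IsOpen (O ∩ h ⁻¹' (P1 ∪ h '' (rad x u 0))ᶜ ∩ ((fun i => h^[i] x) '' (Set.Ico 2 n))ᶜ) :=
      (hO.inter (hE0.isOpen_compl.preimage h.continuous)).inter hfin
    obtain ⟨ε, hε, hb⟩ := Metric.nhds_basis_closedBall.mem_iff.1 (hV.mem_nhds (x := h x)
      ⟨⟨hPO rfl, K2 2 le_rfl (by omega)⟩, by
        rintro ⟨i, ⟨h2, hin⟩, e⟩
        obtain ⟨k, rfl⟩ : ∃ k, i = k + 1 := ⟨i - 1, by omega⟩
        simp only [Function.iterate_succ_apply'] at e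
        exact IH k (by omega) (by omega) h hI hf x (h.injective e)⟩)
    exact ⟨ε, hε, fun z hz hz' => hOf z (hb hz).1.1 (hb hz').1.1, fun z hz => (hb hz).1.2,
      fun i h2 hin hm => (hb hm).2 ⟨i, ⟨h2, hin⟩, rfl⟩⟩
  obtain ⟨ε, hε, B1, B2, B3⟩ := hBex
  -- the point p
  have hpex : ∃ τ : ℝ, 0 < τ ∧ τ ≤ 1 ∧ h (x + τ * (u - x)) ∈ Metric.ball (h x) ε := by
    have hc : Continuous (fun t : ℝ => h (x + t * (u - x))) := by fun_prop
    have h1 : (fun t : ℝ => h (x + t * (u - x))) ⁻¹' Metric.ball (h x) ε ∈ 𝓝 (0 : ℝ) :=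
      (Metric.isOpen_ball.preimage hc).mem_nhds (by simp [hε])
    obtain ⟨δ, hδ, hb⟩ := Metric.mem_nhds_iff.1 h1
    refine ⟨min 1 (δ / 2), by positivity, min_le_left _ _, hb ?_⟩
    rw [Metric.mem_ball, Real.dist_eq, sub_zero, abs_of_pos (by positivity)]
    exact (min_le_right _ _).trans_lt (by linarith)
  obtain ⟨τ, hτ, hτ1, hp⟩ := hpex
  set E := P1 ∪ h '' (rad x u τ) with hE
  have hEE : E ⊆ P1 ∪ h '' (rad x u 0) :=
    Set.union_subset_union_right _ (Set.image_mono (Set.image_mono (Set.Icc_subset_Icc_left hτ.le)))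
  have hEcomp : IsCompact E := (rad_compact x (h u) 0).union ((rad_compact x u τ).image h.continuous)
  have hEconn : IsPreconnected E :=
    IsPreconnected.union (h u) (rad_mem_end _ _ zero_le_one) ⟨u, rad_mem_end _ _ hτ1, rfl⟩
      (rad_preconn _ _ _) ((rad_preconn _ _ _).image _ h.continuous.continuousOn)
  have huh : u ≠ h u := fun e => hf u e.symm
  have hEf : Free h E := by
    rintro z (hz | ⟨w, hw, rfl⟩) (hz' | ⟨w', hw', e⟩)
    · exact hP1f z hz hz'
    · exact rad_disj hr hu hhu huh hτ hz (h.injective e ▸ hw')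
    · rcases rad_cases hr hu hτ.le hw with h1 | rfl <;>
      rcases rad_cases hr hhu le_rfl hz' with h2 | h2
      · exact F5 w h1 h2
      · exact F4 w h1 (h.injective h2)
      · exact F3 h2
      · exact hf _ h2
    · have e := h.injective e
      rcases rad_cases hr hu hτ.le hw with h1 | rfl <;>
      rcases rad_cases hr hu hτ.le hw' with h2 | h2
      · exact hfr w h1 (e ▸ h2)
      · exact F4 w h1 (by rw [← e, h2])
      · exact hhuD (e ▸ h2)
      · exact hf w (by rw [← e, h2])
  have hfin : IsOpen ((fun i => h^[i] x) '' (Set.Ico 2 n))ᶜ :=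
    ((Set.finite_Ico 2 n).image _).isClosed.isOpen_compl
  obtain ⟨O, hO, hOc, hEO, hOV, hOf⟩ := thin_nbhd (h := h) hEcomp hEconn
    (((isCompact_closedBall (h x) ε).image h.continuous).isClosed.isOpen_compl.inter hfin)
    (fun z hz => ⟨by rintro ⟨w, hw, rfl⟩; exact B2 w hw (hEE hz), by
      rintro ⟨i, ⟨h2, hin⟩, rfl⟩; exact K2 i h2 hin (hEE hz)⟩) hEf
  obtain ⟨φ, φI, φs, φe⟩ := push hO hOc (hEO (Or.inl (rad_mem_start x (h u))))
    (hEO (Or.inr ⟨_, ⟨τ, ⟨le_rfl, hτ1⟩, rfl⟩, rfl⟩))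
  obtain ⟨ψ, ψI, ψs, ψe⟩ := push (Metric.isOpen_ball (x := h x) (ε := ε))
    (convex_ball _ _).isPreconnected hp (Metric.mem_ball_self hε)
  have hsub : Metric.ball (h x) ε ⊆ Metric.closedBall (h x) ε := Metric.ball_subset_closedBall
  have g1 : ∀ z, (h.trans φ) z ≠ z := push_fpf hf hOf φs
  have g2 : Free (h.trans φ) (Metric.ball (h x) ε) := by
    intro z hz hz'
    have h1 : h z ∉ O := fun hm => (hOV hm).1 ⟨z, hsub hz, rfl⟩
    rw [Homeomorph.trans_apply, φs _ h1] at hz'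
    exact B1 z (hsub hz) (hsub hz')
  have g3 := push_fpf g1 g2 ψs
  have hI2 : Iso ((h.trans φ).trans ψ) := (Iso.comp ψI (Iso.comp φI hI) :)
  have hEq : (h.trans φ).trans ψ = h.trans (φ.trans ψ) := rfl
  rw [hEq] at hI2 g3
  obtain ⟨k, rfl⟩ : ∃ k, n = k + 2 := ⟨n - 2, by omega⟩
  apply IH (k + 1) (by omega) (by omega) _ hI2 g3 (h x)
  rw [push_iterate_last]
  · rw [← Function.iterate_succ_apply, hx, Homeomorph.trans_apply, φe, ψe]
  · intro i hi hik
    rw [← Function.iterate_succ_apply, Homeomorph.trans_apply, φs, ψs]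
    · exact fun hm => B3 (i + 1) (by omega) (by omega) (hsub hm)
    · exact fun hm => (hOV hm).2 ⟨i + 1, ⟨by omega, by omega⟩, rfl⟩

/-- Brouwer: a fixed point free homeomorphism isotopic to the identity has no periodic point. -/
theorem brouwer (n : ℕ) (hn : 1 ≤ n) : ∀ h : ℂ ≃ₜ ℂ, Iso h → (∀ z, h z ≠ z) →
    ∀ x, h^[n] x ≠ x := by
  induction n using Nat.strong_induction_on with
  | _ n ih =>
    rcases Nat.lt_or_ge n 3 with h3 | h3
    · intro h hI hf x
      have : n = 1 ∨ n = 2 := by omega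
      rcases this with rfl | rfl
      · exact hf x
      · exact no_per2 h hI hf x
    · exact brouwer_step h3 (fun m h1 h2 => ih m h2 h1)

end FLC

namespace FLC

/-- Pseudo-orbits jumping inside the sets of a list. -/
def PathL (h : ℂ → ℂ) : List (Set ℂ) → ℕ → ℂ → ℂ → Prop
  | [], n, x, y => 1 ≤ n ∧ h^[n] x = y
  | B :: L, n, x, y => ∃ k m v, 1 ≤ k ∧ n = k + m ∧ h^[k] x ∈ B ∧ v ∈ B ∧ PathL h L m v y

/-- The same, with all points except the last one outside of `S`. -/
def PathAv (h : ℂ → ℂ) (S : Set ℂ) : List (Set ℂ) → ℕ → ℂ → ℂ → Prop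
  | [], n, x, y => 1 ≤ n ∧ h^[n] x = y ∧ ∀ i, 1 ≤ i → i < n → h^[i] x ∉ S
  | B :: L, n, x, y => ∃ k m v, 1 ≤ k ∧ n = k + m ∧ h^[k] x ∈ B ∧ v ∈ B ∧
      (∀ i, 1 ≤ i → i ≤ k → h^[i] x ∉ S) ∧ PathAv h S L m v y

theorem PathL.pos {h : ℂ → ℂ} : ∀ {L : List (Set ℂ)} {n : ℕ} {x y : ℂ}, PathL h L n x y → 1 ≤ n
  | [], _, _, _, hp => hp.1
  | _ :: _, _, _, _, ⟨_, _, _, hk, hn, _, _, _⟩ => by omega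

theorem PathL.split {h : ℂ → ℂ} (S : Set ℂ) : ∀ {L : List (Set ℂ)} {n : ℕ} {x y : ℂ},
    PathL h L n x y → PathAv h S L n x y ∨
      ∃ L' : List (Set ℂ), L' ⊆ L ∧ ∃ n' < n, ∃ y' ∈ S, PathL h L' n' x y' := by
  intro L
  induction L with
  | nil =>
    rintro n x y ⟨h1, h2⟩
    by_cases hc : ∃ i, 1 ≤ i ∧ i < n ∧ h^[i] x ∈ S
    · obtain ⟨i, hi, hin, hS⟩ := hc
      exact Or.inr ⟨[], by simp, i, hin, _, hS, hi, rfl⟩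
    · push Not at hc
      exact Or.inl ⟨h1, h2, hc⟩
  | cons B L ih =>
    rintro n x y ⟨k, m, v, hk, hn, hB, hv, hp⟩
    have hm := hp.pos
    by_cases hc : ∃ i, 1 ≤ i ∧ i ≤ k ∧ h^[i] x ∈ S
    · obtain ⟨i, hi, hin, hS⟩ := hc
      exact Or.inr ⟨[], by simp, i, by omega, _, hS, hi, rfl⟩
    · push Not at hc
      rcases ih hp with h1 | ⟨L', hL', n', hn', y', hy', hp'⟩
      · exact Or.inl ⟨k, m, v, hk, hn, hB, hv, hc, h1⟩
      · refine Or.inr ⟨B :: L', List.cons_subset_cons B hL', k + n', by omega, y', hy', k, n', v,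
          hk, rfl, hB, hv, hp'⟩

theorem PathL.initial_part {h : ℂ → ℂ} {B : Set ℂ} : ∀ {L : List (Set ℂ)} {n : ℕ} {x y : ℂ}, B ∈ L →
    PathL h L n x y → ∃ L' : List (Set ℂ), L' ⊆ L ∧ ∃ n' < n, ∃ u ∈ B, PathL h L' n' x u := by
  intro L
  induction L with
  | nil => intro n x y hB; simp at hB
  | cons A L ih =>
    rintro n x y hB ⟨k, m, v, hk, hn, hA, hv, hp⟩
    have hm := hp.pos
    rcases List.mem_cons.1 hB with rfl | hB
    · exact ⟨[], by simp, k, by omega, _, hA, hk, rfl⟩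
    · obtain ⟨L', hL', n', hn', u, hu, hp'⟩ := ih hB hp
      exact ⟨A :: L', List.cons_subset_cons A hL', k + n', by omega, u, hu, k, n', v, hk, rfl,
        hA, hv, hp'⟩

theorem PathL.suffix {h : ℂ → ℂ} {B : Set ℂ} : ∀ {L : List (Set ℂ)} {n : ℕ} {x y : ℂ}, B ∈ L →
    PathL h L n x y → ∃ L' : List (Set ℂ), L' ⊆ L ∧ ∃ n' < n, ∃ v ∈ B, PathL h L' n' v y := by
  intro L
  induction L with
  | nil => intro n x y hB; simp at hB
  | cons A L ih =>
    rintro n x y hB ⟨k, m, v, hk, hn, hA, hv, hp⟩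
    have hm := hp.pos
    rcases List.mem_cons.1 hB with rfl | hB
    · exact ⟨L, List.subset_cons_self _ _, m, by omega, v, hv, hp⟩
    · obtain ⟨L', hL', n', hn', u, hu, hp'⟩ := ih hB hp
      exact ⟨L', List.Subset.trans hL' (List.subset_cons_self _ _), n', by omega, u, hu, hp'⟩

theorem PathAv.mono {h : ℂ → ℂ} {S S' : Set ℂ} (hS : S' ⊆ S) : ∀ {L : List (Set ℂ)} {n : ℕ}
    {x y : ℂ}, PathAv h S L n x y → PathAv h S' L n x y
  | [], _, _, _, ⟨h1, h2, h3⟩ => ⟨h1, h2, fun i a b hc => h3 i a b (hS hc)⟩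
  | _ :: _, _, _, _, ⟨k, m, v, hk, hn, hA, hv, h3, hp⟩ =>
    ⟨k, m, v, hk, hn, hA, hv, fun i a b hc => h3 i a b (hS hc), hp.mono hS⟩

theorem PathAv.open {h : ℂ → ℂ} {S : Set ℂ} : ∀ {L : List (Set ℂ)} {n : ℕ} {x y : ℂ},
    PathAv h S L n x y → ∃ U, IsOpen U ∧ S ⊆ U ∧ PathAv h U L n x y := by
  intro L
  induction L with
  | nil =>
    rintro n x y ⟨h1, h2, h3⟩
    refine ⟨((fun i => h^[i] x) '' Set.Ico 1 n)ᶜ,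
      ((Set.finite_Ico 1 n).image _).isClosed.isOpen_compl, ?_, h1, h2, fun i a b hc =>
        hc ⟨i, ⟨a, b⟩, rfl⟩⟩
    rintro z hz ⟨i, ⟨a, b⟩, rfl⟩
    exact h3 i a b hz
  | cons B L ih =>
    rintro n x y ⟨k, m, v, hk, hn, hA, hv, h3, hp⟩
    obtain ⟨U, hU, hSU, hp'⟩ := ih hp
    refine ⟨U ∩ ((fun i => h^[i] x) '' Set.Icc 1 k)ᶜ,
      hU.inter ((Set.finite_Icc 1 k).image _).isClosed.isOpen_compl, ?_, k, m, v, hk, hn, hA, hv,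
      fun i a b hc => hc.2 ⟨i, ⟨a, b⟩, rfl⟩, hp'.mono Set.inter_subset_left⟩
    rintro z hz
    refine ⟨hSU hz, ?_⟩
    rintro ⟨i, ⟨a, b⟩, rfl⟩
    exact h3 i a b hz

theorem PathAv.push {h φ : ℂ ≃ₜ ℂ} {O : Set ℂ} (φs : ∀ x, x ∉ O → φ x = x) {x u : ℂ} {k : ℕ}
    (hu : (h.trans φ)^[k] x = u) : ∀ {L : List (Set ℂ)} {m : ℕ} {v y : ℂ}, φ y = x →
    PathAv h O L m v y → PathL (h.trans φ) L (k + m) v u := by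
  intro L
  induction L with
  | nil =>
    rintro m v y hy ⟨h1, h2, h3⟩
    obtain ⟨j, rfl⟩ : ∃ j, m = j + 1 := ⟨m - 1, by omega⟩
    refine ⟨by omega, ?_⟩
    rw [Function.iterate_add_apply, push_iterate_last, h2, hy, hu]
    exact fun i a b => φs _ (h3 i a (by omega))
  | cons B L ih =>
    rintro n v y hy ⟨j, m, w, hj, hn, hA, hv, h3, hp⟩
    refine ⟨j, k + m, w, hj, by omega, ?_, hv, ih hy hp⟩
    rw [push_iterate (fun i a b => φs _ (h3 i a b))]
    exact hA

/-- Compact convex body. -/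
def IsBrick (B : Set ℂ) : Prop := IsCompact B ∧ Convex ℝ B ∧ (interior B).Nonempty

theorem IsBrick.subset_closure {B : Set ℂ} (hB : IsBrick B) : B ⊆ closure (interior B) := by
  rw [hB.2.1.closure_interior_eq_closure_of_nonempty_interior hB.2.2]
  exact _root_.subset_closure

theorem IsBrick.disj {B B' : Set ℂ} (hB' : IsBrick B')
    (hd : Disjoint (interior B) (interior B')) : ∀ z ∈ interior B, z ∉ B' := by
  intro z hz hz'
  obtain ⟨w, hw, hw'⟩ := mem_closure_iff.1 (hB'.subset_closure hz') _ isOpen_interior hz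
  exact Set.disjoint_left.1 hd hw hw'

/-- The neighbourhood of a brick used for pushing. -/
theorem brick_nbhd {h : ℂ ≃ₜ ℂ} {B : Set ℂ} (hB : IsBrick B) (hfr : Free h B) {x y : ℂ}
    (hx : x ∈ B) (hy : y ∈ B) {U W : Set ℂ} (hU : IsOpen U) (hBU : B ⊆ U) (hW : IsOpen W)
    (hxW : x ∈ W) (hyW : y ∈ W) (hBW : interior B ⊆ W) :
    ∃ O, IsOpen O ∧ IsPreconnected O ∧ x ∈ O ∧ y ∈ O ∧ O ⊆ U ∧ O ⊆ W ∧ Free h O := by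
  obtain ⟨V, hV, -, hBV, hVU, hVf⟩ := thin_nbhd hB.1 hB.2.1.isPreconnected hU hBU hfr
  obtain ⟨ε, hε, h1⟩ := Metric.isOpen_iff.1 (hV.inter hW) x ⟨hBV hx, hxW⟩
  obtain ⟨δ, hδ, h2⟩ := Metric.isOpen_iff.1 (hV.inter hW) y ⟨hBV hy, hyW⟩
  have hsub : interior B ∪ Metric.ball x ε ∪ Metric.ball y δ ⊆ V ∩ W := by
    refine Set.union_subset (Set.union_subset ?_ h1) h2
    exact fun z hz => ⟨hBV (interior_subset hz), hBW hz⟩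
  have hcl := hB.subset_closure
  obtain ⟨p, hp, hp'⟩ := mem_closure_iff.1 (hcl hx) _ Metric.isOpen_ball (Metric.mem_ball_self hε)
  obtain ⟨q, hq, hq'⟩ := mem_closure_iff.1 (hcl hy) _ Metric.isOpen_ball (Metric.mem_ball_self hδ)
  refine ⟨interior B ∪ Metric.ball x ε ∪ Metric.ball y δ,
    (isOpen_interior.union Metric.isOpen_ball).union Metric.isOpen_ball, ?_,
    Or.inl (Or.inr (Metric.mem_ball_self hε)), Or.inr (Metric.mem_ball_self hδ),
    fun z hz => hVU (hsub hz).1, fun z hz => (hsub hz).2,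
    fun z hz hz' => hVf z (hsub hz).1 (hsub hz').1⟩
  refine IsPreconnected.union q (Or.inl hq') hq (IsPreconnected.union p hp' hp ?_ ?_) ?_
  · exact hB.2.1.interior.isPreconnected
  · exact (convex_ball _ _).isPreconnected
  · exact (convex_ball _ _).isPreconnected

theorem franks_aux (n : ℕ) : ∀ (L : List (Set ℂ)) (h : ℂ ≃ₜ ℂ) (B0 : Set ℂ), Iso h →
    (∀ z, h z ≠ z) → (∀ B ∈ B0 :: L, IsBrick B ∧ Free h B) →
    (∀ B ∈ B0 :: L, ∀ B' ∈ B0 :: L, B ≠ B' → Disjoint (interior B) (interior B')) →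
    ∀ x ∈ B0, ∀ y ∈ B0, ¬ PathL h L n x y := by
  induction n using Nat.strong_induction_on with
  | _ n IH =>
  intro L
  induction L with
  | nil =>
    intro h B0 hI hf hb hd x hx y hy hp
    have hB0 := hb B0 (by simp)
    rcases hp.split B0 with hav | ⟨L', hL', n', hn', y', hy', hp'⟩
    · obtain ⟨U, hU, hBU, hav⟩ := hav.open
      obtain ⟨O, hO, hOc, hxO, hyO, hOU, -, hOf⟩ := brick_nbhd hB0.1 hB0.2 hx hy hU hBU isOpen_univ
        trivial trivial (Set.subset_univ _)
      obtain ⟨φ, φI, φs, φe⟩ := push hO hOc hyO hxO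
      have := (hav.mono hOU).push φs (k := 0) (x := x) (u := x) rfl φe
      rw [zero_add] at this
      exact brouwer n this.1 (h.trans φ) (Iso.comp φI hI :) (push_fpf hf hOf φs) x this.2
    · have : L' = [] := by simpa using hL'
      subst this
      exact IH n' hn' [] h B0 hI hf hb hd x hx y' hy' hp'
  | cons B1 L ihL =>
    intro h B0 hI hf hb hd x hx y hy hp
    have hB0 := hb B0 (by simp)
    have short : ∀ L' : List (Set ℂ), L' ⊆ B1 :: L → ∀ B ∈ B0 :: B1 :: L, ∀ n' < n,
        ∀ x ∈ B, ∀ y ∈ B, ¬ PathL h L' n' x y := by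
      intro L' hL' B hB n' hn'
      have hs : ∀ A ∈ B :: L', A ∈ B0 :: B1 :: L := by
        intro A hA
        rcases List.mem_cons.1 hA with rfl | hA
        · exact hB
        · exact List.mem_cons_of_mem _ (hL' hA)
      exact IH n' hn' L' h B hI hf (fun A hA => hb A (hs A hA))
        (fun A hA A' hA' => hd A (hs A hA) A' (hs A' hA'))
    have hxB : ∀ B ∈ B1 :: L, x ∉ B := by
      intro B hB hxB
      obtain ⟨L', hL', n', hn', u, hu, hp'⟩ := hp.initial_part hB
      exact short L' hL' B (List.mem_cons_of_mem _ hB) n' hn' x hxB u hu hp'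
    have hyB : ∀ B ∈ B1 :: L, y ∉ B := by
      intro B hB hyB
      obtain ⟨L', hL', n', hn', u, hu, hp'⟩ := hp.suffix hB
      exact short L' hL' B (List.mem_cons_of_mem _ hB) n' hn' u hu y hyB hp'
    rcases hp.split B0 with hav | ⟨L', hL', n', hn', y', hy', hp'⟩
    · obtain ⟨U, hU, hBU, hav⟩ := hav.open
      have hW : IsOpen (⋃ B ∈ {B | B ∈ B1 :: L}, B)ᶜ := by
        refine isOpen_compl_iff.2 ?_
        apply Set.Finite.isClosed_biUnion
        · exact List.finite_toSet (B1 :: L)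
        · exact fun B hB => (hb B (List.mem_cons_of_mem _ hB)).1.1.isClosed
      obtain ⟨O, hO, hOc, hxO, hyO, hOU, hOW, hOf⟩ := brick_nbhd hB0.1 hB0.2 hx hy hU hBU hW
        (by
          simp only [Set.mem_compl_iff, Set.mem_iUnion, not_exists]
          exact hxB)
        (by
          simp only [Set.mem_compl_iff, Set.mem_iUnion, not_exists]
          exact hyB)
        (by
          intro z hz
          simp only [Set.mem_compl_iff, Set.mem_iUnion, not_exists]
          intro B hB
          refine (hb B (List.mem_cons_of_mem _ hB)).1.disj (hd B0 (by simp) B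
            (List.mem_cons_of_mem _ hB) ?_) z hz
          rintro rfl
          exact hxB _ hB hx)
      obtain ⟨φ, φI, φs, φe⟩ := push hO hOc hyO hxO
      obtain ⟨k, m, v, hk, hn, hA, hv, h3, hp⟩ := hav.mono hOU
      have hu : (h.trans φ)^[k] x = h^[k] x := push_iterate (fun i a b => φs _ (h3 i a b))
      have hp' := hp.push φs hu φe
      rw [← hn] at hp'
      refine ihL (h.trans φ) B1 (Iso.comp φI hI :) (push_fpf hf hOf φs) ?_
        (fun B hB B' hB' => hd B (List.mem_cons_of_mem _ hB) B' (List.mem_cons_of_mem _ hB'))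
        v hv _ hA hp'
      intro B hB
      refine ⟨(hb B (List.mem_cons_of_mem _ hB)).1, fun z hz hz' => ?_⟩
      have hBO : ∀ w ∈ B, w ∉ O := by
        intro w hw hwO
        have := hOW hwO
        simp only [Set.mem_compl_iff, Set.mem_iUnion, not_exists] at this
        exact this B hB hw
      rw [Homeomorph.trans_apply] at hz'
      have h1 : h z ∉ O := fun hm => hBO _ hz' (supp_maps φs hm)
      rw [φs _ h1] at hz'
      exact (hb B (List.mem_cons_of_mem _ hB)).2 z hz hz'
    · exact short L' hL' B0 (by simp) n' hn' x hx y' hy' hp'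

/-- The brick relation. -/
def brel (h : ℂ → ℂ) (P : Set (Set ℂ)) (B B' : Set ℂ) : Prop :=
  B ∈ P ∧ B' ∈ P ∧ ∃ z ∈ B, h z ∈ B'

/-- Franks lemma for bricks. -/
theorem franks_bricks {h : ℂ ≃ₜ ℂ} (hI : Iso h) (hf : ∀ z, h z ≠ z) {P : Set (Set ℂ)}
    (hP : ∀ B ∈ P, IsBrick B ∧ Free h B)
    (hd : ∀ B ∈ P, ∀ B' ∈ P, B ≠ B' → Disjoint (interior B) (interior B')) (B : Set ℂ) :
    ¬ Relation.TransGen (brel h P) B B := by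
  have key : ∀ A, Relation.TransGen (brel h P) A B → A ∈ P ∧ B ∈ P ∧ ∃ x ∈ A, ∃ y ∈ B,
      ∃ L : List (Set ℂ), (∀ C ∈ L, C ∈ P) ∧ ∃ n, PathL h L n x y := by
    intro A hA
    induction hA using Relation.TransGen.head_induction_on with
    | single hr =>
      obtain ⟨h1, h2, z, hz, hz'⟩ := hr
      exact ⟨h1, h2, z, hz, _, hz', [], by simp, 1, le_rfl, rfl⟩
    | head hr _ ih =>
      obtain ⟨h1, h2, z, hz, hz'⟩ := hr
      obtain ⟨h3, h4, x, hx, y, hy, L, hL, n, hp⟩ := ih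
      refine ⟨h1, h4, z, hz, y, hy, _ :: L, ?_, 1 + n, 1, n, x, le_rfl, rfl, hz', hx, hp⟩
      intro C hC
      rcases List.mem_cons.1 hC with rfl | hC
      · exact h2
      · exact hL C hC
  intro hc
  obtain ⟨h1, -, x, hx, y, hy, L, hL, n, hp⟩ := key B hc
  have hs : ∀ A ∈ B :: L, A ∈ P := by
    intro C hC
    rcases List.mem_cons.1 hC with rfl | hC
    · exact h1
    · exact hL C hC
  exact franks_aux n L h B hI hf (fun A hA => hP A (hs A hA))
    (fun A hA A' hA' => hd A (hs A hA) A' (hs A' hA')) x hx y hy hp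

end FLC

namespace FLC

theorem per_nat {f : ℝ → ℂ} {m : ℝ} (h : ∀ s, f (s + 1) = f s + m) (n : ℕ) (s : ℝ) :
    f (s + n) = f s + n * m := by
  induction n with
  | zero => simp
  | succ n ih => push_cast; rw [← add_assoc, h, ih]; ring

/-- The angle function argument: moving separation. -/
theorem sep_pos (Λ : ℝ × ℝ → ℂ) (hΛ : Continuous Λ) (σ : ℝ → ℂ) (hσ : Continuous σ) (m : ℝ)
    (hm : 0 < m) (hper : ∀ t s, Λ (t, s + 1) = Λ (t, s) + m) (hne : ∀ t s, Λ (t, s) ≠ σ t)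
    (h0 : ∀ s, (Λ (0, s)).im < (σ 0).im) (h1 : ∀ s, (σ 1).im < (Λ (1, s)).im) : False := by
  obtain ⟨M, Mc, hM⟩ := log_lift_RR (fun p => Λ p - σ p.1) (by fun_prop)
    (fun p => sub_ne_zero.2 (hne p.1 p.2))
  obtain ⟨C, hC⟩ := isCompact_Icc.exists_bound_of_continuousOn (s := Set.Icc (0 : ℝ) 1)
    (f := fun t => Λ (t, 0) - σ t) (by fun_prop)
  obtain ⟨N, hN⟩ := exists_nat_gt (C / m)
  have hN : C < N * m := by rwa [div_lt_iff₀ hm] at hN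
  have eN : ∀ t, Λ (t, N) = Λ (t, 0) + N * m := fun t => by
    have := per_nat (f := fun s => Λ (t, s)) (hper t) N 0
    simpa using this
  have eN' : ∀ t, Λ (t, -N) = Λ (t, 0) - N * m := fun t => by
    have := per_nat (f := fun s => Λ (t, s)) (hper t) N (-N)
    simp only [neg_add_cancel] at this
    rw [this]; ring
  let D : ℝ → ℂ := fun t => M (t, N) - M (t, -N)
  have Dc : Continuous D := by fun_prop
  let a : ℝ → ℂ := fun t => Λ (t, 0) - σ t
  have aN : ∀ t, a t - N * m ≠ 0 := fun t => by
    have := hne t (-N)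
    rw [eN', ← sub_ne_zero] at this
    simpa [a, sub_right_comm] using this
  have hD : ∀ t, Complex.exp (D t) = (a t + N * m) / (a t - N * m) := fun t => by
    simp only [D]
    rw [Complex.exp_sub, hM, hM]
    simp only [eN, eN', a]
    congr 1 <;> ring
  have hDre : ∀ t, (Complex.exp (D t)).re =
      (‖a t‖ ^ 2 - (N * m) ^ 2) / Complex.normSq (a t - N * m) := fun t => by
    rw [hD, Complex.div_re, ← add_div, Complex.sq_norm, Complex.normSq_apply (a t)]
    congr 1
    simp
    ring
  have hDim : ∀ t, (Complex.exp (D t)).im =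
      (-2 * (N * m) * (a t).im) / Complex.normSq (a t - N * m) := fun t => by
    rw [hD, Complex.div_im, ← sub_div]
    congr 1
    simp
    ring
  have hNm : 0 < N * m := lt_of_le_of_lt ((norm_nonneg _).trans (hC 0 (by simp))) hN
  have hsq : ∀ t, 0 < Complex.normSq (a t - N * m) := fun t => Complex.normSq_pos.2 (aN t)
  have hneg : ∀ t ∈ Set.Icc (0 : ℝ) 1, (Complex.exp (D t)).re < 0 := fun t ht => by
    rw [hDre]
    apply div_neg_of_neg_of_pos _ (hsq t)
    have h2 := hC t ht
    have h3 : ‖a t‖ < N * m := lt_of_le_of_lt h2 hN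
    nlinarith [norm_nonneg (a t)]
  -- the end points
  have slit : ∀ t, (∀ s, Λ (t, s) - σ t ∈ Complex.slitPlane) →
      D t = Complex.log (Λ (t, N) - σ t) - Complex.log (Λ (t, -N) - σ t) := fun t ht => by
    have := exp_const (fun s : ℝ => M (t, s) - Complex.log (Λ (t, s) - σ t))
      (by
        refine Continuous.sub (by fun_prop) (Continuous.clog (by fun_prop) ht)) 1 (fun s => by
        rw [Complex.exp_sub, hM, Complex.exp_log (sub_ne_zero.2 (hne t s)),
          div_self (sub_ne_zero.2 (hne t s))]) N (-N)
    simp only [D]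
    linear_combination this
  have d0 : 0 < (D 0).im := by
    have him : ∀ s, (Λ (0, s) - σ 0).im < 0 := fun s => by
      rw [Complex.sub_im]; linarith [h0 s]
    have e := slit 0 (fun s => Or.inr (him s).ne)
    have hi : (D 0).im = (Λ (0, N) - σ 0).arg - (Λ (0, -N) - σ 0).arg := by
      rw [e, Complex.sub_im, Complex.log_im, Complex.log_im]
    have b1 := Complex.arg_neg_iff.2 (him N)
    have b2 := Complex.arg_neg_iff.2 (him (-N))
    have b3 := Complex.neg_pi_lt_arg (Λ (0, N) - σ 0)
    have b4 := Complex.neg_pi_lt_arg (Λ (0, -N) - σ 0)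
    have hp : 0 < (Complex.exp (D 0)).im := by
      rw [hDim]
      have := him 0
      apply div_pos _ (hsq 0)
      have h5 : (a 0).im < 0 := this
      nlinarith
    by_contra hn
    push Not at hn
    rw [Complex.exp_im] at hp
    have : Real.sin (D 0).im ≤ 0 := Real.sin_nonpos_of_nonpos_of_neg_pi_le hn (by
      rw [hi]; linarith)
    nlinarith [Real.exp_pos (D 0).re]
  have d1 : (D 1).im < 0 := by
    have him : ∀ s, 0 < (Λ (1, s) - σ 1).im := fun s => by
      rw [Complex.sub_im]; linarith [h1 s]
    have e := slit 1 (fun s => Or.inr (him s).ne')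
    have hi : (D 1).im = (Λ (1, N) - σ 1).arg - (Λ (1, -N) - σ 1).arg := by
      rw [e, Complex.sub_im, Complex.log_im, Complex.log_im]
    have b1 := Complex.arg_nonneg_iff.2 (him N).le
    have b2 := Complex.arg_nonneg_iff.2 (him (-N)).le
    have b3 := Complex.arg_le_pi (Λ (1, N) - σ 1)
    have b4 := Complex.arg_le_pi (Λ (1, -N) - σ 1)
    have hp : (Complex.exp (D 1)).im < 0 := by
      rw [hDim]
      have := him 0
      apply div_neg_of_neg_of_pos _ (hsq 1)
      have h5 : 0 < (a 1).im := this
      nlinarith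
    by_contra hn
    push Not at hn
    rw [Complex.exp_im] at hp
    have : 0 ≤ Real.sin (D 1).im := Real.sin_nonneg_of_nonneg_of_le_pi hn (by
      rw [hi]; linarith)
    nlinarith [Real.exp_pos (D 1).re]
  obtain ⟨t, ht, h0t⟩ := intermediate_value_Icc' zero_le_one
    (Complex.continuous_im.comp Dc).continuousOn ⟨d1.le, d0.le⟩
  have := hneg t ht
  rw [Complex.exp_re] at this
  have h0t : (D t).im = 0 := h0t
  rw [h0t, Real.cos_zero] at this
  linarith [Real.exp_pos (D t).re]

theorem sep_ne (Λ : ℝ × ℝ → ℂ) (hΛ : Continuous Λ) (σ : ℝ → ℂ) (hσ : Continuous σ) (m : ℝ)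
    (hm : m ≠ 0) (hper : ∀ t s, Λ (t, s + 1) = Λ (t, s) + m) (hne : ∀ t s, Λ (t, s) ≠ σ t)
    (h0 : ∀ s, (Λ (0, s)).im < (σ 0).im) (h1 : ∀ s, (σ 1).im < (Λ (1, s)).im) : False := by
  rcases lt_or_gt_of_ne hm with hm | hm
  · refine sep_pos (fun p => Λ (p.1, -p.2)) (by fun_prop) σ hσ (-m) (by linarith) ?_
      (fun t s => hne t _) (fun s => h0 _) (fun s => h1 _)
    intro t s
    have := hper t (-(s + 1))
    simp only [neg_add_rev, neg_add_cancel_comm] at this ⊢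
    rw [this]
    push_cast
    ring
  · exact sep_pos Λ hΛ σ hσ m hm hper hne h0 h1

theorem sep_ne' (Λ : ℝ × ℝ → ℂ) (hΛ : Continuous Λ) (σ : ℝ → ℂ) (hσ : Continuous σ) (m : ℝ)
    (hm : m ≠ 0) (hper : ∀ t s, Λ (t, s + 1) = Λ (t, s) + m) (hne : ∀ t s, Λ (t, s) ≠ σ t)
    (h0 : ∀ s, (σ 0).im < (Λ (0, s)).im) (h1 : ∀ s, (Λ (1, s)).im < (σ 1).im) : False :=
  sep_ne (fun p => Λ (1 - p.1, p.2)) (by fun_prop) (fun t => σ (1 - t)) (by fun_prop) m hm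
    (fun t s => hper _ s) (fun t s => hne _ s) (fun s => by simpa using h1 s)
    (fun s => by simpa using h0 s)

/-- Static separation. -/
theorem sep_static {l : ℝ → ℂ} (hl : Continuous l) {m : ℝ} (hm : m ≠ 0)
    (hper : ∀ s, l (s + 1) = l s + m) {K : Set ℂ} (hK : ∀ s, l s ∉ K) {a b : ℂ}
    (hab : JoinedIn K a b) (ha : ∀ s, (l s).im < a.im) (hb : ∀ s, b.im < (l s).im) : False := by
  obtain ⟨γ, hγ⟩ := hab
  refine sep_ne (fun p => l p.2) (by fun_prop) γ.extend γ.continuous_extend m hm (fun t s => hper s)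
    (fun t s e => hK s ?_) (by simpa using ha) (by simpa using hb)
  rw [e]
  have : γ.extend t ∈ Set.range γ := by
    rw [← γ.extend_range]; exact ⟨t, rfl⟩
  obtain ⟨u, hu⟩ := this
  rw [← hu]; exact hγ u

/-- Equivariant isotopy. -/
def IsoT (h : ℂ → ℂ) : Prop :=
  ∃ H : ℝ × ℂ → ℂ, Continuous H ∧ (∀ z, H (0, z) = z) ∧ (∀ z, H (1, z) = h z) ∧
    (∀ t, Function.Injective (fun z => H (t, z))) ∧ ∀ t z, H (t, z + 1) = H (t, z) + 1

theorem IsoT.iso {h : ℂ → ℂ} (hh : IsoT h) : Iso h := by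
  obtain ⟨H, a, b, c, d, e⟩ := hh
  exact ⟨H, a, b, c, d⟩

theorem IsoT.comm {h : ℂ → ℂ} (hh : IsoT h) (z : ℂ) : h (z + 1) = h z + 1 := by
  obtain ⟨H, a, b, c, d, e⟩ := hh
  rw [← c, e, c]

theorem IsoT.comp {g h : ℂ → ℂ} (hg : IsoT g) (hh : IsoT h) : IsoT (fun z => g (h z)) := by
  obtain ⟨H, hc, h0, h1, hi, he⟩ := hg
  obtain ⟨H', hc', h0', h1', hi', he'⟩ := hh
  refine ⟨fun p => H (p.1, H' p), by fun_prop, fun z => by simp [h0, h0'], fun z => by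
    simp [h1, h1'], fun t => ?_, fun t z => ?_⟩
  · exact (hi t).comp (hi' t)
  · simp only [he, he']

theorem IsoT.iterate {g : ℂ → ℂ} (hg : IsoT g) (n : ℕ) : IsoT (g^[n]) := by
  induction n with
  | zero => exact ⟨fun p => p.2, by fun_prop, fun z => rfl, fun z => rfl, fun t a b h => h,
      fun t z => rfl⟩
  | succ n ih => have h := IsoT.comp ih hg; exact h

theorem IsoT.translate (c : ℂ) : IsoT (fun z => z + c) :=
  ⟨fun p => p.2 + p.1 * c, by fun_prop, fun z => by simp, fun z => by simp, fun t a b h => by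
    simpa using h, fun t z => by simp only; ring⟩

theorem comm_int {f : ℂ → ℂ} (hf : ∀ z, f (z + 1) = f z + 1) (n : ℤ) (z : ℂ) :
    f (z + n) = f z + n := by
  induction n using Int.induction_on with
  | zero => simp
  | succ n ih => push_cast at ih ⊢; rw [← add_assoc, hf, ih]; ring
  | pred n ih =>
    have := hf (z + (-n - 1))
    rw [show z + (-(n : ℂ) - 1) + 1 = z + -n by ring] at this
    push_cast at ih ⊢
    rw [ih] at this
    linear_combination -this

theorem reduce_re (z : ℂ) : ∃ n : ℤ, (z + n).re ∈ Set.Icc (0 : ℝ) 1 := by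
  refine ⟨-⌊z.re⌋, ?_⟩
  have h1 := Int.floor_le z.re
  have h2 := Int.lt_floor_add_one z.re
  simp only [Complex.add_re, Complex.neg_re, Complex.intCast_re, Int.cast_neg]
  constructor <;> linarith

theorem box_compact (a b c d : ℝ) : IsCompact {z : ℂ | z.re ∈ Set.Icc a b ∧ z.im ∈ Set.Icc c d} := by
  have h : {z : ℂ | z.re ∈ Set.Icc a b ∧ z.im ∈ Set.Icc c d}
      = Complex.equivRealProdCLM.toHomeomorph.symm '' (Set.Icc a b ×ˢ Set.Icc c d) := by
    ext z
    constructor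
    · intro hz
      exact ⟨(z.re, z.im), hz, by apply Complex.ext <;> simp⟩
    · rintro ⟨w, hw, rfl⟩
      obtain ⟨hw1, hw2⟩ := hw
      exact ⟨by simpa using hw1, by simpa using hw2⟩
  rw [h]
  exact (isCompact_Icc.prod isCompact_Icc).image (Homeomorph.continuous _)

/-- Behaviour at the ends. -/
def EndsOK (f : ℂ → ℂ) : Prop :=
  (∀ M : ℝ, ∃ M' : ℝ, ∀ w : ℂ, M' < w.im → M < (f w).im) ∧
  (∀ M : ℝ, ∃ M' : ℝ, ∀ w : ℂ, w.im < M' → (f w).im < M)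

theorem EndsOK.comp {f g : ℂ → ℂ} (hf : EndsOK f) (hg : EndsOK g) : EndsOK (fun z => f (g z)) := by
  constructor
  · intro M
    obtain ⟨M1, h1⟩ := hf.1 M
    obtain ⟨M2, h2⟩ := hg.1 M1
    exact ⟨M2, fun w hw => h1 _ (h2 w hw)⟩
  · intro M
    obtain ⟨M1, h1⟩ := hf.2 M
    obtain ⟨M2, h2⟩ := hg.2 M1
    exact ⟨M2, fun w hw => h1 _ (h2 w hw)⟩

theorem EndsOK.iterate {f : ℂ → ℂ} (hf : EndsOK f) (n : ℕ) : EndsOK (f^[n]) := by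
  induction n with
  | zero => exact ⟨fun M => ⟨M, fun w h => h⟩, fun M => ⟨M, fun w h => h⟩⟩
  | succ n ih => have h := EndsOK.comp ih hf; exact h

theorem symm_comm {f : ℂ ≃ₜ ℂ} (hf : ∀ z, f (z + 1) = f z + 1) (z : ℂ) :
    f.symm (z + 1) = f.symm z + 1 := by
  apply f.injective; rw [hf]; simp

/-- Properness: preimages of horizontal bands lie in bands. -/
theorem band_proper {f : ℂ ≃ₜ ℂ} (hf : ∀ z, f (z + 1) = f z + 1) (R : ℝ) :
    ∃ R' : ℝ, ∀ w : ℂ, |(f w).im| ≤ R → |w.im| ≤ R' := by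
  obtain ⟨C, hC⟩ := (box_compact 0 1 (-R) R).exists_bound_of_continuousOn
    (f := fun z => ((f.symm z).im : ℝ))
    (Complex.continuous_im.comp f.symm.continuous).continuousOn
  refine ⟨C, fun w hw => ?_⟩
  obtain ⟨n, hn⟩ := reduce_re (f w)
  have := hC (f w + n) ⟨hn, by simpa [abs_le] using hw⟩
  rw [comm_int (symm_comm hf)] at this
  simpa using this

theorem IsoT.ends {f : ℂ ≃ₜ ℂ} (hf : IsoT f) : EndsOK f := by
  have hcomm := hf.comm
  obtain ⟨c, hc⟩ : ∃ c : ℝ, ∀ s : ℝ, |(f s).im| ≤ c := by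
    obtain ⟨C, hC⟩ := (isCompact_Icc (a := (0 : ℝ)) (b := 1)).exists_bound_of_continuousOn
      (f := fun s : ℝ => ((f (s : ℂ)).im : ℝ)) (by
        have : Continuous fun s : ℝ => ((f (s : ℂ)).im : ℝ) := by fun_prop
        exact this.continuousOn)
    refine ⟨C, fun s => ?_⟩
    obtain ⟨n, hn⟩ := reduce_re (s : ℂ)
    have h1 := hC (s + n) (by simpa using hn)
    push_cast at h1
    rw [comm_int hcomm] at h1
    simpa using h1
  obtain ⟨H, Hc, H0, H1, Hi, He⟩ := hf
  have A1 : ∀ w : ℂ, 0 < w.im → -c ≤ (f w).im := by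
    intro w hw
    by_contra hn
    push Not at hn
    refine sep_ne (fun p => H (p.1, (p.2 : ℂ))) (by fun_prop) (fun t => H (t, w)) (by fun_prop) 1
      one_ne_zero (fun t s => by push_cast; exact He t s) (fun t s e => ?_) (fun s => ?_)
      (fun s => ?_)
    · have := Hi t e
      rw [← this] at hw
      simp at hw
    · simp only [H0]; simpa using hw
    · simp only [H1]; have := abs_le.1 (hc s); linarith
  have A2 : ∀ w : ℂ, w.im < 0 → (f w).im ≤ c := by
    intro w hw
    by_contra hn
    push Not at hn
    refine sep_ne' (fun p => H (p.1, (p.2 : ℂ))) (by fun_prop) (fun t => H (t, w)) (by fun_prop) 1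
      one_ne_zero (fun t s => by push_cast; exact He t s) (fun t s e => ?_) (fun s => ?_)
      (fun s => ?_)
    · have := Hi t e
      rw [← this] at hw
      simp at hw
    · simp only [H0]; simpa using hw
    · simp only [H1]; have := abs_le.1 (hc s); linarith
  constructor
  · intro M
    obtain ⟨R', hR'⟩ := band_proper hcomm (max c M)
    refine ⟨max 0 R', fun w hw => ?_⟩
    by_contra hn
    push Not at hn
    have h1 := A1 w ((le_max_left _ _).trans_lt hw)
    have h2 := hR' w (abs_le.2 ⟨by linarith [le_max_left c M], by linarith [le_max_right c M]⟩)
    have := le_abs_self w.im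
    linarith [le_max_right 0 R']
  · intro M
    obtain ⟨R', hR'⟩ := band_proper hcomm (max c (-M))
    refine ⟨min 0 (-R'), fun w hw => ?_⟩
    by_contra hn
    push Not at hn
    have h1 := A2 w (hw.trans_le (min_le_left _ _))
    have h2 := hR' w (abs_le.2 ⟨by linarith [le_max_right c (-M)], by linarith [le_max_left c (-M)]⟩)
    have := neg_abs_le w.im
    linarith [min_le_right 0 (-R')]

theorem EndsOK.symm {f : ℂ ≃ₜ ℂ} (hcomm : ∀ z, f (z + 1) = f z + 1) (hf : EndsOK f) :
    EndsOK f.symm := by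
  constructor
  · intro M
    obtain ⟨R, hR⟩ := band_proper (symm_comm hcomm) (|M|)
    obtain ⟨M2, h2⟩ := hf.2 0
    obtain ⟨R2, hR2⟩ := band_proper (symm_comm hcomm) (|M2|)
    refine ⟨max 0 (max R R2), fun w hw => ?_⟩
    by_contra hn
    push Not at hn
    have a1 := (le_max_left _ _).trans_lt hw
    have a2 := ((le_max_left _ _).trans (le_max_right _ _)).trans_lt hw
    have a3 := ((le_max_right _ _).trans (le_max_right _ _)).trans_lt hw
    have b1 : |M| < |(f.symm w).im| := by
      by_contra hh
      push Not at hh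
      have := hR w hh
      linarith [le_abs_self w.im]
    have b2 : |M2| < |(f.symm w).im| := by
      by_contra hh
      push Not at hh
      have := hR2 w hh
      linarith [le_abs_self w.im]
    have b3 : (f.symm w).im < 0 := by
      by_contra hh
      push Not at hh
      rw [abs_of_nonneg hh] at b1
      linarith [le_abs_self M]
    rw [abs_of_neg b3] at b2
    have := h2 (f.symm w) (by linarith [neg_abs_le M2])
    simp at this
    linarith
  · intro M
    obtain ⟨R, hR⟩ := band_proper (symm_comm hcomm) (|M|)
    obtain ⟨M2, h2⟩ := hf.1 0
    obtain ⟨R2, hR2⟩ := band_proper (symm_comm hcomm) (|M2|)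
    refine ⟨min 0 (min (-R) (-R2)), fun w hw => ?_⟩
    by_contra hn
    push Not at hn
    have a1 := hw.trans_le (min_le_left _ _)
    have a2 := hw.trans_le ((min_le_right _ _).trans (min_le_left _ _))
    have a3 := hw.trans_le ((min_le_right _ _).trans (min_le_right _ _))
    have b1 : |M| < |(f.symm w).im| := by
      by_contra hh
      push Not at hh
      have := hR w hh
      linarith [neg_abs_le w.im]
    have b2 : |M2| < |(f.symm w).im| := by
      by_contra hh
      push Not at hh
      have := hR2 w hh
      linarith [neg_abs_le w.im]
    have b3 : 0 < (f.symm w).im := by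
      by_contra hh
      push Not at hh
      rw [abs_of_nonpos hh] at b1
      linarith [neg_abs_le M]
    rw [abs_of_pos b3] at b2
    have := h2 (f.symm w) (by linarith [le_abs_self M2])
    simp at this
    linarith

end FLC

namespace FLC

/-- integer translate of a set -/
def tr (j : ℤ) (B : Set ℂ) : Set ℂ := {z | z - j ∈ B}

theorem mem_tr {j : ℤ} {B : Set ℂ} {z : ℂ} : z ∈ tr j B ↔ z - j ∈ B := Iff.rfl

theorem add_mem_tr {j : ℤ} {B : Set ℂ} {z : ℂ} : z + j ∈ tr j B ↔ z ∈ B := by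
  rw [mem_tr, add_sub_cancel_right]

theorem tr_tr (i j : ℤ) (B : Set ℂ) : tr i (tr j B) = tr (i + j) B := by
  ext z; simp only [mem_tr]; push_cast; rw [sub_sub]

theorem tr_zero (B : Set ℂ) : tr 0 B = B := by ext z; simp [mem_tr]

structure BrickSys (G : ℂ ≃ₜ ℂ) (P : Set (Set ℂ)) : Prop where
  brick : ∀ B ∈ P, IsBrick B ∧ Free G B
  disj : ∀ B ∈ P, ∀ B' ∈ P, B ≠ B' → Disjoint (interior B) (interior B')
  cover : ∀ z, ∃ B ∈ P, z ∈ B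
  loc : ∀ y, ∃ O ∈ 𝓝 y, ∀ B ∈ P, (∃ w ∈ O, w ∈ B) → y ∈ B
  trans : ∀ B ∈ P, ∀ j, tr j B ∈ P
  comm : ∀ z, G (z + 1) = G z + 1

theorem BrickSys.symm {G : ℂ ≃ₜ ℂ} {P : Set (Set ℂ)} (h : BrickSys G P) : BrickSys G.symm P where
  brick := fun B hB => ⟨(h.brick B hB).1, fun z hz hz' => (h.brick B hB).2 _ hz' (by simpa using hz)⟩
  disj := h.disj
  cover := h.cover
  loc := h.loc
  trans := h.trans
  comm := symm_comm h.comm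

theorem brel_symm {G : ℂ ≃ₜ ℂ} {P : Set (Set ℂ)} {B B' : Set ℂ} :
    brel G.symm P B B' ↔ brel G P B' B := by
  constructor
  · rintro ⟨h1, h2, z, hz, hz'⟩
    exact ⟨h2, h1, _, hz', by simpa using hz⟩
  · rintro ⟨h1, h2, z, hz, hz'⟩
    exact ⟨h2, h1, _, hz', by simpa using hz⟩

theorem BrickSys.brel_tr {G : ℂ ≃ₜ ℂ} {P : Set (Set ℂ)} (h : BrickSys G P) {B B' : Set ℂ} (j : ℤ)
    (hr : brel G P B B') : brel G P (tr j B) (tr j B') := by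
  obtain ⟨h1, h2, z, hz, hz'⟩ := hr
  refine ⟨h.trans _ h1 j, h.trans _ h2 j, z + j, add_mem_tr.2 hz, ?_⟩
  rw [comm_int h.comm]; exact add_mem_tr.2 hz'

theorem BrickSys.tg_tr {G : ℂ ≃ₜ ℂ} {P : Set (Set ℂ)} (h : BrickSys G P) {B B' : Set ℂ} (j : ℤ)
    (hr : Relation.TransGen (brel G P) B B') :
    Relation.TransGen (brel G P) (tr j B) (tr j B') :=
  Relation.TransGen.lift (tr j) (fun _ _ => h.brel_tr j) _ _ hr

theorem BrickSys.rtg_tr {G : ℂ ≃ₜ ℂ} {P : Set (Set ℂ)} (h : BrickSys G P) {B B' : Set ℂ} (j : ℤ)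
    (hr : Relation.ReflTransGen (brel G P) B B') :
    Relation.ReflTransGen (brel G P) (tr j B) (tr j B') :=
  Relation.ReflTransGen.lift (tr j) (fun _ _ => h.brel_tr j) _ _ hr

/-- A point of a brick whose `L`-th iterate lies in another brick gives a chain. -/
theorem BrickSys.chain {G : ℂ ≃ₜ ℂ} {P : Set (Set ℂ)} (h : BrickSys G P) {B' : Set ℂ}
    (hB' : B' ∈ P) (L : ℕ) : ∀ {B : Set ℂ} {z : ℂ}, B ∈ P → z ∈ B → G^[L + 1] z ∈ B' →
    Relation.TransGen (brel G P) B B' := by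
  induction L with
  | zero => exact fun hB hz hz' => Relation.TransGen.single ⟨hB, hB', _, hz, hz'⟩
  | succ L ih =>
    intro B z hB hz hz'
    obtain ⟨C, hC, hzC⟩ := h.cover (G z)
    exact Relation.TransGen.head ⟨hB, hC, z, hz, hzC⟩ (ih hC hzC hz')

theorem zero_mem_of_pos_neg {S : Set ℤ} (hS : ∀ x ∈ S, ∀ y ∈ S, x + y ∈ S) {p n : ℤ}
    (hp : p ∈ S) (hn : n ∈ S) (hp0 : 0 < p) (hn0 : n < 0) : (0 : ℤ) ∈ S := by
  have key : ∀ x ∈ S, ∀ k : ℕ, ((k : ℤ) + 1) * x ∈ S := by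
    intro x hx k
    induction k with
    | zero => simpa using hx
    | succ k ih =>
      have := hS _ ih _ hx
      push_cast
      convert this using 1
      ring
  obtain ⟨a, ha⟩ : ∃ a : ℕ, p = a + 1 := ⟨(p - 1).toNat, by omega⟩
  obtain ⟨b, hb⟩ : ∃ b : ℕ, -n = b + 1 := ⟨(-n - 1).toNat, by omega⟩
  have := hS _ (key p hp b) _ (key n hn a)
  rw [← ha, ← hb] at this
  convert this using 1
  ring

theorem BrickSys.not_both {G : ℂ ≃ₜ ℂ} {P : Set (Set ℂ)} (h : BrickSys G P) (hI : Iso G)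
    (hf : ∀ z, G z ≠ z) {b d : Set ℂ} (hne : ∀ j, tr j b ≠ d) {m1 m2 : ℤ}
    (hm1 : m1 < 0) (hm2 : 0 < m2)
    (h1 : Relation.TransGen (brel G P) b (tr m1 b)) (h2 : Relation.TransGen (brel G P) d (tr m2 d))
    {i j k l : ℤ} (h3 : Relation.ReflTransGen (brel G P) (tr i b) (tr j d))
    (h4 : Relation.ReflTransGen (brel G P) (tr k d) (tr l b)) : False := by
  have cyc := franks_bricks hI hf h.brick h.disj
  have hadd : ∀ c : Set ℂ, ∀ x ∈ {s : ℤ | Relation.TransGen (brel G P) c (tr s c)},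
      ∀ y ∈ {s : ℤ | Relation.TransGen (brel G P) c (tr s c)},
      x + y ∈ {s : ℤ | Relation.TransGen (brel G P) c (tr s c)} := by
    intro c x hx y hy
    have := h.tg_tr x hy
    rw [tr_tr] at this
    exact Relation.TransGen.trans hx this
  have h0 : ∀ c, (0 : ℤ) ∉ {s : ℤ | Relation.TransGen (brel G P) c (tr s c)} := by
    intro c hc
    have hc : Relation.TransGen (brel G P) c (tr 0 c) := hc
    rw [tr_zero] at hc
    exact cyc c hc
  have h3' : Relation.TransGen (brel G P) b (tr (j - i) d) := by
    have := h.rtg_tr (-i) h3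
    rw [tr_tr, tr_tr, neg_add_cancel, tr_zero] at this
    rcases Relation.reflTransGen_iff_eq_or_transGen.1 this with e | e
    · exfalso
      apply hne (-(-i + j))
      rw [← e, tr_tr, neg_add_cancel, tr_zero]
    · rwa [show j - i = -i + j by ring]
  have h4' : Relation.ReflTransGen (brel G P) d (tr (l - k) b) := by
    have := h.rtg_tr (-k) h4
    rwa [tr_tr, tr_tr, neg_add_cancel, tr_zero, show -k + l = l - k by ring] at this
  set s := (j - i) + (l - k) with hs
  have sb : s ∈ {s : ℤ | Relation.TransGen (brel G P) b (tr s b)} := by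
    have := h.rtg_tr (j - i) h4'
    rw [tr_tr] at this
    exact Relation.TransGen.trans_left h3' this
  have sd : s ∈ {s : ℤ | Relation.TransGen (brel G P) d (tr s d)} := by
    have := h.tg_tr (l - k) h3'
    rw [tr_tr] at this
    have := Relation.TransGen.trans_right h4' this
    rwa [add_comm] at this
  rcases lt_trichotomy s 0 with h5 | h5 | h5
  · exact h0 d (zero_mem_of_pos_neg (hadd d) h2 sd hm2 h5)
  · rw [h5] at sb; exact h0 b sb
  · exact h0 b (zero_mem_of_pos_neg (hadd b) sb h1 h5 hm1)

/-- The set of all bricks reachable from the translates of `a`. -/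
def upS (G : ℂ → ℂ) (P : Set (Set ℂ)) (a : Set ℂ) : Set (Set ℂ) :=
  {B | ∃ j, Relation.ReflTransGen (brel G P) (tr j a) B}

/-- The union of the reachable bricks. -/
def upU (G : ℂ → ℂ) (P : Set (Set ℂ)) (a : Set ℂ) : Set ℂ := {z | ∃ B ∈ upS G P a, z ∈ B}

theorem upS_mem {G : ℂ ≃ₜ ℂ} {P : Set (Set ℂ)} (h : BrickSys G P) {a : Set ℂ} (ha : a ∈ P)
    {B : Set ℂ} (hB : B ∈ upS G P a) : B ∈ P := by
  obtain ⟨j, hj⟩ := hB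
  rcases Relation.reflTransGen_iff_eq_or_transGen.1 hj with e | e
  · rw [e]; exact h.trans a ha j
  · obtain ⟨c, -, hc⟩ := Relation.TransGen.tail'_iff.1 e
    exact hc.2.1

theorem upS_step {G : ℂ ≃ₜ ℂ} {P : Set (Set ℂ)} {a : Set ℂ}
    {B B' : Set ℂ} (hB : B ∈ upS G P a) (hr : brel G P B B') : B' ∈ upS G P a := by
  obtain ⟨j, hj⟩ := hB
  exact ⟨j, hj.tail hr⟩

theorem upS_tr {G : ℂ ≃ₜ ℂ} {P : Set (Set ℂ)} (h : BrickSys G P) {a : Set ℂ}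
    {B : Set ℂ} (hB : B ∈ upS G P a) (k : ℤ) : tr k B ∈ upS G P a := by
  obtain ⟨j, hj⟩ := hB
  refine ⟨k + j, ?_⟩
  have := h.rtg_tr k hj
  rwa [tr_tr] at this

theorem upU_tr {G : ℂ ≃ₜ ℂ} {P : Set (Set ℂ)} (h : BrickSys G P) {a : Set ℂ} {z : ℂ}
    (hz : z ∈ upU G P a) (k : ℤ) : z + k ∈ upU G P a := by
  obtain ⟨B, hB, hzB⟩ := hz
  exact ⟨tr k B, upS_tr h hB k, add_mem_tr.2 hzB⟩

theorem upU_closed {G : ℂ ≃ₜ ℂ} {P : Set (Set ℂ)} (h : BrickSys G P) {a : Set ℂ} (ha : a ∈ P) :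
    IsClosed (upU G P a) := by
  rw [← closure_subset_iff_isClosed]
  intro y hy
  obtain ⟨O, hO, hl⟩ := h.loc y
  obtain ⟨w, hw, B, hB, hwB⟩ := mem_closure_iff_nhds.1 hy O hO
  exact ⟨B, hB, hl B (upS_mem h ha hB) ⟨w, hw, hwB⟩⟩

theorem upU_map {G : ℂ ≃ₜ ℂ} {P : Set (Set ℂ)} (h : BrickSys G P) {a : Set ℂ} (ha : a ∈ P) {z : ℂ}
    (hz : z ∈ upU G P a) : G z ∈ interior (upU G P a) := by
  obtain ⟨B, hB, hzB⟩ := hz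
  obtain ⟨O, hO, hl⟩ := h.loc (G z)
  rw [mem_interior_iff_mem_nhds]
  refine Filter.mem_of_superset hO fun w hw => ?_
  obtain ⟨C, hC, hwC⟩ := h.cover w
  exact ⟨C, upS_step hB ⟨upS_mem h ha hB, hC, z, hzB, hl C hC ⟨w, hw, hwC⟩⟩, hwC⟩

theorem joined_brick {B K : Set ℂ} (hB : IsBrick B) (hK : B ⊆ K) {z w : ℂ} (hz : z ∈ B)
    (hw : w ∈ B) : JoinedIn K z w :=
  ((hB.2.1.isPathConnected ⟨z, hz⟩).joinedIn z hz w hw).mono hK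

theorem joined_map {K : Set ℂ} {g : ℂ → ℂ} (hg : Continuous g) (hK : ∀ z ∈ K, g z ∈ K) {z w : ℂ}
    (h : JoinedIn K z w) : JoinedIn K (g z) (g w) := by
  obtain ⟨γ, hγ⟩ := h
  exact ⟨γ.map hg, fun t => by simpa using hK _ (hγ t)⟩

/-- Forward goodness of a brick. -/
def FwdGood (G : ℂ → ℂ) (P : Set (Set ℂ)) (a : Set ℂ) : Prop :=
  ∃ e ∈ P, ∃ j : ℤ, (∃ z ∈ a, G z ∈ e) ∧ (∃ z ∈ e, z ∈ tr j a) ∧ (j = 0 ∨ ∃ z ∈ a, z ∈ tr 1 a)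

theorem periodic_path {K : Set ℂ} (hK : ∀ z ∈ K, ∀ k : ℤ, z + k ∈ K) {z : ℂ} {m : ℤ}
    (h : JoinedIn K z (z + m)) : ∃ l : ℝ → ℂ, Continuous l ∧ (∀ s, l (s + 1) = l s + (m : ℝ)) ∧
      (∀ s, l s ∈ K) ∧ l 0 = z := by
  obtain ⟨γ, hγ⟩ := h
  let g : ℝ → ℂ := fun t => γ.extend t - t * m
  have hg : g 0 = g (0 + 1) := by simp [g]
  have hgc : Continuous g := by
    have := γ.continuous_extend
    fun_prop
  have hc := AddCircle.liftIco_continuous (p := (1 : ℝ)) (a := 0) (f := g) hg hgc.continuousOn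
  have hval : ∀ s : ℝ, AddCircle.liftIco 1 0 g (s : AddCircle (1 : ℝ)) = g (Int.fract s) := by
    intro s
    have h1 : (s : AddCircle (1 : ℝ)) = ((Int.fract s : ℝ) : AddCircle (1 : ℝ)) := (AddCircle.coe_fract s).symm
    rw [h1]
    exact AddCircle.liftIco_coe_apply ⟨Int.fract_nonneg s, by simpa using Int.fract_lt_one s⟩
  refine ⟨fun s => AddCircle.liftIco 1 0 g (s : AddCircle (1 : ℝ)) + s * m, ?_, ?_, ?_, ?_⟩
  · have : Continuous fun s : ℝ => AddCircle.liftIco 1 0 g (s : AddCircle (1 : ℝ)) :=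
      hc.comp (AddCircle.continuous_mk' 1)
    fun_prop
  · intro s
    simp only [hval, Int.fract_add_one]
    push_cast
    ring
  · intro s
    simp only [hval, g]
    have h1 : γ.extend (Int.fract s) ∈ K := by
      have : γ.extend (Int.fract s) ∈ Set.range γ := by
        rw [← γ.extend_range]; exact ⟨_, rfl⟩
      obtain ⟨u, hu⟩ := this
      rw [← hu]; exact hγ u
    have := hK _ h1 (⌊s⌋ * m)
    convert this using 1
    have e : (s : ℂ) = ((⌊s⌋ : ℝ) : ℂ) + ((Int.fract s : ℝ) : ℂ) := by
      rw [← Complex.ofReal_add, Int.floor_add_fract]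
    rw [e]
    push_cast
    ring
  · simp only [hval]
    simp [g]

end FLC

namespace FLC

theorem fwd_chain {G : ℂ ≃ₜ ℂ} {P : Set (Set ℂ)} (h : BrickSys G P) {a : Set ℂ} (ha : a ∈ P)
    {B : Set ℂ} (hB : B ∈ upS G P a) : ∀ z ∈ B, ∃ i : ℕ, ∃ j : ℤ, ∃ w ∈ tr j a,
      JoinedIn (upU G P a) z (G^[i] w) := by
  obtain ⟨j, hj⟩ := hB
  induction hj with
  | refl =>
    intro z hz
    exact ⟨0, j, z, hz, JoinedIn.refl ⟨_, ⟨j, .refl⟩, hz⟩⟩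
  | @tail B B' h1 h2 ih =>
    intro z hz
    have hB' : B' ∈ upS G P a := ⟨j, h1.tail h2⟩
    obtain ⟨hBP, hB'P, u, hu, hGu⟩ := h2
    obtain ⟨i, k, w, hw, hj⟩ := ih u hu
    refine ⟨i + 1, k, w, hw, ?_⟩
    rw [Function.iterate_succ_apply']
    exact (joined_brick (h.brick _ hB'P).1 (show B' ⊆ upU G P a from fun x hx => ⟨B', hB', hx⟩) hz hGu).trans
      (joined_map G.continuous (fun z hz => interior_subset (upU_map h ha hz)) hj)

theorem fwd_back {G : ℂ ≃ₜ ℂ} {P : Set (Set ℂ)} (h : BrickSys G P) {a : Set ℂ} (ha : a ∈ P)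
    {e : Set ℂ} (he : e ∈ P) {j : ℤ} (h1 : ∃ z ∈ a, G z ∈ e) (h2 : ∃ z ∈ e, z ∈ tr j a) (i : ℕ) :
    ∀ (k : ℤ) (w : ℂ), w ∈ tr k a → ∃ l : ℤ, ∃ w' ∈ tr l a, JoinedIn (upU G P a) (G^[i] w) w' ∧
      (j = 0 → l = k) := by
  have hself : ∀ k, tr k a ∈ upS G P a := fun k => ⟨k, .refl⟩
  have hmap : ∀ z ∈ upU G P a, G z ∈ upU G P a := fun z hz => interior_subset (upU_map h ha hz)
  induction i with
  | zero =>
    intro k w hw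
    exact ⟨k, w, hw, JoinedIn.refl ⟨_, hself k, hw⟩, fun _ => rfl⟩
  | succ i ih =>
    intro k w hw
    obtain ⟨u, hu, hGu⟩ := h1
    obtain ⟨v, hv, hva⟩ := h2
    have e1 : JoinedIn (upU G P a) w (u + k) :=
      joined_brick (h.brick _ (h.trans a ha k)).1 (show tr k a ⊆ upU G P a from fun x hx => ⟨_, hself k, hx⟩) hw
        (add_mem_tr.2 hu)
    have e2 := joined_map G.continuous hmap e1
    rw [comm_int h.comm] at e2
    have hek : tr k e ∈ upS G P a := upS_tr h (upS_step (B := a) ⟨0, by rw [tr_zero]⟩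
      ⟨ha, he, u, hu, hGu⟩) k
    have e3 : JoinedIn (upU G P a) (G u + k) (v + k) :=
      joined_brick (h.brick _ (h.trans e he k)).1 (show tr k e ⊆ upU G P a from fun x hx => ⟨_, hek, hx⟩) (add_mem_tr.2 hGu)
        (add_mem_tr.2 hv)
    have hvk : v + k ∈ tr (k + j) a := by
      rw [← tr_tr]; exact add_mem_tr.2 hva
    obtain ⟨l, w', hw', hj, hl⟩ := ih (k + j) (v + k) hvk
    refine ⟨l, w', hw', ?_, fun hj0 => by rw [hl hj0, hj0, add_zero]⟩
    rw [Function.iterate_succ_apply]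
    exact (joined_map (G.continuous.iterate i) (fun z hz => by
      clear ih hj hl
      induction i with
      | zero => exact hz
      | succ n ihn => rw [Function.iterate_succ_apply']; exact hmap _ ihn) (e2.trans e3)).trans hj

/-- return data -/
def Dat (G : ℂ → ℂ) (a : Set ℂ) : Prop := ∃ w ∈ a, ∃ L : ℕ, ∃ m : ℤ, m ≠ 0 ∧ G^[L] w ∈ tr m a

theorem Dat.symm {G : ℂ ≃ₜ ℂ} (hc : ∀ z, G (z + 1) = G z + 1) {a : Set ℂ} (h : Dat G a) :
    Dat G.symm a := by
  obtain ⟨w, hw, L, m, hm, hL⟩ := h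
  refine ⟨G^[L] w - m, hL, L, -m, neg_ne_zero.2 hm, ?_⟩
  have hc' : ∀ z, G.symm^[L] (z + 1) = G.symm^[L] z + 1 := by
    have := symm_comm hc
    intro z
    induction L generalizing z with
    | zero => rfl
    | succ n ih => rw [Function.iterate_succ_apply, this, Function.iterate_succ_apply]
                   have : ∀ z, G.symm^[n] (z+1) = G.symm^[n] z + 1 := by
                     intro z
                     clear ih hL
                     induction n with
                     | zero => rfl
                     | succ k ihk => rw [Function.iterate_succ_apply', ihk, this,
                                        Function.iterate_succ_apply']
                   rw [this]
  have := comm_int hc' (-m) (G^[L] w)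
  rw [mem_tr]
  have e : G^[L] w - m = G^[L] w + ((-m : ℤ) : ℂ) := by push_cast; ring
  rw [e, this]
  have e2 : G.symm^[L] (G^[L] w) = w :=
    Function.LeftInverse.iterate G.symm_apply_apply L w
  rw [e2]
  simpa using hw

theorem fwd_main {G : ℂ ≃ₜ ℂ} {P : Set (Set ℂ)} (h : BrickSys G P) {a : Set ℂ} (ha : a ∈ P)
    (hg : FwdGood G P a) (hd : Dat G a) : ∃ z1 : ℂ, ∃ m : ℤ, m ≠ 0 ∧
      JoinedIn (upU G P a) z1 (z1 + m) ∧
      ∀ z ∈ upU G P a, ∃ k : ℤ, JoinedIn (upU G P a) z (z1 + k) := by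
  obtain ⟨w, hw, L, m, hm, hL⟩ := hd
  obtain ⟨e, he, j, h1, h2, h3⟩ := hg
  have hself : ∀ k, tr k a ∈ upS G P a := fun k => ⟨k, .refl⟩
  have hJ : ∀ k x y, x ∈ tr k a → y ∈ tr k a → JoinedIn (upU G P a) x y := fun k x y hx hy =>
    joined_brick (h.brick _ (h.trans a ha k)).1 (show tr k a ⊆ upU G P a from fun x hx => ⟨_, hself k, hx⟩) hx hy
  have part : ∀ z ∈ upU G P a, ∃ k : ℤ, JoinedIn (upU G P a) z (w + k) := by
    rintro z ⟨B, hB, hz⟩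
    obtain ⟨i, k, u, hu, hj⟩ := fwd_chain h ha hB z hz
    obtain ⟨l, v, hv, hj', -⟩ := fwd_back h ha he h1 h2 i k u hu
    exact ⟨l, (hj.trans hj').trans (hJ l _ _ hv (add_mem_tr.2 hw))⟩
  rcases h3 with h3 | ⟨z, hz, hz1⟩
  · refine ⟨w, m, hm, ?_, part⟩
    obtain ⟨l, v, hv, hj, hl⟩ := fwd_back h ha he h1 h2 L 0 w (by rw [tr_zero]; exact hw)
    rw [hl h3] at hv
    exact ((hJ 0 _ _ (by rw [tr_zero]; exact hw) hv).trans hj.symm).trans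
      (hJ m _ _ hL (add_mem_tr.2 hw))
  · refine ⟨w, 1, one_ne_zero, ?_, part⟩
    exact (hJ 0 _ _ (by rw [tr_zero]; exact hw) (by rw [tr_zero]; exact hz)).trans
      (hJ 1 _ _ hz1 (add_mem_tr.2 hw))

theorem per_bdd {l : ℝ → ℂ} (hl : Continuous l) {m : ℝ}
    (hper : ∀ s, l (s + 1) = l s + m) : ∃ C : ℝ, ∀ s, |(l s).im| ≤ C := by
  have hp : Function.Periodic (fun s => |(l s).im|) 1 := by
    intro s; simp [hper]
  obtain ⟨C, hC⟩ := (isCompact_Icc (a := (0 : ℝ)) (b := 1)).bddAbove_image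
    (f := fun s => |(l s).im|) (by fun_prop)
  refine ⟨C, fun s => ?_⟩
  have := hp.sub_zsmul_eq ⌊s⌋ (x := s)
  simp only [zsmul_eq_mul, mul_one] at this
  rw [← this]
  exact hC ⟨s - ⌊s⌋, ⟨by linarith [Int.floor_le s], by linarith [Int.lt_floor_add_one s]⟩, rfl⟩

/-- Static separation with a sign. -/
theorem sep_eps {l : ℝ → ℂ} (hl : Continuous l) {m : ℝ} (hm : m ≠ 0)
    (hper : ∀ s, l (s + 1) = l s + m) {K : Set ℂ} (hK : ∀ s, l s ∉ K) {a b : ℂ} {ε C : ℝ}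
    (hε : ε = 1 ∨ ε = -1) (hC : ∀ s, |(l s).im| ≤ C)
    (hab : JoinedIn K a b) (ha : C < ε * a.im) (hb : ε * b.im < -C) : False := by
  rcases hε with rfl | rfl
  · exact sep_static hl hm hper hK hab (fun s => by linarith [(abs_le.1 (hC s)).2])
      (fun s => by linarith [(abs_le.1 (hC s)).1])
  · exact sep_static hl hm hper hK hab.symm (fun s => by linarith [(abs_le.1 (hC s)).2])
      (fun s => by linarith [(abs_le.1 (hC s)).1])

/-- the output: an attracting half annulus -/
def OutV (G : ℂ → ℂ) : Prop :=
  ∃ V : Set ℂ, IsClosed V ∧ (∀ z, z ∈ V ↔ z + 1 ∈ V) ∧ (∀ z ∈ V, G z ∈ interior V) ∧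
    ∃ ε : ℝ, (ε = 1 ∨ ε = -1) ∧ ∃ M : ℝ, (∀ z : ℂ, ε * z.im ≤ -M → z ∈ V) ∧
      (∀ z : ℂ, M ≤ ε * z.im → z ∉ V)

theorem EndsOK.eps {f : ℂ → ℂ} (hf : EndsOK f) {ε : ℝ} (hε : ε = 1 ∨ ε = -1) (M : ℝ) :
    ∃ M', ∀ w : ℂ, M' < ε * w.im → M < ε * (f w).im := by
  rcases hε with rfl | rfl
  · obtain ⟨M', h⟩ := hf.1 M
    exact ⟨M', fun w hw => by have := h w (by linarith); linarith⟩
  · obtain ⟨M', h⟩ := hf.2 (-M)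
    exact ⟨-M', fun w hw => by have := h w (by linarith); linarith⟩

theorem trap_component {G : ℂ ≃ₜ ℂ} (hE' : EndsOK G.symm) {K : Set ℂ} (hKc : IsClosed K)
    (hK1 : ∀ z ∈ K, ∀ k : ℤ, z + k ∈ K) (hKG : ∀ z ∈ K, G z ∈ interior K)
    {ε C : ℝ} (hε : ε = 1 ∨ ε = -1) (hC : ∀ z ∈ K, ε * z.im ≤ C)
    {l : ℝ → ℂ} (hl : Continuous l) {m : ℝ} (hm : m ≠ 0)
    (hper : ∀ s, l (s + 1) = l s + m) (hlK : ∀ s, l s ∈ K) : OutV G := by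
  have hεε : ε * ε = 1 := by rcases hε with rfl | rfl <;> norm_num
  set H : Set ℂ := {z | C + 1 ≤ ε * z.im} with hH
  have hHK : H ⊆ Kᶜ := fun z hz hz' => by
    have := hC z hz'
    have : C + 1 ≤ ε * z.im := hz
    linarith
  have hHc : IsPreconnected H := by
    apply Convex.isPreconnected
    intro x hx y hy a b ha hb hab
    simp only [hH, Set.mem_ofPred_eq] at *
    simp only [Complex.add_im, Complex.real_smul, Complex.mul_im, Complex.ofReal_re,
      Complex.ofReal_im, zero_mul, add_zero]
    calc C + 1 = a * (C + 1) + b * (C + 1) := by rw [← add_mul, hab, one_mul]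
      _ ≤ a * (ε * x.im) + b * (ε * y.im) := by gcongr
      _ = _ := by ring
  have pt : ∀ c : ℝ, ε * ((⟨0, ε * c⟩ : ℂ)).im = c := fun c => by
    change ε * (ε * c) = c
    rw [← mul_assoc, hεε, one_mul]
  set p : ℂ := ⟨0, ε * (C + 1)⟩ with hp
  have hpH : p ∈ H := (pt (C + 1)).ge
  set U := connectedComponentIn Kᶜ p with hU
  have hUo : IsOpen U := hKc.isOpen_compl.connectedComponentIn
  have hUK : U ⊆ Kᶜ := connectedComponentIn_subset _ _
  have hHU : H ⊆ U := hHc.subset_connectedComponentIn hpH hHK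
  have hUc : IsPreconnected U := isPreconnected_connectedComponentIn
  have key : ∀ S : Set ℂ, IsPreconnected S → S ⊆ Kᶜ → (∃ z ∈ S, z ∈ H) → S ⊆ U := by
    rintro S hS hSK ⟨z, hzS, hzH⟩
    have := hS.subset_connectedComponentIn hzS hSK
    rwa [hU, connectedComponentIn_eq (hHU hzH : z ∈ connectedComponentIn Kᶜ p)]
  have htr : ∀ n : ℤ, ∀ z ∈ U, z + n ∈ U := by
    intro n z hz
    have := key ((fun z => z + (n : ℂ)) '' U) (hUc.image _ (by fun_prop)) ?_ ?_
    · exact this ⟨z, hz, rfl⟩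
    · rintro _ ⟨w, hw, rfl⟩ hwK
      have := hK1 _ hwK (-n)
      refine hUK hw ?_
      simpa using this
    · refine ⟨p + n, ⟨p, hHU hpH, rfl⟩, ?_⟩
      have : C + 1 ≤ ε * p.im := hpH
      simpa [hH] using this
  obtain ⟨C1, hC1⟩ := per_bdd hl hper
  refine ⟨Uᶜ, hUo.isClosed_compl, ?_, ?_, ε, hε, max (C + 1) (C1 + 1), ?_, ?_⟩
  · intro z
    rw [Set.mem_compl_iff, Set.mem_compl_iff, not_iff_not]
    refine ⟨fun h => by simpa using htr 1 z h, fun h => by simpa using htr (-1) _ h⟩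
  · intro z hz
    rw [interior_compl, Set.mem_compl_iff]
    intro hGz
    apply hz
    have hsub := key (G.symm '' closure U) (hUc.closure.image _ G.symm.continuous.continuousOn)
      ?_ ?_
    · exact hsub ⟨G z, hGz, G.symm_apply_apply z⟩
    · rintro _ ⟨w, hw, rfl⟩ hwK
      have := hKG _ hwK
      rw [G.apply_symm_apply] at this
      have h2 : closure U ⊆ (interior K)ᶜ :=
        closure_minimal (fun x hx hx' => hUK hx (interior_subset hx')) isOpen_interior.isClosed_compl
      exact h2 hw this
    · obtain ⟨M', hM'⟩ := hE'.eps hε (C + 1)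
      refine ⟨_, ⟨⟨0, ε * max (C + 1) (M' + 1)⟩, subset_closure (hHU ?_), rfl⟩, ?_⟩
      · exact (le_max_left _ _).trans (pt _).ge
      · refine (hM' _ ?_).le
        rw [pt]
        have := le_max_right (C + 1) (M' + 1)
        linarith
  · intro z hz hzU
    have hq : (⟨0, ε * max (C + 1) (C1 + 1)⟩ : ℂ) ∈ U := hHU ((le_max_left _ _).trans (pt _).ge)
    have hUcn : IsConnected U := ⟨⟨_, hq⟩, hUc⟩
    have hj := (hUo.isConnected_iff_isPathConnected.1 hUcn).joinedIn _ hq _ hzU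
    have := le_max_right (C + 1) (C1 + 1)
    refine sep_eps hl hm hper (fun s hs => hUK hs (hlK s)) hε hC1 hj ?_ ?_
    · rw [pt]; linarith
    · linarith
  · intro z hz hz'
    exact hz' (hHU ((le_max_left _ _).trans hz))

theorem brick_trap {G : ℂ ≃ₜ ℂ} {P : Set (Set ℂ)} (h : BrickSys G P)
    (hE' : EndsOK G.symm) {a r : Set ℂ} (ha : a ∈ P) (hr : r ∈ P)
    (ga : FwdGood G P a) (gr : FwdGood G.symm P r) (da : Dat G a) (dr : Dat G r)
    (hno : ∀ j k, ¬ Relation.ReflTransGen (brel G P) (tr j a) (tr k r)) : OutV G := by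
  obtain ⟨z1, m1, hm1, hj1, hall1⟩ := fwd_main h ha ga da
  obtain ⟨z2, m2, hm2, hj2, -⟩ := fwd_main h.symm hr gr (dr.symm h.comm)
  obtain ⟨l1, hl1, hp1, hk1, -⟩ := periodic_path (fun z hz k => upU_tr h hz k) hj1
  obtain ⟨l2, hl2, hp2, hk2, -⟩ := periodic_path (fun z hz k => upU_tr h.symm hz k) hj2
  have hdis : ∀ z ∈ upU G P a, G z ∉ upU G.symm P r := by
    rintro z ⟨B, hB, hzB⟩ ⟨C, hC, hzC⟩
    have hb : brel G P B C := ⟨upS_mem h ha hB, upS_mem h.symm hr hC, z, hzB, hzC⟩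
    obtain ⟨j, hj⟩ := hB
    obtain ⟨k, hk⟩ := hC
    have hk' : Relation.ReflTransGen (brel G P) C (tr k r) := by
      clear hb hzC hj hzB
      induction hk with
      | refl => exact .refl
      | tail _ h2 ih => exact ih.head (brel_symm.1 h2)
    exact hno j k ((hj.tail hb).trans hk')
  set l3 : ℝ → ℂ := fun s => G.symm (l2 s) with hl3
  have hl3c : Continuous l3 := G.symm.continuous.comp hl2
  have hp3 : ∀ s, l3 (s + 1) = l3 s + ((m2 : ℝ) : ℂ) := by
    intro s
    simp only [hl3]
    rw [hp2]
    have := comm_int (symm_comm h.comm) m2 (l2 s)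
    push_cast
    exact this
  have hk3 : ∀ s, l3 s ∉ upU G P a := by
    intro s hs
    apply hdis _ hs
    simpa [hl3] using hk2 s
  obtain ⟨C, hC⟩ := per_bdd hl3c hp3
  have hm1' : (m1 : ℝ) ≠ 0 := by exact_mod_cast hm1
  have hm2' : (m2 : ℝ) ≠ 0 := by exact_mod_cast hm2
  have fin : ∀ ε : ℝ, (ε = 1 ∨ ε = -1) → (∀ z ∈ upU G P a, ε * z.im ≤ C) → OutV G :=
    fun ε hε hb => trap_component hE' (upU_closed h ha) (fun z hz k => upU_tr h hz k)
      (fun z hz => upU_map h ha hz) hε hb hl1 hm1' hp1 hk1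
  by_cases c1 : ∀ z ∈ upU G P a, (1 : ℝ) * z.im ≤ C
  · exact fin 1 (Or.inl rfl) c1
  by_cases c2 : ∀ z ∈ upU G P a, (-1 : ℝ) * z.im ≤ C
  · exact fin (-1) (Or.inr rfl) c2
  exfalso
  push Not at c1 c2
  obtain ⟨x, hx, hxC⟩ := c1
  obtain ⟨y, hy, hyC⟩ := c2
  obtain ⟨k, hk⟩ := hall1 x hx
  obtain ⟨k', hk'⟩ := hall1 y hy
  have := joined_map (g := fun z => z + ((k - k' : ℤ) : ℂ)) (by fun_prop)
    (fun z hz => upU_tr h hz (k - k')) hk'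
  have e : z1 + (k' : ℂ) + ((k - k' : ℤ) : ℂ) = z1 + k := by push_cast; ring
  rw [e] at this
  refine sep_eps hl3c hm2' hp3 hk3 (Or.inl rfl) hC (hk.trans this.symm) hxC ?_
  simp
  linarith

theorem brick_main {G : ℂ ≃ₜ ℂ} {P : Set (Set ℂ)} (h : BrickSys G P) (hI : Iso G)
    (hf : ∀ z, G z ≠ z) (hE' : EndsOK G.symm) {b d : Set ℂ} (hb : b ∈ P) (hd : d ∈ P)
    (hne : ∀ j, tr j b ≠ d) (gb : FwdGood G P b) (gb' : FwdGood G.symm P b)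
    (gd : FwdGood G P d) (gd' : FwdGood G.symm P d) {z1 z2 : ℂ} (hz1 : z1 ∈ b) (hz2 : z2 ∈ d)
    {L1 L2 : ℕ} {m1 m2 : ℤ} (hm1 : m1 < 0) (hm2 : 0 < m2)
    (hr1 : G^[L1 + 1] z1 ∈ tr m1 b) (hr2 : G^[L2 + 1] z2 ∈ tr m2 d) : OutV G := by
  have c1 := h.chain (h.trans b hb m1) L1 hb hz1 hr1
  have c2 := h.chain (h.trans d hd m2) L2 hd hz2 hr2
  have db : Dat G b := ⟨z1, hz1, _, m1, hm1.ne, hr1⟩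
  have dd : Dat G d := ⟨z2, hz2, _, m2, hm2.ne', hr2⟩
  by_cases c : ∀ j k, ¬ Relation.ReflTransGen (brel G P) (tr j b) (tr k d)
  · exact brick_trap h hE' hb hd gb gd' db dd c
  · push Not at c
    obtain ⟨i, j, hij⟩ := c
    exact brick_trap h hE' hd hb gd gb' dd db fun k l hkl =>
      h.not_both hI hf hne hm1 hm2 c1 c2 hij hkl

end FLC

namespace FLC

def rect (u v c d : ℝ) : Set ℂ := {z | z.re ∈ Set.Icc u v ∧ z.im ∈ Set.Icc c d}

def Gap (Z : Set ℝ) (u v : ℝ) : Prop := u ∈ Z ∧ v ∈ Z ∧ u < v ∧ ∀ x ∈ Z, u < x → x < v → False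

def LF (Z : Set ℝ) : Prop :=
  (∀ a b, (Z ∩ Set.Icc a b).Finite) ∧ (∀ x, ∃ u ∈ Z, u < x) ∧ (∀ x, ∃ v ∈ Z, x < v)

theorem Gap.eq {Z : Set ℝ} {u v u' v' x : ℝ} (h : Gap Z u v) (h' : Gap Z u' v') (h1 : u < x)
    (h2 : x < v) (h3 : u' < x) (h4 : x < v') : u = u' ∧ v = v' := by
  obtain ⟨a1, a2, a3, a4⟩ := h
  obtain ⟨b1, b2, b3, b4⟩ := h'
  constructor
  · rcases lt_trichotomy u u' with e | e | e
    · exact (a4 u' b1 e (by linarith)).elim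
    · exact e
    · exact (b4 u a1 e (by linarith)).elim
  · rcases lt_trichotomy v v' with e | e | e
    · exact (b4 v a2 (by linarith) e).elim
    · exact e
    · exact (a4 v' b2 (by linarith) e).elim

/-- gap containing `x`, closed on the left -/
theorem LF.gapR {Z : Set ℝ} (h : LF Z) (x : ℝ) : ∃ u v, Gap Z u v ∧ u ≤ x ∧ x < v := by
  obtain ⟨h1, h2, h3⟩ := h
  obtain ⟨u0, hu0, hu0x⟩ := h2 x
  obtain ⟨v0, hv0, hv0x⟩ := h3 x
  obtain ⟨u, hu, hum⟩ := Set.exists_max_image (Z ∩ Set.Icc u0 x) id (h1 _ _)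
    ⟨u0, hu0, le_rfl, hu0x.le⟩
  obtain ⟨v, hv, hvm⟩ := Set.exists_min_image (Z ∩ Set.Ioc x v0) id
    ((h1 x v0).subset (Set.inter_subset_inter_right _ Set.Ioc_subset_Icc_self))
    ⟨v0, hv0, hv0x, le_rfl⟩
  refine ⟨u, v, ⟨hu.1, hv.1, hu.2.2.trans_lt hv.2.1, fun y hy hy1 hy2 => ?_⟩, hu.2.2, hv.2.1⟩
  rcases le_or_gt y x with e | e
  · have := hum y ⟨hy, hu.2.1.trans hy1.le, e⟩
    exact absurd this (not_le.2 hy1)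
  · have := hvm y ⟨hy, e, hy2.le.trans hv.2.2⟩
    exact absurd this (not_le.2 hy2)

/-- gap containing `x`, closed on the right -/
theorem LF.gapL {Z : Set ℝ} (h : LF Z) (x : ℝ) : ∃ u v, Gap Z u v ∧ u < x ∧ x ≤ v := by
  obtain ⟨h1, h2, h3⟩ := h
  obtain ⟨u0, hu0, hu0x⟩ := h2 x
  obtain ⟨v0, hv0, hv0x⟩ := h3 x
  obtain ⟨u, hu, hum⟩ := Set.exists_max_image (Z ∩ Set.Ico u0 x) id
    ((h1 u0 x).subset (Set.inter_subset_inter_right _ Set.Ico_subset_Icc_self))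
    ⟨u0, hu0, le_rfl, hu0x⟩
  obtain ⟨v, hv, hvm⟩ := Set.exists_min_image (Z ∩ Set.Icc x v0) id (h1 _ _)
    ⟨v0, hv0, hv0x.le, le_rfl⟩
  refine ⟨u, v, ⟨hu.1, hv.1, hu.2.2.trans_le hv.2.1, fun y hy hy1 hy2 => ?_⟩, hu.2.2, hv.2.1⟩
  rcases lt_or_ge y x with e | e
  · have := hum y ⟨hy, hu.2.1.trans hy1.le, e⟩
    exact absurd this (not_le.2 hy1)
  · have := hvm y ⟨hy, e, hy2.le.trans hv.2.2⟩
    exact absurd this (not_le.2 hy2)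

theorem LF.loc {Z : Set ℝ} (h : LF Z) (x : ℝ) : ∀ᶠ w in 𝓝 x, ∀ u v, Gap Z u v → u ≤ w → w ≤ v →
    u ≤ x ∧ x ≤ v := by
  have hf : ((Z ∩ Set.Icc (x - 1) (x + 1)) \ {x}).Finite := (h.1 _ _).subset Set.sdiff_subset
  have h1 : ∀ᶠ w in 𝓝 x, w ∈ Set.Ioo (x - 1) (x + 1) :=
    Ioo_mem_nhds (by linarith) (by linarith)
  have h2 : ∀ᶠ w in 𝓝 x, ∀ y ∈ ((Z ∩ Set.Icc (x - 1) (x + 1)) \ {x} : Set ℝ),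
      (y < x → y < w) ∧ (x < y → w < y) := by
    rw [Filter.eventually_all_finite hf]
    intro y hy
    have hne : y ≠ x := hy.2
    rcases lt_or_gt_of_ne hne with e | e
    · filter_upwards [lt_mem_nhds e] with w hw
      exact ⟨fun _ => hw, fun h => absurd h (not_lt.2 e.le)⟩
    · filter_upwards [gt_mem_nhds e] with w hw
      exact ⟨fun h => absurd h (not_lt.2 e.le), fun _ => hw⟩
  filter_upwards [h1, h2] with w hw1 hw2 u v hg hu hv
  constructor
  · by_contra hc
    push Not at hc
    have := (hw2 u ⟨⟨hg.1, by linarith [hw1.1], by linarith [hw1.2]⟩, hc.ne'⟩).2 hc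
    linarith
  · by_contra hc
    push Not at hc
    have := (hw2 v ⟨⟨hg.2.1, by linarith [hw1.1], by linarith [hw1.2]⟩, hc.ne⟩).1 hc
    linarith

def bricks (Y : Set ℝ) (Z : ℝ → Set ℝ) : Set (Set ℂ) :=
  {B | ∃ u v c d, Gap Y c d ∧ Gap (Z c) u v ∧ B = rect u v c d}

theorem rect_interior {u v c d : ℝ} :
    interior (rect u v c d) = {z | z.re ∈ Set.Ioo u v ∧ z.im ∈ Set.Ioo c d} := by
  have h : rect u v c d = Set.Icc u v ×ℂ Set.Icc c d := rfl
  rw [h, Complex.interior_reProdIm, interior_Icc, interior_Icc]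
  rfl

theorem rect_brick {u v c d : ℝ} (h1 : u < v) (h2 : c < d) : IsBrick (rect u v c d) := by
  refine ⟨box_compact u v c d, ?_, ?_⟩
  · have h : rect u v c d = Complex.re ⁻¹' Set.Icc u v ∩ Complex.im ⁻¹' Set.Icc c d := rfl
    rw [h]
    exact ((convex_Icc u v).linear_preimage Complex.reLm).inter
      ((convex_Icc c d).linear_preimage Complex.imLm)
  · rw [rect_interior]
    exact ⟨⟨(u + v) / 2, (c + d) / 2⟩, ⟨by change u < (u+v)/2; linarith, by change (u+v)/2 < v; linarith⟩,
      ⟨by change c < (c+d)/2; linarith, by change (c+d)/2 < d; linarith⟩⟩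

theorem tr_rect (j : ℤ) (u v c d : ℝ) : tr j (rect u v c d) = rect (u + j) (v + j) c d := by
  ext z
  simp [rect, tr, le_sub_iff_add_le]

theorem Gap.shift {Z : Set ℝ} (hZ : ∀ x, x ∈ Z ↔ x + 1 ∈ Z) {u v : ℝ} (h : Gap Z u v) (j : ℤ) :
    Gap Z (u + j) (v + j) := by
  have hj : ∀ (j : ℤ) x, x ∈ Z ↔ x + j ∈ Z := by
    intro j
    induction j using Int.induction_on with
    | zero => simp
    | succ n ih => intro x; push_cast at ih ⊢; rw [ih x, hZ (x + n), add_assoc]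
    | pred n ih => intro x; push_cast at ih ⊢; rw [ih x, hZ (x + (-n - 1))]; ring_nf
  refine ⟨(hj j u).1 h.1, (hj j v).1 h.2.1, by linarith [h.2.2.1], fun x hx h1 h2 => ?_⟩
  refine h.2.2.2 (x - j) ((hj j _).2 (by simpa using hx)) (by linarith) (by linarith)

theorem bricks_loc {Y : Set ℝ} {Z : ℝ → Set ℝ} (hY : LF Y)
    (hY1 : ∀ c d, Gap Y c d → d ≤ c + 1) (hZ : ∀ c, LF (Z c)) (y : ℂ) : ∀ᶠ w in 𝓝 y,
    ∀ u v c d, Gap Y c d → Gap (Z c) u v → w ∈ rect u v c d → y ∈ rect u v c d := by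
  have hf := hY.1 (y.im - 1) (y.im + 1)
  have h1 : ∀ᶠ w : ℂ in 𝓝 y, ∀ c d, Gap Y c d → c ≤ w.im → w.im ≤ d → c ≤ y.im ∧ y.im ≤ d :=
    Complex.continuous_im.continuousAt.eventually (hY.loc y.im)
  have h2 : ∀ᶠ w : ℂ in 𝓝 y, ∀ c ∈ Y ∩ Set.Icc (y.im - 1) (y.im + 1), ∀ u v, Gap (Z c) u v →
      u ≤ w.re → w.re ≤ v → u ≤ y.re ∧ y.re ≤ v := by
    rw [Filter.eventually_all_finite hf]
    intro c _
    exact Complex.continuous_re.continuousAt.eventually ((hZ c).loc y.re)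
  filter_upwards [h1, h2] with w h1 h2 u v c d hcd huv hw
  have hy := h1 c d hcd hw.2.1 hw.2.2
  have := hY1 c d hcd
  exact ⟨h2 c ⟨hcd.1, by linarith, by linarith⟩ u v huv hw.1.1 hw.1.2, hy⟩

theorem bricks_sys {G : ℂ ≃ₜ ℂ} {Y : Set ℝ} {Z : ℝ → Set ℝ} (hc : ∀ z, G (z + 1) = G z + 1)
    (hY : LF Y) (hY1 : ∀ c d, Gap Y c d → d ≤ c + 1) (hZ : ∀ c, LF (Z c))
    (hT : ∀ c x, x ∈ Z c ↔ x + 1 ∈ Z c)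
    (hfree : ∀ u v c d, Gap Y c d → Gap (Z c) u v → Free G (rect u v c d)) :
    BrickSys G (bricks Y Z) where
  brick := by
    rintro B ⟨u, v, c, d, h1, h2, rfl⟩
    exact ⟨rect_brick h2.2.2.1 h1.2.2.1, hfree _ _ _ _ h1 h2⟩
  disj := by
    rintro B ⟨u, v, c, d, h1, h2, rfl⟩ B' ⟨u', v', c', d', h1', h2', rfl⟩ hne
    rw [rect_interior, rect_interior, Set.disjoint_left]
    rintro z ⟨hz1, hz2⟩ ⟨hz1', hz2'⟩
    obtain ⟨e1, e2⟩ := h1.eq h1' hz2.1 hz2.2 hz2'.1 hz2'.2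
    subst e1 e2
    obtain ⟨e1, e2⟩ := h2.eq h2' hz1.1 hz1.2 hz1'.1 hz1'.2
    subst e1 e2
    exact hne rfl
  cover := by
    intro z
    obtain ⟨c, d, hcd, h1, h2⟩ := hY.gapR z.im
    obtain ⟨u, v, huv, h3, h4⟩ := (hZ c).gapR z.re
    exact ⟨_, ⟨u, v, c, d, hcd, huv, rfl⟩, ⟨h3, h4.le⟩, ⟨h1, h2.le⟩⟩
  loc := by
    intro y
    refine ⟨_, bricks_loc hY hY1 hZ y, ?_⟩
    rintro B ⟨u, v, c, d, h1, h2, rfl⟩ ⟨w, hw, hwB⟩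
    exact hw u v c d h1 h2 hwB
  trans := by
    rintro B ⟨u, v, c, d, h1, h2, rfl⟩ j
    exact ⟨u + j, v + j, c, d, h1, h2.shift (hT c) j, tr_rect j u v c d⟩
  comm := hc

theorem lattice_fin (o : ℝ) {w : ℝ} (hw : 0 < w) (a b : ℝ) :
    ({x : ℝ | ∃ i : ℤ, x = o + i * w} ∩ Set.Icc a b).Finite := by
  refine ((Set.finite_Icc ⌊(a - o) / w⌋ ⌈(b - o) / w⌉).image (fun i : ℤ => o + i * w)).subset ?_
  rintro x ⟨⟨i, rfl⟩, h1, h2⟩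
  refine ⟨i, ⟨?_, ?_⟩, rfl⟩
  · have : (a - o) / w ≤ i := by rw [div_le_iff₀ hw]; linarith
    exact_mod_cast (Int.floor_le _).trans this
  · have : i ≤ (b - o) / w := by rw [le_div_iff₀ hw]; linarith
    exact_mod_cast this.trans (Int.le_ceil _)

/-- horizontal breakpoints -/
def Zs (o s : ℝ) (w : ℝ) : Set ℝ :=
  {x | (∃ m : ℤ, x = o + m ∨ x = s + m) ∨
    (∃ a : ℤ, x = o + a * w ∧ ∀ m : ℤ, o + m < x → x < s + m → False)}

theorem Zs_LF (o s : ℝ) {w : ℝ} (hw : 0 < w) : LF (Zs o s w) := by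
  refine ⟨fun a b => ?_, fun x => ?_, fun x => ?_⟩
  · refine (((lattice_fin o one_pos a b).union (lattice_fin s one_pos a b)).union
      (lattice_fin o hw a b)).subset ?_
    rintro x ⟨⟨m, rfl | rfl⟩ | ⟨m, hm, -⟩, hx⟩
    · exact Or.inl (Or.inl ⟨⟨m, by ring⟩, hx⟩)
    · exact Or.inl (Or.inr ⟨⟨m, by ring⟩, hx⟩)
    · exact Or.inr ⟨⟨m, hm⟩, hx⟩
  · obtain ⟨n, hn⟩ := exists_int_lt (x - o)
    exact ⟨o + n, Or.inl ⟨n, Or.inl rfl⟩, by linarith⟩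
  · obtain ⟨n, hn⟩ := exists_int_gt (x - o)
    exact ⟨o + n, Or.inl ⟨n, Or.inl rfl⟩, by linarith⟩

theorem Zs_T (o s : ℝ) {K : ℕ} (hK : 0 < K) (x : ℝ) :
    x ∈ Zs o s (1 / K) ↔ x + 1 ∈ Zs o s (1 / K) := by
  have hK' : (K : ℝ) ≠ 0 := by positivity
  constructor
  · rintro (⟨m, rfl | rfl⟩ | ⟨a, rfl, ha⟩)
    · exact Or.inl ⟨m + 1, Or.inl (by push_cast; ring)⟩
    · exact Or.inl ⟨m + 1, Or.inr (by push_cast; ring)⟩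
    · refine Or.inr ⟨a + K, by push_cast; field_simp; ring, fun m h1 h2 => ha (m - 1) ?_ ?_⟩ <;>
      push_cast <;> linarith
  · rintro (⟨m, h | h⟩ | ⟨a, h, ha⟩)
    · exact Or.inl ⟨m - 1, Or.inl (by push_cast; linarith)⟩
    · exact Or.inl ⟨m - 1, Or.inr (by push_cast; linarith)⟩
    · refine Or.inr ⟨a - K, ?_, fun m h1 h2 => ha (m + 1) ?_ ?_⟩
      · rw [eq_sub_of_add_eq h]; push_cast; field_simp; ring
      · push_cast; linarith
      · push_cast; linarith

theorem Zs_no {o s w : ℝ} (h2 : s ≤ o + 1) {x : ℝ} (hx : x ∈ Zs o s w) (m : ℤ)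
    (h3 : o + m < x) (h4 : x < s + m) : False := by
  rcases hx with ⟨n, rfl | rfl⟩ | ⟨a, -, ha⟩
  · have e1 : (m : ℝ) < n := by linarith
    have e2 : (n : ℝ) < m + 1 := by linarith
    norm_cast at e1 e2
    omega
  · have e1 : (n : ℝ) < m := by linarith
    have e2 : (m : ℝ) < n + 1 := by linarith
    norm_cast at e1 e2
    omega
  · exact ha m h3 h4

theorem Zs_gap {o s w : ℝ} (h1 : o < s) (h2 : s ≤ o + 1) : Gap (Zs o s w) o s :=
  ⟨Or.inl ⟨0, Or.inl (by simp)⟩, Or.inl ⟨0, Or.inr (by simp)⟩, h1, fun x hx h3 h4 =>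
    Zs_no h2 hx 0 (by simpa using h3) (by simpa using h4)⟩

theorem Zs_gaps {o s w : ℝ} (hw : 0 < w) (h1 : o < s) (h2 : s ≤ o + 1) {u v : ℝ}
    (hg : Gap (Zs o s w) u v) : (∃ m : ℤ, u = o + m ∧ v = s + m) ∨ v - u ≤ w := by
  by_contra hc
  push Not at hc
  obtain ⟨hc1, hc2⟩ := hc
  obtain ⟨hu, hv, huv, hno⟩ := hg
  have caseA : ∀ m : ℤ, u = o + m → False := by
    rintro m rfl
    have hs : s + m ∈ Zs o s w := Or.inl ⟨m, Or.inr rfl⟩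
    have h3 : v ≤ s + m := by
      by_contra h; push Not at h
      exact hno _ hs (by linarith) h
    rcases h3.lt_or_eq with h | h
    · exact Zs_no h2 hv m huv h
    · exact hc1 m rfl h
  set a := ⌊(u - o) / w⌋ + 1 with ha
  have g1 : u < o + a * w := by
    have := Int.lt_floor_add_one ((u - o) / w)
    rw [div_lt_iff₀ hw] at this
    rw [ha]; push_cast; linarith
  have g2 : o + a * w ≤ u + w := by
    have := Int.floor_le ((u - o) / w)
    rw [le_div_iff₀ hw] at this
    rw [ha]; push_cast; linarith
  have hg : ∃ m : ℤ, o + m < o + a * w ∧ o + a * w < s + m := by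
    by_contra h
    push Not at h
    exact hno (o + a * w) (Or.inr ⟨a, rfl, fun m h3 h4 => by linarith [h m h3]⟩) g1 (by linarith)
  obtain ⟨m, hm1, hm2⟩ := hg
  have hom : o + m ≤ u := by
    by_contra h; push Not at h
    exact hno (o + m) (Or.inl ⟨m, Or.inl rfl⟩) h (by linarith)
  rcases hom.lt_or_eq with h | h
  · exact Zs_no h2 hu m h (by linarith)
  · exact caseA m h.symm

/-- vertical breakpoints -/
def Ys (A H : ℝ) (n : ℤ → ℕ) : Set ℝ :=
  {y | ∃ j i : ℤ, A + j * H ≤ y ∧ y ≤ A + (j + 1) * H ∧ y = A + j * H + i * (H / n j)}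

theorem Ys_base {A H : ℝ} (hH : 0 < H) (n : ℤ → ℕ) (j : ℤ) : A + j * H ∈ Ys A H n :=
  ⟨j, 0, le_rfl, by linarith, by simp⟩

theorem Ys_LF {A H : ℝ} (hH : 0 < H) {n : ℤ → ℕ} (hn : ∀ j, 0 < n j) : LF (Ys A H n) := by
  refine ⟨fun a b => ?_, fun x => ?_, fun x => ?_⟩
  · refine ((Set.finite_Icc (⌊(a - A) / H⌋ - 1) ⌈(b - A) / H⌉).biUnion (fun j _ =>
      lattice_fin (A + j * H) (div_pos hH (Nat.cast_pos.2 (hn j))) a b)).subset ?_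
    rintro y ⟨⟨j, i, h1, h2, h3⟩, hy⟩
    refine Set.mem_biUnion (x := j) ⟨?_, ?_⟩ ⟨⟨i, h3⟩, hy⟩
    · have : (a - A) / H ≤ j + 1 := by rw [div_le_iff₀ hH]; linarith [hy.1]
      have := (Int.floor_le _).trans this
      have : ⌊(a - A) / H⌋ ≤ j + 1 := by exact_mod_cast this
      omega
    · have : j ≤ (b - A) / H := by rw [le_div_iff₀ hH]; linarith [hy.2]
      exact_mod_cast this.trans (Int.le_ceil _)
  · obtain ⟨m, hm⟩ := exists_int_lt ((x - A) / H)
    rw [lt_div_iff₀ hH] at hm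
    exact ⟨_, Ys_base hH n m, by linarith⟩
  · obtain ⟨m, hm⟩ := exists_int_gt ((x - A) / H)
    rw [div_lt_iff₀ hH] at hm
    exact ⟨_, Ys_base hH n m, by linarith⟩

/-- block index -/
noncomputable def blk (A H c : ℝ) : ℤ := ⌊(c - A) / H⌋

theorem blk_le {A H : ℝ} (hH : 0 < H) (c : ℝ) : A + blk A H c * H ≤ c := by
  have := Int.floor_le ((c - A) / H)
  rw [le_div_iff₀ hH] at this
  unfold blk; linarith

theorem lt_blk {A H : ℝ} (hH : 0 < H) (c : ℝ) : c < A + (blk A H c + 1) * H := by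
  have := Int.lt_floor_add_one ((c - A) / H)
  rw [div_lt_iff₀ hH] at this
  unfold blk; linarith

theorem blk_base {A H : ℝ} (hH : 0 < H) (j : ℤ) : blk A H (A + j * H) = j := by
  unfold blk
  rw [add_sub_cancel_left, mul_div_cancel_right₀ _ hH.ne', Int.floor_intCast]

theorem Ys_gap {A H : ℝ} (hH : 0 < H) {n : ℤ → ℕ} (hn : ∀ j, 0 < n j) {c d : ℝ}
    (hg : Gap (Ys A H n) c d) : d ≤ A + (blk A H c + 1) * H ∧ d - c ≤ H / n (blk A H c) := by
  obtain ⟨hc, hd, hcd, hno⟩ := hg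
  have b1 := blk_le (A := A) hH c
  have b2 := lt_blk (A := A) hH c
  set j := blk A H c with hj
  have hbase : A + (j + 1) * H ∈ Ys A H n := by
    have := Ys_base (A := A) hH n (j + 1)
    push_cast at this; exact this
  have h1 : d ≤ A + (j + 1) * H := by
    by_contra h; push Not at h
    exact hno _ hbase b2 h
  refine ⟨h1, ?_⟩
  obtain ⟨i, hi⟩ : ∃ i : ℤ, c = A + j * H + i * (H / n j) := by
    obtain ⟨j', i, e1, e2, e3⟩ := hc
    have l1 : (j' : ℝ) < j + 1 := by
      by_contra h; push Not at h
      have := mul_le_mul_of_nonneg_right h hH.le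
      linarith
    have l2 : (j : ℝ) ≤ j' + 1 := by
      by_contra h; push Not at h
      have := mul_lt_mul_of_pos_right h hH
      linarith
    norm_cast at l1 l2
    rcases (by omega : j' = j ∨ j = j' + 1) with h | h
    · rw [h] at e3; exact ⟨i, e3⟩
    · refine ⟨0, ?_⟩
      have : (j : ℝ) = j' + 1 := by rw [h]; push_cast; ring
      rw [← this] at e2
      simp; linarith
  have hnj : (0 : ℝ) < n j := Nat.cast_pos.2 (hn j)
  have hw : 0 < H / n j := div_pos hH hnj
  by_contra hlt
  push Not at hlt
  refine hno (c + H / n j) ⟨j, i + 1, by linarith, ?_, by rw [hi]; push_cast; ring⟩ (by linarith) (by linarith)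
  linarith

theorem Ys_gap_one {A H : ℝ} (hH : 0 < H) {n : ℤ → ℕ} (hn : ∀ j, 0 < n j) {j : ℤ} (h1 : n j = 1) :
    Gap (Ys A H n) (A + j * H) (A + (j + 1) * H) := by
  obtain ⟨u, v, hg, h2, h3⟩ := (Ys_LF (A := A) hH hn).gapR (A + j * H)
  have hu : u = A + j * H := by
    by_contra h
    exact hg.2.2.2 _ (Ys_base hH n j) (lt_of_le_of_ne h2 h) h3
  subst hu
  convert hg using 1
  apply le_antisymm
  · obtain ⟨j', i, e1, e2, e3⟩ := hg.2.1
    have l1 : (j : ℝ) < j' + 1 := by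
      by_contra h; push Not at h
      have := mul_le_mul_of_nonneg_right h hH.le
      linarith
    norm_cast at l1
    rcases (by omega : j' = j ∨ j + 1 ≤ j') with h | h
    · subst h
      rw [h1] at e3
      simp only [Nat.cast_one, div_one] at e3
      have : (0 : ℝ) < i := by
        by_contra hh; push Not at hh
        have := mul_le_mul_of_nonneg_right hh hH.le
        linarith
      have : (1 : ℝ) ≤ i := by norm_cast at this ⊢
      have := mul_le_mul_of_nonneg_right this hH.le
      linarith
    · have : (j : ℝ) + 1 ≤ j' := by exact_mod_cast h
      have := mul_le_mul_of_nonneg_right this hH.le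
      linarith
  · have := (Ys_gap hH hn hg).1
    rwa [blk_base hH] at this

theorem Ys_gap_one' {A H : ℝ} (hH : 0 < H) {n : ℤ → ℕ} (hn : ∀ j, 0 < n j) {c d : ℝ}
    (hg : Gap (Ys A H n) c d) (h1 : n (blk A H c) = 1) :
    c = A + blk A H c * H ∧ d = A + (blk A H c + 1) * H := by
  have h2 := Ys_gap_one (A := A) hH hn h1
  have h3 := (Ys_gap hH hn hg).1
  have h4 := blk_le (A := A) hH c
  have h5 := hg.2.2.1
  obtain ⟨e1, e2⟩ := hg.eq h2 (x := (c + d) / 2) (by linarith) (by linarith) (by linarith)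
    (by linarith)
  exact ⟨e1, e2⟩

end FLC

namespace FLC

theorem row_half {G : ℂ ≃ₜ ℂ} {Y : Set ℝ} {Z0 : ℝ → Set ℝ} (hY : LF Y)
    (hY1 : ∀ c d, Gap Y c d → d ≤ c + 1) (hZ0 : ∀ c, LF (Z0 c)) {c0 d0 o hh k t r : ℝ}
    (hrow : Gap Y c0 d0) (hk : 0 < k) (hhh : 0 < hh) (hr : 0 < r) {x p : ℂ} (hxp : G x = p)
    (ht1 : o + hh < t) (ht2 : t ≤ o + 1) (hx : x ∈ rect o t c0 d0) (hp : p ∈ rect o t c0 d0)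
    (hpt : p.re = t) (hxt : x.re < t) (hS : x.re = o → t < o + 1)
    (hfree : ∀ s, o + hh ≤ s → s < t → Free G (rect o s c0 d0)) :
    ∀ᶠ s in 𝓝[<] t, ∀ Z : ℝ → Set ℝ, Z c0 = Zs o s k → (∀ c, LF (Z c)) →
      (∀ c d, Gap Y c d → c ≠ c0 → c < d0 + r → c0 - r < d → Z c = Z0 c) →
      FwdGood G (bricks Y Z) (rect o s c0 d0) ∧ FwdGood G.symm (bricks Y Z) (rect o s c0 d0) := by
  have ev : ∀ {q : ℝ → Prop}, (∀ᶠ s in 𝓝 t, q s) → ∀ᶠ s in 𝓝[<] t, q s :=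
    fun h => h.filter_mono nhdsWithin_le_nhds
  have e0 : ∀ᶠ s in 𝓝[<] t, s < t := eventually_nhdsWithin_of_forall fun s hs => hs
  have e1 : ∀ᶠ s in 𝓝[<] t, o + hh < s := ev (lt_mem_nhds ht1)
  have e2 : ∀ᶠ s in 𝓝[<] t, x.re < s := ev (lt_mem_nhds hxt)
  have e3 : ∀ᶠ s in 𝓝[<] t, o + (⌈(t - o) / k⌉ - 1) * k < s := by
    refine ev (lt_mem_nhds ?_)
    have := Int.ceil_lt_add_one ((t - o) / k)
    have : ((⌈(t - o) / k⌉ : ℝ) - 1) < (t - o) / k := by linarith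
    rw [lt_div_iff₀ hk] at this
    linarith
  have hcont : Tendsto (fun s : ℝ => G.symm (p - ((t - s : ℝ) : ℂ))) (𝓝 t) (𝓝 x) := by
    have : Continuous (fun s : ℝ => G.symm (p - ((t - s : ℝ) : ℂ))) :=
      G.symm.continuous.comp (by fun_prop)
    have h := this.tendsto t
    simpa [← hxp] using h
  have e4 : ∀ᶠ s in 𝓝[<] t, ∀ u v c d, Gap Y c d → Gap (Z0 c) u v →
      G.symm (p - ((t - s : ℝ) : ℂ)) ∈ rect u v c d → x ∈ rect u v c d :=
    ev (hcont.eventually (bricks_loc hY hY1 hZ0 x))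
  have hre : Tendsto (fun s : ℝ => (G.symm (p - ((t - s : ℝ) : ℂ))).re) (𝓝 t) (𝓝 x.re) :=
    (Complex.continuous_re.tendsto x).comp hcont
  have him : Tendsto (fun s : ℝ => (G.symm (p - ((t - s : ℝ) : ℂ))).im) (𝓝 t) (𝓝 x.im) :=
    (Complex.continuous_im.tendsto x).comp hcont
  have e5 := ev (him.eventually (lt_mem_nhds (show c0 - r < x.im by linarith [hx.2.1])))
  have e6 := ev (him.eventually (gt_mem_nhds (show x.im < d0 + r by linarith [hx.2.2])))
  have e7 := ev (hre.eventually (gt_mem_nhds (show x.re < (x.re + t) / 2 by linarith)))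
  have e7' : ∀ᶠ s in 𝓝[<] t, (x.re + t) / 2 < s := ev (lt_mem_nhds (by linarith))
  have e8 := ev (hre.eventually (lt_mem_nhds (show o - k < x.re by linarith [hx.1.1])))
  have e9 : ∀ᶠ s in 𝓝[<] t, (o < x.re → o < (G.symm (p - ((t - s : ℝ) : ℂ))).re) := by
    by_cases h : o < x.re
    · filter_upwards [ev (hre.eventually (lt_mem_nhds h))] with s hs _ using hs
    · exact Filter.Eventually.of_forall fun s h' => absurd h' h
  have e10 : ∀ᶠ s in 𝓝[<] t, (t < o + 1 → t - 1 < (G.symm (p - ((t - s : ℝ) : ℂ))).re) := by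
    by_cases h : t < o + 1
    · filter_upwards [ev (hre.eventually (lt_mem_nhds (show t - 1 < x.re by linarith [hx.1.1])))]
        with s hs _ using hs
    · exact Filter.Eventually.of_forall fun s h' => absurd h' h
  filter_upwards [e0, e1, e2, e3, e4, e5, e6, e7, e7', e8, e9, e10] with s e0 e1 e2 e3 e4 e5 e6 e7 e7' e8 e9 e10
  intro Z hZc hZ hZ2
  set y := G.symm (p - ((t - s : ℝ) : ℂ)) with hy
  have hs1 : s ≤ o + 1 := by linarith
  have hxb : x ∈ rect o s c0 d0 := ⟨⟨hx.1.1, e2.le⟩, hx.2⟩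
  have hpb : p - ((t - s : ℝ) : ℂ) ∈ rect o s c0 d0 := by
    refine ⟨?_, ?_⟩
    · rw [Complex.sub_re, Complex.ofReal_re, hpt]
      constructor <;> linarith
    · rw [Complex.sub_im, Complex.ofReal_im, sub_zero]; exact hp.2
  constructor
  · obtain ⟨u, v, huv, hu, hv⟩ := (hZ c0).gapL t
    have hus : u ≤ s := by
      by_contra h
      push Not at h
      have huZ := huv.1
      rw [hZc] at huZ
      rcases huZ with ⟨n, hn | hn⟩ | ⟨a, ha, -⟩
      · have e1 : (0 : ℝ) < n := by linarith
        have e2 : (n : ℝ) < 1 := by linarith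
        norm_cast at e1 e2
        omega
      · have e1 : (0 : ℝ) < n := by linarith
        have e2 : (n : ℝ) < 1 := by linarith
        norm_cast at e1 e2
        omega
      · have l1 : (⌈(t - o) / k⌉ - 1) * k < a * k := by linarith
        have l2 := lt_of_mul_lt_mul_right l1 hk.le
        have l3 : (a : ℝ) * k < t - o := by linarith
        rw [← lt_div_iff₀ hk] at l3
        have l4 := l3.trans_le (Int.le_ceil _)
        norm_cast at l2 l4
        omega
    refine ⟨rect u v c0 d0, ⟨u, v, c0, d0, hrow, huv, rfl⟩, 0, ⟨x, hxb, ?_⟩, ⟨⟨s, c0⟩, ?_, ?_⟩, Or.inl rfl⟩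
    · rw [hxp]; exact ⟨⟨by rw [hpt]; exact hu.le, by rw [hpt]; exact hv⟩, hp.2⟩
    · exact ⟨⟨hus, by change s ≤ v; linarith⟩, ⟨le_rfl, hrow.2.2.1.le⟩⟩
    · rw [tr_zero]
      exact ⟨⟨by change o ≤ s; linarith, le_rfl⟩, ⟨le_rfl, hrow.2.2.1.le⟩⟩
  · have hyb : y ∉ rect o s c0 d0 := by
      intro h
      refine hfree s e1.le e0 y h ?_
      rw [hy, G.apply_symm_apply]; exact hpb
    by_cases hyr : y.im ∈ Set.Icc c0 d0
    · have hyo : y.re < o := by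
        by_contra h
        push Not at h
        exact hyb ⟨⟨h, by linarith⟩, hyr⟩
      have hxo : x.re = o := by
        by_contra h
        have := e9 (lt_of_le_of_ne hx.1.1 (Ne.symm h))
        linarith
      have hto := hS hxo
      have hyt := e10 hto
      obtain ⟨u, v, huv, hu, hv⟩ := (hZ c0).gapR y.re
      have hvo : o ≤ v := by
        by_contra h
        push Not at h
        have hvZ := huv.2.1
        rw [hZc] at hvZ
        rcases hvZ with ⟨n, hn | hn⟩ | ⟨a, ha, -⟩
        · have e1 : (-1 : ℝ) < n := by linarith
          have e2 : (n : ℝ) < 0 := by linarith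
          norm_cast at e1 e2
          have : (-1 : ℤ) < n := by exact_mod_cast e1
          omega
        · have e1 : (-1 : ℝ) < n := by linarith
          have e2 : (n : ℝ) < 0 := by linarith
          norm_cast at e1 e2
          have : (-1 : ℤ) < n := by exact_mod_cast e1
          omega
        · have l1 : (-1 : ℝ) * k < a * k := by linarith
          have l2 := lt_of_mul_lt_mul_right l1 hk.le
          have l3 : (a : ℝ) * k < 0 * k := by linarith
          have l4 := lt_of_mul_lt_mul_right l3 hk.le
          have : (-1 : ℤ) < a := by exact_mod_cast l2
          norm_cast at l4
          omega
      refine ⟨rect u v c0 d0, ⟨u, v, c0, d0, hrow, huv, rfl⟩, 0, ⟨_, hpb, ⟨hu, hv.le⟩, hyr⟩,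
        ⟨⟨o, c0⟩, ?_, ?_⟩, Or.inl rfl⟩
      · exact ⟨⟨by change u ≤ o; linarith, hvo⟩, ⟨le_rfl, hrow.2.2.1.le⟩⟩
      · rw [tr_zero]
        exact ⟨⟨le_rfl, by change o ≤ s; linarith⟩, ⟨le_rfl, hrow.2.2.1.le⟩⟩
    · obtain ⟨c, d, hcd, hc, hd⟩ := hY.gapR y.im
      obtain ⟨u, v, huv, hu, hv⟩ := (hZ c).gapR y.re
      have hcc : c ≠ c0 := by
        rintro rfl
        apply hyr
        refine ⟨hc, ?_⟩
        have : d = d0 := by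
          have := hcd.2.2.1
          have h2 := hrow.2.2.1
          rcases lt_trichotomy d d0 with h | h | h
          · exact (hrow.2.2.2 d hcd.2.1 this h).elim
          · exact h
          · exact (hcd.2.2.2 d0 hrow.2.1 h2 h).elim
        rw [← this]; exact hd.le
      have hZe := hZ2 c d hcd hcc (by linarith) (by linarith)
      have hyR : y ∈ rect u v c d := ⟨⟨hu, hv.le⟩, ⟨hc, hd.le⟩⟩
      refine ⟨rect u v c d, ⟨u, v, c, d, hcd, huv, rfl⟩, 0, ⟨_, hpb, hyR⟩, ⟨x, ?_, ?_⟩, Or.inl rfl⟩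
      · exact e4 u v c d hcd (hZe ▸ huv) hyR
      · rw [tr_zero]; exact hxb

theorem free_symm {G : ℂ ≃ₜ ℂ} {B : Set ℂ} (h : Free G B) : Free G.symm B :=
  fun z hz hz' => h _ hz' (by simpa using hz)

theorem row_good {G : ℂ ≃ₜ ℂ} (hc : ∀ z, G (z + 1) = G z + 1) {Y : Set ℝ} {Z0 : ℝ → Set ℝ} (hY : LF Y)
    (hY1 : ∀ c d, Gap Y c d → d ≤ c + 1) (hZ0 : ∀ c, LF (Z0 c)) {c0 d0 o hh k r : ℝ}
    (hrow : Gap Y c0 d0) (hk : 0 < k) (hhh : 0 < hh) (hhh1 : hh < 1) (hr : 0 < r)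
    (hS1 : ∀ x, x.re = o → (G x).re = o + 1 → x.im ∈ Set.Icc c0 d0 → (G x).im ∈ Set.Icc c0 d0 → False)
    (hS2 : ∀ x, x.re = o + 1 → (G x).re = o → x.im ∈ Set.Icc c0 d0 → (G x).im ∈ Set.Icc c0 d0 → False)
    (hS3 : ∀ x, x.re = (G x).re → x.im ∈ Set.Icc c0 d0 → (G x).im ∈ Set.Icc c0 d0 → False)
    (hsm : Free G (rect o (o + hh) c0 d0))
    (hline : ∃ z : ℂ, z.im ∈ Set.Icc c0 d0 ∧ (G z).im ∈ Set.Icc c0 d0) :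
    ∃ s, o + hh ≤ s ∧ s ≤ o + 1 ∧ Free G (rect o s c0 d0) ∧
      ∀ Z : ℝ → Set ℝ, Z c0 = Zs o s k → (∀ c, LF (Z c)) →
      (∀ c d, Gap Y c d → c ≠ c0 → c < d0 + r → c0 - r < d → Z c = Z0 c) →
      FwdGood G (bricks Y Z) (rect o s c0 d0) ∧ FwdGood G.symm (bricks Y Z) (rect o s c0 d0) := by
  by_cases hfr : Free G (rect o (o + 1) c0 d0)
  · refine ⟨o + 1, by linarith, le_rfl, hfr, fun Z hZc hZ _ => ?_⟩
    have hg : Gap (Z c0) o (o + 1) := by rw [hZc]; exact Zs_gap (by linarith) le_rfl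
    have hT : ∀ j : ℤ, rect (o + j) (o + 1 + j) c0 d0 ∈ bricks Y Z := by
      intro j
      refine ⟨o + j, o + 1 + j, c0, d0, hrow, ?_, rfl⟩
      rw [hZc]
      refine ⟨Or.inl ⟨j, Or.inl rfl⟩, Or.inl ⟨j, Or.inr rfl⟩, by linarith, fun x hx h1 h2 =>
        Zs_no le_rfl hx j h1 h2⟩
    have touch : ∃ z ∈ rect o (o + 1) c0 d0, z ∈ tr 1 (rect o (o + 1) c0 d0) := by
      refine ⟨⟨o + 1, c0⟩, ⟨⟨by change o ≤ o + 1; linarith, le_rfl⟩, le_rfl, hrow.2.2.1.le⟩, ?_⟩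
      rw [tr_rect]
      exact ⟨⟨by simp, by simp⟩, le_rfl, hrow.2.2.1.le⟩
    obtain ⟨z, hz1, hz2⟩ := hline
    have fl : ∀ w : ℂ, w.im ∈ Set.Icc c0 d0 → ∃ n : ℤ, w ∈ tr n (rect o (o + 1) c0 d0) := by
      intro w hw
      refine ⟨⌊w.re - o⌋, ?_⟩
      rw [tr_rect]
      have h1 := Int.floor_le (w.re - o)
      have h2 := Int.lt_floor_add_one (w.re - o)
      exact ⟨⟨by linarith, by linarith⟩, hw⟩
    obtain ⟨n, hn⟩ := fl z hz1
    obtain ⟨m, hm⟩ := fl (G z) hz2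
    have key : ∃ x ∈ rect o (o + 1) c0 d0, G x ∈ tr (m - n) (rect o (o + 1) c0 d0) := by
      refine ⟨z - n, hn, ?_⟩
      have := comm_int hc (-n) z
      push_cast at this
      rw [← sub_eq_add_neg] at this
      rw [this, mem_tr]
      rw [mem_tr] at hm
      convert hm using 1
      push_cast; ring
    obtain ⟨x, hx, hGx⟩ := key
    have hb : ∀ j : ℤ, tr j (rect o (o + 1) c0 d0) ∈ bricks Y Z := fun j => by
      rw [tr_rect]; exact hT j
    constructor
    · exact ⟨_, hb (m - n), m - n, ⟨x, hx, hGx⟩, ⟨_, hGx, hGx⟩, Or.inr touch⟩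
    · refine ⟨_, hb (-(m - n)), -(m - n), ⟨G x - (m - n : ℤ), hGx, ?_⟩, ⟨_, add_mem_tr.2 hx, add_mem_tr.2 hx⟩,
        Or.inr touch⟩
      have := comm_int (symm_comm hc) (-(m - n)) (G x)
      rw [G.symm_apply_apply] at this
      rw [show G x - ((m - n : ℤ) : ℂ) = G x + ((-(m - n) : ℤ) : ℂ) by push_cast; ring, this]
      exact add_mem_tr.2 hx
  · set S : Set ℝ := {s | s ∈ Set.Icc (o + hh) (o + 1) ∧ ¬ Free G (rect o s c0 d0)} with hSdef
    have hScl : IsClosed S := by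
      set C : Set (ℝ × ℂ) := {q | q.1 ∈ Set.Icc (o + hh) (o + 1) ∧ q.2 ∈ rect o (o + 1) c0 d0 ∧
        q.2.re ≤ q.1 ∧ (G q.2).re ∈ Set.Icc o q.1 ∧ (G q.2).im ∈ Set.Icc c0 d0} with hC
      have hCc : IsCompact C := by
        refine (isCompact_Icc.prod (box_compact o (o + 1) c0 d0)).of_isClosed_subset
          ?_ (fun q hq => ⟨hq.1, hq.2.1⟩)
        have h1 := G.continuous
        have hbx : IsClosed (rect o (o + 1) c0 d0) := (box_compact o (o + 1) c0 d0).isClosed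
        have hCe : C = Prod.fst ⁻¹' Set.Icc (o + hh) (o + 1) ∩ Prod.snd ⁻¹' rect o (o + 1) c0 d0 ∩
            {q : ℝ × ℂ | q.2.re ≤ q.1} ∩ {q : ℝ × ℂ | o ≤ (G q.2).re} ∩
            {q : ℝ × ℂ | (G q.2).re ≤ q.1} ∩ (fun q : ℝ × ℂ => (G q.2).im) ⁻¹' Set.Icc c0 d0 := by
          ext q
          simp only [hC, Set.mem_inter_iff, Set.mem_preimage, Set.mem_ofPred_eq, Set.mem_Icc]
          tauto
        rw [hCe]
        exact (((((isClosed_Icc.preimage continuous_fst).inter (hbx.preimage continuous_snd)).inter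
          (isClosed_le (by fun_prop) (by fun_prop))).inter
          (isClosed_le (by fun_prop) (by fun_prop))).inter
          (isClosed_le (by fun_prop) (by fun_prop))).inter
          (isClosed_Icc.preimage (by fun_prop))
      have : S = Prod.fst '' C := by
        ext s
        constructor
        · rintro ⟨hs, hnf⟩
          unfold Free at hnf
          push Not at hnf
          obtain ⟨z, hz, hGz⟩ := hnf
          exact ⟨(s, z), ⟨hs, ⟨⟨hz.1.1, hz.1.2.trans hs.2⟩, hz.2⟩, hz.1.2, hGz.1, hGz.2⟩, rfl⟩
        · rintro ⟨⟨s', z⟩, ⟨h1, h2, h3, h4, h5⟩, rfl⟩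
          exact ⟨h1, fun hf => hf z ⟨⟨h2.1.1, h3⟩, h2.2⟩ ⟨h4, h5⟩⟩
      rw [this]
      exact (hCc.image continuous_fst).isClosed
    have hSne : S.Nonempty := ⟨o + 1, ⟨by linarith, le_rfl⟩, hfr⟩
    have hSb : BddBelow S := ⟨o + hh, fun s hs => hs.1.1⟩
    have htS := hScl.csInf_mem hSne hSb
    set t := sInf S with ht
    have hfree : ∀ s, o + hh ≤ s → s < t → Free G (rect o s c0 d0) := by
      intro s h1 h2
      by_contra h
      have := csInf_le hSb (show s ∈ S from ⟨⟨h1, by linarith [htS.1.2]⟩, h⟩)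
      linarith
    have ht1 : o + hh < t := by
      refine lt_of_le_of_ne htS.1.1 fun h => htS.2 ?_
      rw [← h]; exact hsm
    have hnf := htS.2
    unfold Free at hnf
    push Not at hnf
    obtain ⟨x, hx, hGx⟩ := hnf
    have hor : x.re = t ∨ (G x).re = t := by
      by_contra h
      push Not at h
      have h1 := lt_of_le_of_ne hx.1.2 h.1
      have h2 := lt_of_le_of_ne hGx.1.2 h.2
      refine hfree (max (o + hh) (max x.re (G x).re)) (le_max_left _ _)
        (max_lt ht1 (max_lt h1 h2)) x ⟨⟨hx.1.1, ?_⟩, hx.2⟩ ⟨⟨hGx.1.1, ?_⟩, hGx.2⟩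
      · exact (le_max_left _ _).trans (le_max_right _ _)
      · exact (le_max_right _ _).trans (le_max_right _ _)
    have fin : (∀ᶠ s in 𝓝[<] t, ∀ Z : ℝ → Set ℝ, Z c0 = Zs o s k → (∀ c, LF (Z c)) →
      (∀ c d, Gap Y c d → c ≠ c0 → c < d0 + r → c0 - r < d → Z c = Z0 c) →
      FwdGood G (bricks Y Z) (rect o s c0 d0) ∧ FwdGood G.symm (bricks Y Z) (rect o s c0 d0)) →
      ∃ s, o + hh ≤ s ∧ s ≤ o + 1 ∧ Free G (rect o s c0 d0) ∧
      ∀ Z : ℝ → Set ℝ, Z c0 = Zs o s k → (∀ c, LF (Z c)) →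
      (∀ c d, Gap Y c d → c ≠ c0 → c < d0 + r → c0 - r < d → Z c = Z0 c) →
      FwdGood G (bricks Y Z) (rect o s c0 d0) ∧ FwdGood G.symm (bricks Y Z) (rect o s c0 d0) := by
      intro hev
      have e0 : ∀ᶠ s in 𝓝[<] t, s < t := eventually_nhdsWithin_of_forall fun s hs => hs
      have e1 : ∀ᶠ s in 𝓝[<] t, o + hh < s :=
        (lt_mem_nhds ht1 : ∀ᶠ s in 𝓝 t, _).filter_mono nhdsWithin_le_nhds
      obtain ⟨s, h1, h2, h3⟩ := (hev.and (e0.and e1)).exists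
      exact ⟨s, h3.le, by linarith [htS.1.2], hfree s h3.le h2, h1⟩
    apply fin
    rcases hor with hxt | hpt
    · have hpt : (G x).re < t := by
        refine lt_of_le_of_ne hGx.1.2 fun h => hS3 x (hxt.trans h.symm) hx.2 hGx.2
      have := row_half (G := G.symm) hY hY1 hZ0 hrow hk hhh hr (x := G x) (p := x)
        (G.symm_apply_apply x) ht1 htS.1.2 hGx hx hxt hpt (fun h => by
          refine lt_of_le_of_ne htS.1.2 fun h' => hS2 x (hxt.trans h') h hx.2 hGx.2)
        (fun s h1 h2 => free_symm (hfree s h1 h2))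
      filter_upwards [this] with s hs Z h1 h2 h3
      exact (hs Z h1 h2 h3).symm
    · have hxt : x.re < t := by
        refine lt_of_le_of_ne hx.1.2 fun h => hS3 x (h.trans hpt.symm) hx.2 hGx.2
      exact row_half hY hY1 hZ0 hrow hk hhh hr rfl ht1 htS.1.2 hx hGx hpt hxt (fun h => by
          refine lt_of_le_of_ne htS.1.2 fun h' => hS1 x h (hpt.trans h') hx.2 hGx.2) hfree

end FLC

namespace FLC

theorem line_trap {G : ℂ ≃ₜ ℂ} (hc : ∀ z, G (z + 1) = G z + 1) (hE : EndsOK G) (y0 : ℝ)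
    (h : ∀ z : ℂ, z.im = y0 → (G z).im ≠ y0) : OutV G := by
  set l : ℝ → ℂ := fun t => G (⟨t, y0⟩ : ℂ) with hl
  have hlc : Continuous l := by
    refine G.continuous.comp ?_
    have : (fun t : ℝ => (⟨t, y0⟩ : ℂ)) = fun t : ℝ => (t : ℂ) + y0 * Complex.I := by
      ext t; apply Complex.ext <;> simp
    rw [this]; fun_prop
  have hlp : ∀ s, l (s + 1) = l s + ((1 : ℝ) : ℂ) := by
    intro s
    simp only [hl]
    rw [show (⟨s + 1, y0⟩ : ℂ) = ⟨s, y0⟩ + 1 by apply Complex.ext <;> simp, hc]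
    simp
  have hne : ∀ t, (l t).im ≠ y0 := fun t => h _ rfl
  obtain ⟨ε, hε, hεl⟩ : ∃ ε : ℝ, (ε = 1 ∨ ε = -1) ∧ ∀ t, ε * y0 < ε * (l t).im := by
    have hpc : IsPreconnected (Set.range fun t => (l t).im) :=
      isPreconnected_range (Complex.continuous_im.comp hlc)
    rcases lt_or_gt_of_ne (hne 0) with h0 | h0
    · refine ⟨-1, Or.inr rfl, fun t => ?_⟩
      by_contra hcon
      have : y0 ∈ Set.range fun t => (l t).im :=
        hpc.Icc_subset ⟨0, rfl⟩ ⟨t, rfl⟩ ⟨h0.le, by linarith⟩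
      obtain ⟨s, hs⟩ := this
      exact hne s hs
    · refine ⟨1, Or.inl rfl, fun t => ?_⟩
      by_contra hcon
      have : y0 ∈ Set.range fun t => (l t).im :=
        hpc.Icc_subset ⟨t, rfl⟩ ⟨0, rfl⟩ ⟨by linarith, h0.le⟩
      obtain ⟨s, hs⟩ := this
      exact hne s hs
  have hεε : ε * ε = 1 := by rcases hε with rfl | rfl <;> norm_num
  have pt : ∀ c : ℝ, ε * ((⟨0, ε * c⟩ : ℂ)).im = c := fun c => by
    change ε * (ε * c) = c
    rw [← mul_assoc, hεε, one_mul]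
  have hy : |ε * y0| = |y0| := by rcases hε with rfl | rfl <;> simp
  refine ⟨{z | ε * y0 ≤ ε * z.im}, isClosed_le (by fun_prop) (by fun_prop), ?_, ?_, -ε, ?_,
    |y0| + 1, ?_, ?_⟩
  · intro z; simp
  · intro z hz
    have hz : ε * y0 ≤ ε * z.im := hz
    have hop : IsOpen {z : ℂ | ε * y0 < ε * z.im} := isOpen_lt (by fun_prop) (by fun_prop)
    suffices hs : ε * y0 < ε * (G z).im from
      mem_interior.2 ⟨{z : ℂ | ε * y0 < ε * z.im},
        fun w hw => (show ε * y0 < ε * w.im from hw).le, hop, hs⟩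
    rcases hz.lt_or_eq with hz | hz
    · by_contra hcon
      push Not at hcon
      obtain ⟨C, hC⟩ := per_bdd hlc hlp
      obtain ⟨M', hM'⟩ := hE.eps hε C
      set q : ℂ := ⟨0, ε * max (M' + 1) (ε * y0 + 1)⟩ with hq
      have q1 : M' < ε * q.im := by rw [hq, pt]; linarith [le_max_left (M' + 1) (ε * y0 + 1)]
      have q2 : ε * y0 < ε * q.im := by rw [hq, pt]; linarith [le_max_right (M' + 1) (ε * y0 + 1)]
      have hq3 := hM' q q1
      set K := G '' {w : ℂ | ε * y0 < ε * w.im} with hK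
      have hconv : Convex ℝ {w : ℂ | ε * y0 < ε * w.im} := by
        have : {w : ℂ | ε * y0 < ε * w.im} = Complex.imLm ⁻¹' {t : ℝ | ε * y0 < ε * t} := rfl
        rw [this]
        apply Convex.linear_preimage
        have h2 : {t : ℝ | ε * y0 < ε * t} = (ε • LinearMap.id : ℝ →ₗ[ℝ] ℝ) ⁻¹' Set.Ioi (ε * y0) := by
          ext; simp
        rw [h2]
        exact (convex_Ioi _).linear_preimage _
      have hJ : JoinedIn K (G q) (G z) :=
        ((hconv.isPathConnected ⟨z, hz⟩).image G.continuous).joinedIn _ ⟨q, q2, rfl⟩ _ ⟨z, hz, rfl⟩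
      have hlK : ∀ s, l s ∉ K := by
        rintro s ⟨w, hw, hws⟩
        have := G.injective hws
        rw [this] at hw
        exact lt_irrefl (ε * y0) hw
      rcases hε with rfl | rfl
      · exact sep_static hlc one_ne_zero hlp hlK hJ
          (fun s => by linarith [(abs_le.1 (hC s)).2]) (fun s => by linarith [hεl s])
      · exact sep_static hlc one_ne_zero hlp hlK hJ.symm
          (fun s => by linarith [hεl s]) (fun s => by linarith [(abs_le.1 (hC s)).1])
    · have : z.im = y0 := by rcases hε with rfl | rfl <;> linarith
      have h2 := hεl z.re
      simp only [hl] at h2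
      rwa [show (⟨z.re, y0⟩ : ℂ) = z by apply Complex.ext <;> simp [this]] at h2
  · rcases hε with rfl | rfl <;> simp
  · intro z hz
    change ε * y0 ≤ ε * z.im
    linarith [le_abs_self (ε * y0)]
  · intro z hz hz'
    have hz' : ε * y0 ≤ ε * z.im := hz'
    linarith [neg_abs_le (ε * y0)]

theorem disp_pos {G : ℂ ≃ₜ ℂ} (hc : ∀ z, G (z + 1) = G z + 1) (hf : ∀ z, G z ≠ z) (R : ℝ) :
    ∃ δ > 0, ∀ z : ℂ, |z.im| ≤ R → δ ≤ ‖G z - z‖ := by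
  have hG := G.continuous
  by_cases hR : 0 ≤ R
  · obtain ⟨w, hw, hmin⟩ := (box_compact 0 1 (-R) R).exists_isMinOn
      ⟨0, ⟨by simp, by simp⟩, by simpa using hR, by simpa using hR⟩
      (f := fun z => ‖G z - z‖) (by fun_prop)
    refine ⟨‖G w - w‖, norm_pos_iff.2 (sub_ne_zero.2 (hf w)), fun z hz => ?_⟩
    obtain ⟨n, hn⟩ := reduce_re z
    have := hmin (show z + n ∈ _ from ⟨hn, by simpa using (abs_le.1 hz)⟩)
    simp only [Set.mem_ofPred_eq] at this
    rw [comm_int hc] at this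
    simpa using this
  · exact ⟨1, one_pos, fun z hz => absurd ((abs_nonneg _).trans hz) hR⟩

theorem norm_le' (z : ℂ) : ‖z‖ ≤ |z.re| + |z.im| := Complex.norm_le_abs_re_add_abs_im z

theorem small_free {G : ℂ ≃ₜ ℂ} {R δ : ℝ} (hd : ∀ z : ℂ, |z.im| ≤ R → δ ≤ ‖G z - z‖)
    {u v c d : ℝ} (h1 : -R ≤ c) (h2 : d ≤ R) (h3 : (v - u) + (d - c) < δ) :
    Free G (rect u v c d) := by
  intro z hz hGz
  have := hd z (abs_le.2 ⟨h1.trans hz.2.1, hz.2.2.trans h2⟩)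
  have h4 := norm_le' (G z - z)
  have h5 : |(G z - z).re| ≤ v - u := by
    rw [Complex.sub_re, abs_le]; constructor <;> linarith [hz.1.1, hz.1.2, hGz.1.1, hGz.1.2]
  have h6 : |(G z - z).im| ≤ d - c := by
    rw [Complex.sub_im, abs_le]; constructor <;> linarith [hz.2.1, hz.2.2, hGz.2.1, hGz.2.2]
  linarith

theorem free_tr {G : ℂ ≃ₜ ℂ} (hc : ∀ z, G (z + 1) = G z + 1) {B : Set ℂ} (h : Free G B) (j : ℤ) :
    Free G (tr j B) := by
  intro z hz hGz
  refine h _ hz ?_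
  have := comm_int hc (-j) z
  push_cast at this
  rw [← sub_eq_add_neg, ← sub_eq_add_neg] at this
  rw [this]; exact hGz

theorem local_disp {G : ℂ ≃ₜ ℂ} {a v : ℂ} (h : G a ≠ a + v) :
    ∃ η > 0, ∀ z, ‖z - a‖ < η → η ≤ ‖G z - z - v‖ := by
  have hG := G.continuous
  have h0 : 0 < ‖G a - a - v‖ := norm_pos_iff.2 (by
    intro e; apply h; linear_combination e)
  have hcn : Continuous fun z => ‖G z - z - v‖ := by fun_prop
  have := hcn.continuousAt.eventually (lt_mem_nhds (half_lt_self h0))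
  obtain ⟨r, hr, hb⟩ := Metric.eventually_nhds_iff.1 this
  refine ⟨min r (‖G a - a - v‖ / 2), by positivity, fun z hz => ?_⟩
  have := hb (y := z) (by rw [dist_eq_norm]; exact hz.trans_le (min_le_left _ _))
  exact (min_le_right _ _).trans this.le

theorem core_rows {G : ℂ ≃ₜ ℂ} (hc : ∀ z, G (z + 1) = G z + 1) (hf : ∀ z, G z ≠ z) (hE : EndsOK G)
    {za zb : ℂ} (hlt : za.im < zb.im) (ha1 : G za ≠ za + 1) (ha2 : G za ≠ za + (-1))
    (hb1 : G zb ≠ zb + 1) (hb2 : G zb ≠ zb + (-1)) : OutV G ∨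
    ∃ P a b, BrickSys G P ∧ a ∈ P ∧ b ∈ P ∧ a ∈ 𝓝 za ∧ b ∈ 𝓝 zb ∧ (∀ j, tr j a ≠ b) ∧
      FwdGood G P a ∧ FwdGood G.symm P a ∧ FwdGood G P b ∧ FwdGood G.symm P b := by
  by_cases la : ∀ z : ℂ, z.im = za.im → (G z).im ≠ za.im
  · exact Or.inl (line_trap hc hE _ la)
  by_cases lb : ∀ z : ℂ, z.im = zb.im → (G z).im ≠ zb.im
  · exact Or.inl (line_trap hc hE _ lb)
  right
  push Not at la lb
  obtain ⟨η1, hη1, H1⟩ := local_disp ha1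
  obtain ⟨η2, hη2, H2⟩ := local_disp ha2
  obtain ⟨η3, hη3, H3⟩ := local_disp hb1
  obtain ⟨η4, hη4, H4⟩ := local_disp hb2
  obtain ⟨δ, hδ, hδR⟩ := disp_pos hc hf (|za.im| + |zb.im| + 2)
  set η := min (min (min η1 η2) (min η3 η4)) (min (δ / 2) (1 / 2)) with hη
  have hηpos : 0 < η := by positivity
  have b1 : η ≤ η1 := ((min_le_left _ _).trans (min_le_left _ _)).trans (min_le_left _ _)
  have b2 : η ≤ η2 := ((min_le_left _ _).trans (min_le_left _ _)).trans (min_le_right _ _)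
  have b3 : η ≤ η3 := ((min_le_left _ _).trans (min_le_right _ _)).trans (min_le_left _ _)
  have b4 : η ≤ η4 := ((min_le_left _ _).trans (min_le_right _ _)).trans (min_le_right _ _)
  have b5 : η ≤ δ / 2 := (min_le_right _ _).trans (min_le_left _ _)
  have b6 : η ≤ 1 / 2 := (min_le_right _ _).trans (min_le_right _ _)
  obtain ⟨Q, hQ2, hQ⟩ : ∃ Q : ℕ, 2 ≤ Q ∧ (zb.im - za.im) / Q < η := by
    obtain ⟨Q, hQ⟩ := exists_nat_gt ((zb.im - za.im) / η)
    refine ⟨Q + 2, by omega, ?_⟩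
    rw [div_lt_iff₀ hηpos] at hQ
    rw [div_lt_iff₀ (by positivity)]
    push_cast; nlinarith
  have hQpos : (0 : ℝ) < Q := by positivity
  have hQ2' : (2 : ℝ) ≤ Q := by exact_mod_cast hQ2
  set H := (zb.im - za.im) / Q with hH
  have hHpos : 0 < H := div_pos (by linarith) hQpos
  have hQH : Q * H = zb.im - za.im := by rw [hH]; field_simp
  set A := za.im - H / 2 with hA
  obtain ⟨K, hK, hK1⟩ : ∃ K : ℕ, 0 < K ∧ (1 : ℝ) / K < δ / 2 := by
    obtain ⟨K, hK⟩ := exists_nat_one_div_lt (half_pos hδ)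
    exact ⟨K + 1, by omega, by push_cast; exact hK⟩
  have hKr : (0 : ℝ) < 1 / K := by positivity
  have hN : ∀ j : ℤ, ∃ N : ℕ, 0 < N ∧ ∀ u v c d : ℝ, (-(|A| + (|(j : ℝ)| + 1) * H) ≤ c) →
      d ≤ (|A| + (|(j : ℝ)| + 1) * H) → v - u ≤ (1 : ℝ) / N → d - c ≤ H / N → Free G (rect u v c d) := by
    intro j
    obtain ⟨δj, hδj, hd⟩ := disp_pos hc hf (|A| + (|(j : ℝ)| + 1) * H)
    obtain ⟨N, hN⟩ := exists_nat_gt ((1 + H) / δj)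
    have hNpos : (0 : ℝ) < N := lt_trans (by positivity) hN
    refine ⟨N, by exact_mod_cast hNpos, fun u v c d h1 h2 h3 h4 => small_free hd h1 h2 ?_⟩
    rw [div_lt_iff₀ hδj] at hN
    have : 1 / (N : ℝ) + H / N < δj := by
      rw [← add_div, div_lt_iff₀ hNpos]; linarith
    linarith
  choose N hNpos hNfree using hN
  set n : ℤ → ℕ := fun j => if j = 0 ∨ j = Q then 1 else N j with hn
  have hnpos : ∀ j, 0 < n j := by
    intro j; simp only [hn]; split_ifs
    · exact one_pos
    · exact hNpos j
  set Y := Ys A H n with hYdef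
  have hY : LF Y := Ys_LF hHpos hnpos
  have hY1 : ∀ c d, Gap Y c d → d ≤ c + 1 := by
    intro c d hg
    have h1 := (Ys_gap hHpos hnpos hg).2
    have h2 : H / n (blk A H c) ≤ H := div_le_self hHpos.le (by exact_mod_cast hnpos _)
    linarith
  have n0 : n 0 = 1 := by simp [hn]
  have nQ : n Q = 1 := by simp [hn]
  have rowa : Gap Y A (A + H) := by
    have := Ys_gap_one (A := A) hHpos hnpos n0
    simpa using this
  have rowb : Gap Y (A + Q * H) (A + Q * H + H) := by
    have := Ys_gap_one (A := A) hHpos hnpos nQ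
    simp only [Int.cast_natCast] at this
    convert this using 1
    ring
  set Z0 : ℝ → Set ℝ := fun c => Zs 0 (1 / N (blk A H c)) (1 / N (blk A H c)) with hZ0
  have hNr : ∀ j, (0 : ℝ) < 1 / N j := fun j => by have := hNpos j; positivity
  have hZ0L : ∀ c, LF (Z0 c) := fun c => Zs_LF _ _ (hNr _)
  have hAa : |A| ≤ |za.im| + 1 := by
    rw [hA]; exact (abs_sub _ _).trans (by rw [abs_of_pos (half_pos hHpos)]; linarith)
  have l1 := neg_abs_le za.im
  have l2 := le_abs_self za.im
  have l3 := neg_abs_le zb.im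
  have l4 := le_abs_self zb.im
  have l5 := abs_nonneg za.im
  have l6 := abs_nonneg zb.im
  have hη' : H < η := hQ
  -- generic check for a row
  have rowS : ∀ z0 : ℂ, ∀ c0 : ℝ, c0 = z0.im - H / 2 → |z0.im| ≤ |za.im| + |zb.im| →
      (∀ z, ‖z - z0‖ < η → η ≤ ‖G z - z - 1‖) → (∀ z, ‖z - z0‖ < η → η ≤ ‖G z - z - (-1)‖) →
      (∃ z : ℂ, z.im = z0.im ∧ (G z).im = z0.im) → Gap Y c0 (c0 + H) →
      ∃ s, z0.re - H / 2 + H ≤ s ∧ s ≤ z0.re - H / 2 + 1 ∧ Free G (rect (z0.re - H / 2) s c0 (c0 + H)) ∧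
      ∀ Z : ℝ → Set ℝ, Z c0 = Zs (z0.re - H / 2) s (1 / K) → (∀ c, LF (Z c)) →
      (∀ c d, Gap Y c d → c ≠ c0 → c < c0 + H + H / 2 → c0 - H / 2 < d → Z c = Z0 c) →
      FwdGood G (bricks Y Z) (rect (z0.re - H / 2) s c0 (c0 + H)) ∧
      FwdGood G.symm (bricks Y Z) (rect (z0.re - H / 2) s c0 (c0 + H)) := by
    intro z0 c0 hc0 hz0 S1 S2 hl hrow
    have q1 := neg_abs_le z0.im
    have q2 := le_abs_self z0.im
    refine row_good hc hY hY1 hZ0L hrow hKr hHpos (by linarith) (half_pos hHpos) ?_ ?_ ?_ ?_ ?_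
    · intro x h1 h2 h3 h4
      have e1 : ‖x - z0‖ < η := by
        refine (norm_le' _).trans_lt ?_
        have p1 : |(x - z0).re| ≤ H / 2 := by
          rw [Complex.sub_re, h1, abs_le]; constructor <;> linarith
        have p2 : |(x - z0).im| ≤ H / 2 := by
          rw [Complex.sub_im, abs_le]; constructor <;> linarith [h3.1, h3.2]
        linarith
      have e2 := norm_le' (G x - x - 1)
      have p1 : |(G x - x - 1).re| ≤ 0 := by
        rw [Complex.sub_re, Complex.sub_re, h1, h2, Complex.one_re]; simp
      have p2 : |(G x - x - 1).im| ≤ H := by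
        rw [Complex.sub_im, Complex.sub_im, Complex.one_im, abs_le]
        constructor <;> linarith [h3.1, h3.2, h4.1, h4.2]
      linarith [S1 x e1]
    · intro x h1 h2 h3 h4
      have e1 : ‖(x + (-1 : ℤ)) - z0‖ < η := by
        refine (norm_le' _).trans_lt ?_
        have p1 : |((x + (-1 : ℤ)) - z0).re| ≤ H / 2 := by
          have e : ((x + (-1 : ℤ)) - z0).re = x.re - 1 - z0.re := by simp; ring
          rw [e, h1, abs_le]; constructor <;> linarith
        have p2 : |((x + (-1 : ℤ)) - z0).im| ≤ H / 2 := by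
          have e : ((x + (-1 : ℤ)) - z0).im = x.im - z0.im := by simp
          rw [e, abs_le]; constructor <;> linarith [h3.1, h3.2]
        exact (add_le_add p1 p2).trans_lt (by linarith)
      have e3 := S2 _ e1
      rw [comm_int hc, show G x + ((-1 : ℤ) : ℂ) - (x + ((-1 : ℤ) : ℂ)) - (-1) = G x - x + 1 by ring] at e3
      have e2 := norm_le' (G x - x + 1)
      have p1 : |(G x - x + 1).re| ≤ 0 := by
        rw [Complex.add_re, Complex.sub_re, h1, h2, Complex.one_re]; simp
      have p2 : |(G x - x + 1).im| ≤ H := by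
        rw [Complex.add_im, Complex.sub_im, Complex.one_im, abs_le]
        constructor <;> linarith [h3.1, h3.2, h4.1, h4.2]
      linarith
    · intro x h1 h3 h4
      have e2 := norm_le' (G x - x)
      have p1 : |(G x - x).re| ≤ 0 := by
        rw [Complex.sub_re, h1]; simp
      have p2 : |(G x - x).im| ≤ H := by
        rw [Complex.sub_im, abs_le]
        constructor <;> linarith [h3.1, h3.2, h4.1, h4.2]
      have := hδR x (abs_le.2 ⟨by linarith [h3.1, h3.2], by linarith [h3.1, h3.2]⟩)
      linarith
    · exact small_free hδR (by linarith) (by linarith) (by linarith)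
    · obtain ⟨z, h1, h2⟩ := hl
      exact ⟨z, ⟨by linarith, by linarith⟩, ⟨by linarith, by linarith⟩⟩
  obtain ⟨s0, hs01, hs02, hs03, hs04⟩ := rowS za A hA (by linarith)
    (fun z hz => b1.trans (H1 z (hz.trans_le b1))) (fun z hz => b2.trans (H2 z (hz.trans_le b2))) la rowa
  obtain ⟨s1, hs11, hs12, hs13, hs14⟩ := rowS zb (A + Q * H) (by rw [hQH]; linarith) (by linarith)
    (fun z hz => b3.trans (H3 z (hz.trans_le b3))) (fun z hz => b4.trans (H4 z (hz.trans_le b4))) lb rowb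
  set Z : ℝ → Set ℝ := fun c => if blk A H c = 0 then Zs (za.re - H / 2) s0 (1 / K) else
    if blk A H c = Q then Zs (zb.re - H / 2) s1 (1 / K) else Z0 c with hZ
  have hQ0 : (Q : ℤ) ≠ 0 := by omega
  have blka : blk A H A = 0 := by have := blk_base (A := A) hHpos 0; simpa using this
  have blkb : blk A H (A + Q * H) = Q := by
    have := blk_base (A := A) hHpos Q; simpa using this
  have hZa : Z A = Zs (za.re - H / 2) s0 (1 / K) := by simp [hZ, blka]
  have hZb : Z (A + Q * H) = Zs (zb.re - H / 2) s1 (1 / K) := by simp [hZ, blkb]; omega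
  have hZL : ∀ c, LF (Z c) := by
    intro c; simp only [hZ]; split_ifs
    · exact Zs_LF _ _ hKr
    · exact Zs_LF _ _ hKr
    · exact hZ0L c
  have hZT : ∀ c x, x ∈ Z c ↔ x + 1 ∈ Z c := by
    intro c x; simp only [hZ, hZ0]; split_ifs
    · exact Zs_T _ _ hK x
    · exact Zs_T _ _ hK x
    · exact Zs_T _ _ (hNpos _) x
  have g0 : ∀ c d, Gap Y c d → blk A H c = 0 → c = A ∧ d = A + H := by
    intro c d hg h0
    have := Ys_gap_one' hHpos hnpos hg (by rw [h0]; exact n0)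
    rw [h0] at this
    simpa using this
  have gQ : ∀ c d, Gap Y c d → blk A H c = Q → c = A + Q * H ∧ d = A + Q * H + H := by
    intro c d hg h0
    have := Ys_gap_one' hHpos hnpos hg (by rw [h0]; exact nQ)
    rw [h0] at this
    push_cast at this
    exact ⟨this.1, by rw [this.2]; ring⟩
  have hQHH : 2 * H ≤ Q * H := by nlinarith
  have hga := hs04 Z hZa hZL (by
    intro c d hg h1 h2 h3
    have t1 : blk A H c ≠ 0 := fun h => h1 (g0 c d hg h).1
    have t2 : blk A H c ≠ Q := fun h => by
      have := (gQ c d hg h).1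
      linarith
    simp only [hZ, if_neg t1, if_neg t2])
  have hgb := hs14 Z hZb hZL (by
    intro c d hg h1 h2 h3
    have t1 : blk A H c ≠ Q := fun h => h1 (gQ c d hg h).1
    have t2 : blk A H c ≠ 0 := fun h => by
      have := (g0 c d hg h).2
      linarith
    simp only [hZ, if_neg t1, if_neg t2])
  have hspecial : ∀ o s c0 : ℝ, o < s → s ≤ o + 1 → Free G (rect o s c0 (c0 + H)) →
      -(|za.im| + |zb.im| + 2) ≤ c0 → c0 + H ≤ |za.im| + |zb.im| + 2 →
      ∀ u v, Gap (Zs o s (1 / K)) u v → Free G (rect u v c0 (c0 + H)) := by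
    intro o s c0 h1 h2 h3 h4 h5 u v hg
    rcases Zs_gaps hKr h1 h2 hg with ⟨m, rfl, rfl⟩ | h
    · rw [← tr_rect]; exact free_tr hc h3 m
    · exact small_free hδR h4 h5 (by linarith)
  refine ⟨bricks Y Z, rect (za.re - H / 2) s0 A (A + H),
    rect (zb.re - H / 2) s1 (A + Q * H) (A + Q * H + H), ?_, ?_, ?_, ?_, ?_, ?_, hga.1, hga.2, hgb.1, hgb.2⟩
  · refine bricks_sys hc hY hY1 hZL hZT ?_
    intro u v c d hcd huv
    by_cases t1 : blk A H c = 0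
    · obtain ⟨rfl, rfl⟩ := g0 c d hcd t1
      rw [hZa] at huv
      exact hspecial _ _ _ (by linarith) hs02 hs03 (by linarith) (by linarith) u v huv
    by_cases t2 : blk A H c = Q
    · obtain ⟨rfl, rfl⟩ := gQ c d hcd t2
      rw [hZb] at huv
      exact hspecial _ _ _ (by linarith) hs12 hs13 (by linarith) (by linarith) u v huv
    simp only [hZ, if_neg t1, if_neg t2, hZ0] at huv
    have hgap := Ys_gap hHpos hnpos hcd
    have hnn : n (blk A H c) = N (blk A H c) := by simp [hn, t1, t2]
    rw [hnn] at hgap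
    have hble := blk_le (A := A) hHpos c
    set j := blk A H c with hj
    have hN1 : (1 : ℝ) / N j ≤ 1 := by
      rw [div_le_one (by exact_mod_cast hNpos j)]; exact_mod_cast hNpos j
    have a1 := neg_abs_le A
    have a2 := le_abs_self A
    have a3 := mul_le_mul_of_nonneg_right (neg_abs_le (j : ℝ)) hHpos.le
    have a4 := mul_le_mul_of_nonneg_right (le_abs_self (j : ℝ)) hHpos.le
    refine hNfree j u v c d (by linarith) (by linarith) ?_ hgap.2
    rcases Zs_gaps (hNr j) (hNr j) (by linarith) huv with ⟨m, rfl, rfl⟩ | h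
    · linarith
    · exact h
  · refine ⟨_, _, _, _, rowa, ?_, rfl⟩
    rw [hZa]; exact Zs_gap (by linarith) hs02
  · refine ⟨_, _, _, _, rowb, ?_, rfl⟩
    rw [hZb]; exact Zs_gap (by linarith) hs12
  · rw [← mem_interior_iff_mem_nhds, rect_interior]
    exact ⟨⟨by linarith, by linarith⟩, ⟨by linarith, by linarith⟩⟩
  · rw [← mem_interior_iff_mem_nhds, rect_interior]
    exact ⟨⟨by linarith, by linarith⟩, ⟨by linarith, by linarith⟩⟩
  · intro j hj
    rw [tr_rect] at hj
    have : (⟨zb.re - H / 2, A + Q * H⟩ : ℂ) ∈ rect (zb.re - H / 2) s1 (A + Q * H) (A + Q * H + H) :=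
      ⟨⟨le_rfl, by change zb.re - H / 2 ≤ s1; linarith⟩, le_rfl, by change A + Q * H ≤ _; linarith⟩
    rw [← hj] at this
    have := this.2.2
    change A + Q * H ≤ A + H at this
    linarith

theorem core {G : ℂ ≃ₜ ℂ} (hI : Iso G) (hc : ∀ z, G (z + 1) = G z + 1) (hf : ∀ z, G z ≠ z)
    (hE : EndsOK G) (hE' : EndsOK G.symm)
    {z1 z2 : ℂ} (hne : z1.im ≠ z2.im) (ha1 : G z1 ≠ z1 + 1) (ha2 : G z1 ≠ z1 + (-1))
    (hb1 : G z2 ≠ z2 + 1) (hb2 : G z2 ≠ z2 + (-1))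
    (r1 : ∀ U ∈ 𝓝 z1, ∃ L : ℕ, ∃ m : ℤ, m < 0 ∧ G^[L + 1] z1 - m ∈ U)
    (r2 : ∀ U ∈ 𝓝 z2, ∃ L : ℕ, ∃ m : ℤ, 0 < m ∧ G^[L + 1] z2 - m ∈ U) : OutV G := by
  rcases lt_or_gt_of_ne hne with h | h
  · rcases core_rows hc hf hE h ha1 ha2 hb1 hb2 with h | ⟨P, a, b, hP, ha, hb, na, nb, hab, g1, g2, g3, g4⟩
    · exact h
    · obtain ⟨L1, m1, hm1, hr1⟩ := r1 a na
      obtain ⟨L2, m2, hm2, hr2⟩ := r2 b nb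
      exact brick_main hP hI hf hE' ha hb hab g1 g2 g3 g4 (mem_of_mem_nhds na) (mem_of_mem_nhds nb)
        hm1 hm2 hr1 hr2
  · rcases core_rows hc hf hE h hb1 hb2 ha1 ha2 with h | ⟨P, a, b, hP, ha, hb, na, nb, hab, g1, g2, g3, g4⟩
    · exact h
    · obtain ⟨L1, m1, hm1, hr1⟩ := r1 b nb
      obtain ⟨L2, m2, hm2, hr2⟩ := r2 a na
      refine brick_main hP hI hf hE' hb ha (fun j hj => hab (-j) ?_) g3 g4 g1 g2 (mem_of_mem_nhds nb)
        (mem_of_mem_nhds na) hm1 hm2 hr1 hr2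
      rw [← hj, tr_tr, neg_add_cancel, tr_zero]

end FLC

namespace FLC

theorem lattice_walk {n : ℤ} {R : ℤ → ℤ → Prop} {J : ℕ} {Γ : ℤ × ℤ → ℤ × ℤ → Prop}
    (hRn : ∀ i j, R (i + n) j ↔ R i j) (hR0 : ∀ i j, j ≤ 0 → R i j) (hRJ : ∀ i j, (J : ℤ) ≤ j → ¬ R i j)
    (hsym : ∀ v u, Γ v u → Γ u v) (hsh : ∀ v u, Γ v u → ∀ m : ℤ, Γ (v + (m * n, 0)) (u + (m * n, 0)))
    (hh : ∀ i j, ¬ (R i (j - 1) ↔ R i j) → Γ (i, j) (i + 1, j))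
    (hv : ∀ i j, ¬ (R (i - 1) j ↔ R i j) → Γ (i, j) (i, j + 1)) (hn : 0 < n) :
    ∃ v, ∃ k : ℤ, k ≠ 0 ∧ Relation.ReflTransGen Γ v (v + (k * n, 0)) := by
  classical
  by_contra hcon
  push Not at hcon
  have e0 : ∀ v : ℤ × ℤ, v + ((0 : ℤ) * n, 0) = v := fun v => by simp
  have e2 : ∀ (v : ℤ × ℤ) (a b : ℤ), v + (a * n, 0) + (b * n, 0) = v + ((a + b) * n, 0) := fun v a b => by
    rw [add_assoc, add_mul]; simp
  set S := Relation.ReflTransGen Γ with hS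
  have ssym : ∀ {v u}, S v u → S u v := fun h => by
    induction h with
    | refl => exact Relation.ReflTransGen.refl
    | tail _ h ih => exact Relation.ReflTransGen.head (hsym _ _ h) ih
  have ssh : ∀ {v u} (m : ℤ), S v u → S (v + (m * n, 0)) (u + (m * n, 0)) := fun m h =>
    Relation.ReflTransGen.lift (fun v : ℤ × ℤ => v + (m * n, 0)) (fun a b hab => hsh a b hab m) _ _ h
  let st : Setoid (ℤ × ℤ) := ⟨fun v w => ∃ k : ℤ, S v (w + (k * n, 0)), ⟨
    fun v => ⟨0, by rw [e0]⟩,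
    fun {v w} ⟨k, hk⟩ => ⟨-k, by
      have := ssh (-k) (ssym hk)
      rwa [e2, add_neg_cancel, e0] at this⟩,
    fun {u v w} ⟨k, hk⟩ ⟨l, hl⟩ => ⟨l + k, by
      have := ssh k hl
      rw [e2] at this
      exact hk.trans this⟩⟩⟩
  have hrep : ∀ v, ∃ k : ℤ, S v ((Quotient.mk st v).out + (k * n, 0)) := fun v =>
    st.symm (Quotient.mk_out (s := st) v)
  choose φ hφ using hrep
  have key : ∀ v w (m : ℤ), S v (w + (m * n, 0)) → φ v = φ w + m := by
    intro v w m h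
    have hq : Quotient.mk st v = Quotient.mk st w := Quotient.sound ⟨m, h⟩
    have h1 := hφ v
    rw [hq] at h1
    have h2 := ssh m (hφ w)
    have h3 := (ssym h1).trans (h.trans h2)
    have h4 := ssh (- φ v) h3
    rw [e2, e2, e2, add_neg_cancel, e0] at h4
    by_contra hne
    exact hcon _ (φ w + (m + - φ v)) (fun h => hne (by omega)) h4
  have k1 : ∀ v w, Γ v w → φ v = φ w := fun v w h => by
    have := key v w 0 (by rw [e0]; exact Relation.ReflTransGen.single h)
    simpa using this
  have k2 : ∀ i j, φ (i + n, j) = φ (i, j) + 1 := fun i j => by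
    have := key (i + n, j) (i, j) 1 (by
      have : ((i, j) : ℤ × ℤ) + (1 * n, 0) = (i + n, j) := by simp
      rw [this])
    simpa using this
  set r : ℤ → ℤ → ℤ := fun i j => if R i j then 1 else 0 with hr
  have hr1 : ∀ i j, (r i j = 0 ∨ r i j = 1) := fun i j => by simp only [hr]; split_ifs <;> simp
  have ph : ∀ i j, (r i (j - 1) - r i j) * (φ (i, j) - φ (i + 1, j)) = 0 := by
    intro i j
    by_cases h : R i (j - 1) ↔ R i j
    · simp [hr, h]
    · rw [k1 _ _ (hh i j h)]; simp
  have pv : ∀ i j, (r i j - r (i - 1) j) * (φ (i, j + 1) - φ (i, j)) = 0 := by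
    intro i j
    by_cases h : R (i - 1) j ↔ R i j
    · simp [hr, h]
    · rw [k1 _ _ (hv i j h)]; simp
  set W : ℤ → ℤ := fun i => ∑ m ∈ Finset.range (J + 1), (r i (m - 1) - r i m) * φ (i, m) with hW
  have parts : ∀ i, ∀ N : ℕ, ∑ m ∈ Finset.range N, φ (i, m) * ((r i (m - 1) - r (i - 1) (m - 1)) - (r i m - r (i - 1) m))
      = φ (i, 0) * (r i (-1) - r (i - 1) (-1)) - φ (i, N) * (r i (N - 1) - r (i - 1) (N - 1)) := by
    intro i N
    induction N with
    | zero => simp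
    | succ N ih =>
      rw [Finset.sum_range_succ, ih]
      have := pv i N
      push_cast
      rw [add_sub_cancel_right]
      linear_combination this
  have hstep : ∀ i, W i = W (i - 1) := by
    intro i
    rw [← sub_eq_zero]
    simp only [hW]
    rw [← Finset.sum_sub_distrib]
    have : ∀ m ∈ Finset.range (J + 1), (r i (m - 1) - r i m) * φ (i, m)
        - (r (i - 1) (m - 1) - r (i - 1) m) * φ (i - 1, m) =
        φ (i, m) * ((r i (m - 1) - r (i - 1) (m - 1)) - (r i m - r (i - 1) m)) := by
      intro m _
      have := ph (i - 1) m
      rw [sub_add_cancel] at this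
      linear_combination (-1 : ℤ) * this
    rw [Finset.sum_congr rfl this, parts]
    have a1 : r i (-1) = 1 := if_pos (hR0 _ _ (by omega))
    have a2 : r (i - 1) (-1) = 1 := if_pos (hR0 _ _ (by omega))
    have a3 : r i ((J + 1 : ℕ) - 1) = 0 := if_neg (hRJ _ _ (by omega))
    have a4 : r (i - 1) ((J + 1 : ℕ) - 1) = 0 := if_neg (hRJ _ _ (by omega))
    rw [a1, a2, a3, a4]; simp
  have hconst : ∀ m : ℕ, W m = W 0 := by
    intro m
    induction m with
    | zero => simp
    | succ m ih => rw [hstep, ← ih]; push_cast; rw [add_sub_cancel_right]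
  have tele : ∀ N : ℕ, ∑ m ∈ Finset.range N, (r 0 (m - 1) - r 0 m) = r 0 (-1) - r 0 (N - 1) := by
    intro N
    induction N with
    | zero => simp
    | succ N ih => rw [Finset.sum_range_succ, ih]; push_cast; rw [add_sub_cancel_right]; ring
  have hend : W n = W 0 + 1 := by
    have a1 : r 0 (-1) = 1 := if_pos (hR0 _ _ (by omega))
    have a3 : r 0 ((J + 1 : ℕ) - 1) = 0 := if_neg (hRJ _ _ (by omega))
    have t := tele (J + 1)
    rw [a1, a3, sub_zero] at t
    rw [← t]
    simp only [hW]
    rw [← Finset.sum_add_distrib]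
    refine Finset.sum_congr rfl fun m _ => ?_
    have p1 : ∀ j, r n j = r 0 j := fun j => by
      have := hRn 0 j; rw [zero_add] at this; simp only [hr, this]
    have p2 := k2 0 m
    rw [zero_add] at p2
    rw [p1, p1, p2]; ring
  have := hconst n.toNat
  rw [Int.toNat_of_nonneg hn.le] at this
  omega

theorem walk_of_rtg {α : Type*} {Γ : α → α → Prop} {v u : α} (h : Relation.ReflTransGen Γ v u) :
    ∃ L : ℕ, ∃ w : ℕ → α, w 0 = v ∧ w L = u ∧ ∀ i < L, Γ (w i) (w (i + 1)) := by
  induction h with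
  | refl => exact ⟨0, fun _ => v, rfl, rfl, fun i hi => absurd hi (by omega)⟩
  | @tail b c _ hbc ih =>
    obtain ⟨L, w, h0, hL, hs⟩ := ih
    refine ⟨L + 1, fun i => if i ≤ L then w i else c, by simp [h0], by simp, fun i hi => ?_⟩
    rcases Nat.lt_succ_iff_lt_or_eq.1 hi with hi | rfl
    · simp only [if_pos hi.le, if_pos (show i + 1 ≤ L from hi)]; exact hs i hi
    · simp [hL, hbc]

theorem simple_walk {n : ℤ} (hn : 0 < n) {Γ : ℤ × ℤ → ℤ × ℤ → Prop}
    (hsh : ∀ v u, Γ v u → ∀ m : ℤ, Γ (v + (m * n, 0)) (u + (m * n, 0)))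
    (hex : ∃ v, ∃ k : ℤ, k ≠ 0 ∧ Relation.ReflTransGen Γ v (v + (k * n, 0))) :
    ∃ W : ℤ → ℤ × ℤ, ∃ L : ℤ, ∃ k : ℤ, 0 < L ∧ k ≠ 0 ∧ (∀ a, W (a + L) = W a + (k * n, 0)) ∧
      (∀ a, Γ (W a) (W (a + 1))) ∧ ∀ a b c : ℤ, W a = W b + (c * n, 0) → ∃ j, a = b + j * L := by
  classical
  have e0 : ∀ v : ℤ × ℤ, v + ((0 : ℤ) * n, 0) = v := fun v => by simp
  have e2 : ∀ (v : ℤ × ℤ) (a b : ℤ), v + (a * n, 0) + (b * n, 0) = v + ((a + b) * n, 0) := fun v a b => by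
    rw [add_assoc, add_mul]; simp
  let Q : ℕ → Prop := fun L => ∃ w : ℕ → ℤ × ℤ, ∃ k : ℤ, k ≠ 0 ∧ w L = w 0 + (k * n, 0) ∧
    ∀ i < L, Γ (w i) (w (i + 1))
  have hQ : ∃ L, Q L := by
    obtain ⟨v, k, hk, h⟩ := hex
    obtain ⟨L, w, h0, hL, hs⟩ := walk_of_rtg h
    exact ⟨L, w, k, hk, by rw [h0, hL], hs⟩
  obtain ⟨w, k, hk, hwL, hst⟩ := Nat.find_spec hQ
  have hmin : ∀ m, m < Nat.find hQ → ¬ Q m := fun m hm => Nat.find_min hQ hm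
  set L := Nat.find hQ with hL
  have hLpos : 0 < L := by
    rcases Nat.eq_zero_or_pos L with h | h
    · rw [h] at hwL
      have := congrArg Prod.fst hwL
      simp at this
      omega
    · exact h
  have hsimple : ∀ x y : ℕ, x < y → y < L → ∀ c : ℤ, w y ≠ w x + (c * n, 0) := by
    intro x y hxy hyL c h
    by_cases hc : c = 0
    · rw [hc, e0] at h
      refine hmin (L - (y - x)) (by omega) ⟨fun i => if i ≤ x then w i else w (i + (y - x)), k, hk, ?_, ?_⟩
      · have t1 : ¬ (L - (y - x) ≤ x) := by omega
        simp only [if_neg t1, if_pos (Nat.zero_le x)]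
        rw [← hwL]; congr 1; omega
      · intro i hi
        rcases lt_trichotomy i x with h1 | h1 | h1
        · simp only [if_pos h1.le, if_pos (show i + 1 ≤ x from h1)]
          exact hst i (by omega)
        · subst h1
          have t1 : ¬ (i + 1 ≤ i) := by omega
          simp only [if_neg t1, le_refl, if_true]
          rw [← h]
          have := hst y hyL
          rwa [show i + 1 + (y - i) = y + 1 by omega]
        · have t1 : ¬ (i + 1 ≤ x) := by omega
          have t2 : ¬ (i ≤ x) := by omega
          simp only [if_neg t1, if_neg t2]
          have := hst (i + (y - x)) (by omega)
          rwa [show i + 1 + (y - x) = i + (y - x) + 1 by omega]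
    · refine hmin (y - x) (by omega) ⟨fun i => w (x + i), c, hc, ?_, fun i hi => ?_⟩
      · simp only [add_zero]; rw [← h]; congr 1; omega
      · exact hst (x + i) (by omega)
  have hLz : (0 : ℤ) < L := by exact_mod_cast hLpos
  refine ⟨fun a => w (a % L).toNat + ((a / L * k) * n, 0), L, k, hLz, hk, ?_, ?_, ?_⟩
  · intro a
    simp only
    rw [e2, Int.add_emod_right, Int.add_ediv_of_dvd_right (dvd_refl _), Int.ediv_self hLz.ne']
    congr 3; ring
  · intro a
    simp only
    have m0 := Int.emod_nonneg a hLz.ne'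
    have m1 := Int.emod_lt_of_pos a hLz
    have hdm := Int.emod_add_mul_ediv a L
    by_cases h : a % L + 1 < L
    · have t1 : (a + 1) % L = a % L + 1 := by
        rw [← Int.emod_eq_of_lt (by omega) h, Int.emod_add_emod]
      have t2 : (a + 1) / L = a / L := by
        have h3 := Int.emod_add_mul_ediv (a + 1) L
        rw [t1] at h3
        have : (L : ℤ) * ((a + 1) / L) = L * (a / L) := by linarith
        exact mul_left_cancel₀ hLz.ne' this
      rw [t1, t2, show (a % L + 1).toNat = (a % L).toNat + 1 by omega]
      exact hsh _ _ (hst _ (by omega)) _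
    · have h' : a % L + 1 = L := by omega
      have t1 : (a + 1) % L = 0 := by
        rw [← Int.emod_add_emod, h', Int.emod_self]
      have t2 : (a + 1) / L = a / L + 1 := by
        have h3 := Int.emod_add_mul_ediv (a + 1) L
        rw [t1] at h3
        have : (L : ℤ) * ((a + 1) / L) = L * (a / L + 1) := by linarith
        exact mul_left_cancel₀ hLz.ne' this
      rw [t1, t2, show (0 : ℤ).toNat = 0 from rfl, show (a / L + 1) * k = k + a / L * k by ring, ← e2, ← hwL]
      have := hsh _ _ (hst (a % L).toNat (by omega)) (a / L * k)
      rwa [show (a % L).toNat + 1 = L by omega] at this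
  · intro a b c h
    simp only at h
    rw [e2] at h
    have m0 := Int.emod_nonneg a hLz.ne'
    have m1 := Int.emod_lt_of_pos a hLz
    have m2 := Int.emod_nonneg b hLz.ne'
    have m3 := Int.emod_lt_of_pos b hLz
    have hda := Int.emod_add_mul_ediv a L
    have hdb := Int.emod_add_mul_ediv b L
    have hsub : ∀ (u v : ℤ × ℤ) (p q : ℤ), u + (p * n, 0) = v + (q * n, 0) → u = v + ((q - p) * n, 0) := by
      intro u v p q h
      have h1 := congrArg Prod.fst h
      have h2 := congrArg Prod.snd h
      simp at h1 h2
      apply Prod.ext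
      · simp; linarith
      · simpa using h2
    rcases lt_trichotomy (a % L).toNat (b % L).toNat with hlt | heq | hlt
    · exact absurd (hsub _ _ _ _ h.symm) (hsimple _ _ hlt (by omega) _)
    · refine ⟨a / L - b / L, ?_⟩
      have : a % L = b % L := by omega
      linear_combination this - hda + hdb
    · exact absurd (hsub _ _ _ _ h) (hsimple _ _ hlt (by omega) _)

end FLC

namespace FLC

theorem seg_arith {x1 y1 x2 y2 dx dy ex ey : ℤ} {u v : ℝ} (hu0 : 0 ≤ u) (hu1 : u < 1) (hv0 : 0 ≤ v) (hv1 : v < 1)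
    (hd : (dx = 1 ∧ dy = 0) ∨ (dx = -1 ∧ dy = 0) ∨ (dx = 0 ∧ dy = 1) ∨ (dx = 0 ∧ dy = -1))
    (he : (ex = 1 ∧ ey = 0) ∨ (ex = -1 ∧ ey = 0) ∨ (ex = 0 ∧ ey = 1) ∨ (ex = 0 ∧ ey = -1))
    (hx : (x1 : ℝ) + u * dx = x2 + v * ex) (hy : (y1 : ℝ) + u * dy = y2 + v * ey) :
    (u = v ∧ x1 = x2 ∧ y1 = y2) ∨ (x2 = x1 + dx ∧ y2 = y1 + dy ∧ ex = -dx ∧ ey = -dy) := by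
  obtain ⟨m, rfl⟩ : ∃ m, x2 = x1 + m := ⟨x2 - x1, by ring⟩
  obtain ⟨k, rfl⟩ : ∃ k, y2 = y1 + k := ⟨y2 - y1, by ring⟩
  push_cast at hx hy
  have bnd : ∀ m d e : ℤ, |d| ≤ 1 → |e| ≤ 1 → (m : ℝ) = u * d - v * e → -2 < m ∧ m < 2 := by
    intro m d e h1 h2 h
    obtain ⟨h1, h1'⟩ := abs_le.1 h1
    obtain ⟨h2, h2'⟩ := abs_le.1 h2
    have a1 : (-1 : ℝ) ≤ d := by exact_mod_cast h1
    have a2 : (d : ℝ) ≤ 1 := by exact_mod_cast h1'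
    have a3 : (-1 : ℝ) ≤ e := by exact_mod_cast h2
    have a4 : (e : ℝ) ≤ 1 := by exact_mod_cast h2'
    have l : (-2 : ℝ) < m ∧ (m : ℝ) < 2 := by constructor <;> nlinarith
    exact ⟨by exact_mod_cast l.1, by exact_mod_cast l.2⟩
  have bm := bnd m dx ex (abs_le.2 ⟨by omega, by omega⟩) (abs_le.2 ⟨by omega, by omega⟩) (by linarith)
  have bk := bnd k dy ey (abs_le.2 ⟨by omega, by omega⟩) (abs_le.2 ⟨by omega, by omega⟩) (by linarith)
  have hm : m = -1 ∨ m = 0 ∨ m = 1 := by omega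
  have hk : k = -1 ∨ k = 0 ∨ k = 1 := by omega
  rcases hd with ⟨rfl, rfl⟩ | ⟨rfl, rfl⟩ | ⟨rfl, rfl⟩ | ⟨rfl, rfl⟩ <;>
  rcases he with ⟨rfl, rfl⟩ | ⟨rfl, rfl⟩ | ⟨rfl, rfl⟩ | ⟨rfl, rfl⟩ <;>
  rcases hm with rfl | rfl | rfl <;> rcases hk with rfl | rfl | rfl <;>
  push_cast at hx hy <;>
  first
  | (exfalso; linarith)
  | (left; exact ⟨by linarith, by omega, by omega⟩)
  | (right; exact ⟨by omega, by omega, by omega, by omega⟩)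

/-- piecewise linear curve through the points `p m`, `m ∈ ℤ` -/
noncomputable def pl (p : ℤ → ℂ) (t : ℝ) : ℂ :=
  p ⌊t⌋ + ((t - ⌊t⌋ : ℝ) : ℂ) * (p (⌊t⌋ + 1) - p ⌊t⌋)

theorem pl_Icc (p : ℤ → ℂ) (m : ℤ) {t : ℝ} (ht : t ∈ Set.Icc (m : ℝ) (m + 1)) :
    pl p t = p m + ((t - m : ℝ) : ℂ) * (p (m + 1) - p m) := by
  rcases ht.2.lt_or_eq with h | h
  · have : ⌊t⌋ = m := Int.floor_eq_iff.2 ⟨ht.1, h⟩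
    rw [pl, this]
  · have : ⌊t⌋ = m + 1 := by rw [h]; simp
    rw [pl, this, h]; push_cast; ring

theorem pl_cont (p : ℤ → ℂ) : Continuous (pl p) := by
  have hlf : LocallyFinite fun m : ℤ => Set.Icc (m : ℝ) (m + 1) := by
    intro x
    refine ⟨Set.Ioo (x - 1) (x + 1), Ioo_mem_nhds (by linarith) (by linarith), ?_⟩
    refine (Set.finite_Icc (⌊x⌋ - 3) (⌊x⌋ + 3)).subset ?_
    rintro m ⟨y, hy1, hy2⟩
    have f1 := Int.floor_le x
    have f2 := Int.lt_floor_add_one x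
    have g1 : (m : ℝ) ≤ ⌊x⌋ + 3 := by linarith [hy1.1, hy2.2]
    have g2 : (⌊x⌋ : ℝ) - 3 ≤ m := by linarith [hy1.2, hy2.1]
    exact ⟨by exact_mod_cast g2, by exact_mod_cast g1⟩
  refine hlf.continuous ?_ (fun m => isClosed_Icc) ?_
  · refine Set.eq_univ_of_forall fun x => Set.mem_iUnion.2 ⟨⌊x⌋, Int.floor_le x, (Int.lt_floor_add_one x).le⟩
  · intro m
    refine ContinuousOn.congr ?_ (fun t ht => pl_Icc p m ht)
    fun_prop

theorem pl_per (p : ℤ → ℂ) {L : ℤ} {c : ℂ} (h : ∀ a, p (a + L) = p a + c) (t : ℝ) :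
    pl p (t + L) = pl p t + c := by
  simp only [pl, Int.floor_add_intCast]
  rw [show ⌊t⌋ + L + 1 = ⌊t⌋ + 1 + L by ring, h, h]
  push_cast; ring

theorem pl_seg (p : ℤ → ℂ) (t : ℝ) : pl p t ∈ segment ℝ (p ⌊t⌋) (p (⌊t⌋ + 1)) := by
  rw [segment_eq_image']
  refine ⟨t - ⌊t⌋, ⟨by linarith [Int.floor_le t], by linarith [Int.lt_floor_add_one t]⟩, ?_⟩
  simp [pl]

def pos (v : ℤ × ℤ) : ℂ := ⟨v.1, v.2⟩

def nbr (v u : ℤ × ℤ) : Prop := u = v + (1, 0) ∨ u = v + (-1, 0) ∨ u = v + (0, 1) ∨ u = v + (0, -1)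

theorem pl_inj {W : ℤ → ℤ × ℤ} {n L k : ℤ} (hn : 0 < n) (hk : k ≠ 0)
    (hper : ∀ a, W (a + L) = W a + (k * n, 0)) (hnb : ∀ a, nbr (W a) (W (a + 1)))
    (hs : ∀ a b c : ℤ, W a = W b + (c * n, 0) → ∃ j, a = b + j * L) {s t : ℝ} {c : ℤ}
    (h : pl (fun a => pos (W a)) s = pl (fun a => pos (W a)) t + ((c * n : ℤ) : ℂ)) : ∃ j : ℤ, s = t + j * L := by
  have hperj : ∀ j : ℤ, ∀ a, W (a + j * L) = W a + (j * k * n, 0) := by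
    intro j
    induction j using Int.induction_on with
    | zero => intro a; simp
    | succ i ih =>
      intro a
      rw [show a + ((i : ℤ) + 1) * L = (a + i * L) + L by ring, hper, ih, add_assoc]
      congr 1
      ext <;> simp; ring
    | pred i ih =>
      intro a
      have h1 := hper (a + (-(i : ℤ) - 1) * L)
      rw [show a + (-(i : ℤ) - 1) * L + L = a + (-i) * L by ring, ih] at h1
      have h2 := congrArg Prod.fst h1
      have h3 := congrArg Prod.snd h1
      simp at h2 h3
      ext
      · simp; linarith
      · simp [h3]
  have hd : ∀ a, ∃ dx dy : ℤ, W (a + 1) = W a + (dx, dy) ∧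
      ((dx = 1 ∧ dy = 0) ∨ (dx = -1 ∧ dy = 0) ∨ (dx = 0 ∧ dy = 1) ∨ (dx = 0 ∧ dy = -1)) := by
    intro a
    rcases hnb a with h | h | h | h
    · exact ⟨_, _, h, by simp⟩
    · exact ⟨_, _, h, by simp⟩
    · exact ⟨_, _, h, by simp⟩
    · exact ⟨_, _, h, by simp⟩
  set a := ⌊s⌋ with ha
  set b := ⌊t⌋ with hb
  obtain ⟨dx, dy, hda, hdd⟩ := hd a
  obtain ⟨ex, ey, hdb, hde⟩ := hd b
  have h1 := congrArg Complex.re h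
  have h2 := congrArg Complex.im h
  simp only [pl, pos, ← ha, ← hb, hda, hdb] at h1 h2
  simp at h1 h2
  rcases seg_arith (x1 := (W a).1) (y1 := (W a).2) (x2 := (W b).1 + c * n) (y2 := (W b).2) (u := s - a) (v := t - b)
    (by linarith [Int.floor_le s]) (by linarith [Int.lt_floor_add_one s])
    (by linarith [Int.floor_le t]) (by linarith [Int.lt_floor_add_one t]) hdd hde
    (by push_cast; linarith) (by linarith) with ⟨e1, e2, e3⟩ | ⟨e1, e2, e3, e4⟩
  · obtain ⟨j, hj⟩ := hs a b c (by ext <;> simp [e2, e3])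
    refine ⟨j, ?_⟩
    have : (a : ℝ) = b + j * L := by exact_mod_cast hj
    linarith
  · exfalso
    obtain ⟨j, hj⟩ := hs (a + 1) b c (by rw [hda]; ext <;> simp <;> omega)
    have f1 : W (a + 1) = W b + (j * k * n, 0) := by rw [hj, hperj]
    have f2 : W (a + 2) = W (b + 1) + (j * k * n, 0) := by
      rw [show a + 2 = (b + 1) + j * L by linarith, hperj]
    have f3 : W (a + 2) = W a := by
      rw [f2, hdb, add_right_comm, ← f1, hda, e3, e4]
      ext <;> simp
    obtain ⟨i, hi⟩ := hs (a + 2) a 0 (by rw [f3]; simp)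
    have f4 := hperj i a
    rw [← hi, f3] at f4
    have f5 := congrArg Prod.fst f4
    simp at f5
    rcases f5 with (f5 | f5) | f5
    · rw [f5] at hi; omega
    · exact hk f5
    · omega

end FLC

namespace FLC

theorem inv_int {A : Set ℂ} (h : ∀ z, z ∈ A ↔ z + 1 ∈ A) (m : ℤ) (z : ℂ) : z + m ∈ A ↔ z ∈ A := by
  induction m using Int.induction_on with
  | zero => simp
  | succ n ih => push_cast at ih ⊢; rw [← ih, h (z + n), add_assoc]
  | pred n ih => push_cast at ih ⊢; rw [← ih, h]; congr! 1; ring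

theorem sep_dist {A1 A2 : Set ℂ} (c1 : IsClosed A1) (c2 : IsClosed A2) (t1 : ∀ z, z ∈ A1 ↔ z + 1 ∈ A1)
    (t2 : ∀ z, z ∈ A2 ↔ z + 1 ∈ A2) (hdis : ∀ z, z ∈ A1 → z ∉ A2) {M : ℝ} (hM : 0 ≤ M)
    (h1 : ∀ z : ℂ, z.im ≤ -M → z ∈ A1) (h2 : ∀ z : ℂ, M ≤ z.im → z ∈ A2) :
    ∃ δ > 0, ∀ z ∈ A1, ∀ w ∈ A2, δ ≤ ‖z - w‖ := by
  have hne2 : A2.Nonempty := ⟨⟨0, M⟩, h2 _ le_rfl⟩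
  obtain ⟨x, hx, hmin⟩ := ((box_compact 0 1 (-(M + 1)) (M + 1)).inter_left c1).exists_isMinOn
    ⟨⟨0, -M⟩, h1 _ le_rfl, ⟨by simp, by simp⟩, by simp, by change -M ≤ M + 1; linarith⟩
    (Metric.continuous_infDist_pt A2).continuousOn
  have hpos : 0 < Metric.infDist x A2 := (c2.notMem_iff_infDist_pos hne2).1 (hdis x hx.1)
  refine ⟨min (Metric.infDist x A2) 1, lt_min hpos one_pos, fun z hz w hw => ?_⟩
  by_cases hzim : -(M + 1) ≤ z.im
  · have hz2 : z.im < M := by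
      by_contra h
      exact hdis z hz (h2 z (not_lt.1 h))
    obtain ⟨n, hn⟩ := reduce_re z
    have := hmin (show z + n ∈ _ from ⟨(inv_int t1 n z).2 hz, hn, by simpa using hzim, by simp; linarith⟩)
    simp only [Set.mem_ofPred_eq] at this
    refine (min_le_left _ _).trans (this.trans ((Metric.infDist_le_dist_of_mem ((inv_int t2 n w).2 hw)).trans ?_))
    rw [dist_eq_norm]; simp
  · have : -M < w.im := by
      by_contra h
      exact hdis w (h1 w (not_lt.1 h)) hw
    refine (min_le_right _ _).trans ?_
    have h3 := Complex.abs_im_le_norm (z - w)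
    rw [Complex.sub_im] at h3
    have := neg_abs_le (z.im - w.im)
    linarith

theorem rect_convex (u v c d : ℝ) : Convex ℝ (rect u v c d) :=
  ((convex_Icc u v).linear_preimage Complex.reLm).inter ((convex_Icc c d).linear_preimage Complex.imLm)

theorem sep_curve {A1 A2 : Set ℂ} (c1 : IsClosed A1) (c2 : IsClosed A2) (t1 : ∀ z, z ∈ A1 ↔ z + 1 ∈ A1)
    (t2 : ∀ z, z ∈ A2 ↔ z + 1 ∈ A2) (hdis : ∀ z, z ∈ A1 → z ∉ A2) {M0 : ℝ}
    (h1 : ∀ z : ℂ, z.im ≤ -M0 → z ∈ A1) (h2 : ∀ z : ℂ, M0 ≤ z.im → z ∈ A2) :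
    ∃ g : ℝ → ℂ, ∃ k : ℤ, Continuous g ∧ k ≠ 0 ∧ (∀ t, g (t + 1) = g t + k) ∧
      (∀ t, g t ∉ A1 ∧ g t ∉ A2) ∧ ∀ s t : ℝ, ∀ c : ℤ, g s = g t + c → ∃ j : ℤ, s = t + j := by
  obtain ⟨M, hM⟩ := exists_nat_ge M0
  replace h1 : ∀ z : ℂ, z.im ≤ -M → z ∈ A1 := fun z hz => h1 z (by linarith)
  replace h2 : ∀ z : ℂ, M ≤ z.im → z ∈ A2 := fun z hz => h2 z (by linarith)
  obtain ⟨δ, hδ, hsep⟩ := sep_dist c1 c2 t1 t2 hdis (Nat.cast_nonneg M) h1 h2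
  obtain ⟨n0, hn0⟩ := exists_nat_gt (2 / δ)
  obtain ⟨n, hnpos, hnδ⟩ : ∃ n : ℕ, 0 < n ∧ 2 / (n : ℝ) < δ := by
    have : (0 : ℝ) < n0 := lt_trans (by positivity) hn0
    refine ⟨n0, by exact_mod_cast this, ?_⟩
    rw [div_lt_iff₀ hδ] at hn0
    rw [div_lt_iff₀ this]; linarith
  have hnr : (0 : ℝ) < n := by exact_mod_cast hnpos
  have hnc : (n : ℂ) ≠ 0 := by exact_mod_cast hnpos.ne'
  set P : ℤ × ℤ → ℂ := fun v => ⟨v.1 / n, v.2 / n - M⟩ with hP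
  have hPpos : ∀ v, P v = pos v / n - M * Complex.I := by
    intro v
    apply Complex.ext <;> simp [hP, pos]
  set S : ℤ → ℤ → Set ℂ := fun i j => rect (i / n) ((i + 1) / n) (j / n - M) ((j + 1) / n - M) with hS
  set R : ℤ → ℤ → Prop := fun i j => ∃ z ∈ S i j, z ∈ A1 with hR
  set Γ : ℤ × ℤ → ℤ × ℤ → Prop := fun v u => nbr v u ∧ ∀ z ∈ segment ℝ (P v) (P u), z ∉ A1 ∧ z ∉ A2 with hΓ
  have hPs : ∀ v (m : ℤ), P (v + (m * n, 0)) = P v + m := by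
    intro v m
    apply Complex.ext
    · simp [hP]; field_simp
    · simp [hP]
  have hsh : ∀ v u, Γ v u → ∀ m : ℤ, Γ (v + (m * n, 0)) (u + (m * n, 0)) := by
    rintro v u ⟨hnb, hseg⟩ m
    refine ⟨?_, fun z hz => ?_⟩
    · rcases hnb with h | h | h | h
      · exact Or.inl (by rw [h]; abel)
      · exact Or.inr (Or.inl (by rw [h]; abel))
      · exact Or.inr (Or.inr (Or.inl (by rw [h]; abel)))
      · exact Or.inr (Or.inr (Or.inr (by rw [h]; abel)))
    · rw [hPs, hPs, add_comm (P v), add_comm (P u), ← segment_translate_image] at hz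
      obtain ⟨w, hw, rfl⟩ := hz
      have := hseg w hw
      simp only
      rw [add_comm, inv_int t1, inv_int t2]
      exact this
  have hcell : ∀ i j i' j' z, z ∈ S i j → z ∈ S i' j' → ¬ (R i j ↔ R i' j') → z ∉ A1 ∧ z ∉ A2 := by
    intro i j i' j' z hz hz' hne
    have hd : ∀ i j, z ∈ S i j → R i j → z ∉ A2 := by
      rintro i j hz ⟨w, hw, hwA⟩ hzA
      have := hsep w hwA z hzA
      have h4 := norm_le' (w - z)
      have e : ∀ x : ℝ, (x + 1) / n - x / n = 1 / n := fun x => by ring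
      have e1 := e i
      have e2 := e j
      have h5 : |(w - z).re| ≤ 1 / n := by
        rw [Complex.sub_re, abs_le]
        constructor <;> linarith [hz.1.1, hz.1.2, hw.1.1, hw.1.2]
      have h6 : |(w - z).im| ≤ 1 / n := by
        rw [Complex.sub_im, abs_le]
        constructor <;> linarith [hz.2.1, hz.2.2, hw.2.1, hw.2.2]
      have : 2 / (n : ℝ) = 1 / n + 1 / n := by ring
      linarith
    refine ⟨fun hzA => hne ⟨fun _ => ⟨z, hz', hzA⟩, fun _ => ⟨z, hz, hzA⟩⟩, fun hzA => ?_⟩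
    by_cases h : R i j
    · exact hd i j hz h hzA
    · by_cases h' : R i' j'
      · exact hd _ _ hz' h' hzA
      · exact hne ⟨fun x => absurd x h, fun x => absurd x h'⟩
  have hmemS : ∀ i j a b : ℤ, (a = i ∨ a = i + 1) → (b = j ∨ b = j + 1) → P (a, b) ∈ S i j := by
    intro i j a b ha hb
    have ha1 : (i : ℝ) ≤ a ∧ (a : ℝ) ≤ i + 1 := by
      rcases ha with rfl | rfl <;> constructor <;> push_cast <;> linarith
    have hb1 : (j : ℝ) ≤ b ∧ (b : ℝ) ≤ j + 1 := by
      rcases hb with rfl | rfl <;> constructor <;> push_cast <;> linarith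
    refine ⟨⟨?_, ?_⟩, ⟨?_, ?_⟩⟩ <;> simp only [hP]
    · exact div_le_div_of_nonneg_right ha1.1 hnr.le
    · gcongr; exact ha1.2
    · exact sub_le_sub_right (div_le_div_of_nonneg_right hb1.1 hnr.le) _
    · gcongr; exact hb1.2
  have hedge : ∀ i j i' j' a b a' b', P (a, b) ∈ S i j → P (a, b) ∈ S i' j' → P (a', b') ∈ S i j →
      P (a', b') ∈ S i' j' → ¬ (R i j ↔ R i' j') → ∀ z ∈ segment ℝ (P (a, b)) (P (a', b')), z ∉ A1 ∧ z ∉ A2 :=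
    fun i j i' j' a b a' b' m1 m2 m3 m4 hne z hz =>
      hcell i j i' j' z ((rect_convex _ _ _ _).segment_subset m1 m3 hz)
        ((rect_convex _ _ _ _).segment_subset m2 m4 hz) hne
  have hRn1 : ∀ i j (m : ℤ), R i j → R (i + m * n) j := by
    rintro i j m ⟨z, hz, hzA⟩
    refine ⟨z + m, ?_, (inv_int t1 m z).2 hzA⟩
    have e1 : ((i + m * n : ℤ) : ℝ) / n = i / n + m := by push_cast; field_simp
    have e2 : (((i + m * n : ℤ) : ℝ) + 1) / n = (i + 1) / n + m := by push_cast; field_simp; ring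
    refine ⟨?_, ?_⟩
    · rw [e1, e2]; simp; exact ⟨hz.1.1, hz.1.2⟩
    · simpa using hz.2
  have hex := lattice_walk (n := (n : ℤ)) (R := R) (J := 2 * M * n) (Γ := Γ) (fun i j => ⟨fun h => by
      have := hRn1 _ _ (-1) h; simpa using this, fun h => by have := hRn1 _ _ 1 h; simpa using this⟩)
    (fun i j hj => ⟨P (i, j), hmemS i j i j (Or.inl rfl) (Or.inl rfl), h1 _ (by
      have : (j : ℝ) ≤ 0 := by exact_mod_cast hj
      have := div_nonpos_of_nonpos_of_nonneg this hnr.le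
      simp only [hP]; linarith)⟩)
    (by
      rintro i j hj ⟨z, hz, hzA⟩
      have h3 : ((2 * M * n : ℕ) : ℝ) ≤ j := by exact_mod_cast hj
      push_cast at h3
      have h4 : (2 * M : ℝ) ≤ j / n := by rw [le_div_iff₀ hnr]; exact h3
      exact hdis z hzA (h2 z (by linarith [hz.2.1])))
    (by
      rintro v u ⟨hnb, hseg⟩
      refine ⟨?_, by rw [segment_symm]; exact hseg⟩
      rcases hnb with h | h | h | h
      · exact Or.inr (Or.inl (by rw [h]; ext <;> simp))
      · exact Or.inl (by rw [h]; ext <;> simp)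
      · exact Or.inr (Or.inr (Or.inr (by rw [h]; ext <;> simp)))
      · exact Or.inr (Or.inr (Or.inl (by rw [h]; ext <;> simp))))
    hsh
    (fun i j h => ⟨Or.inl (by simp), hedge i (j - 1) i j _ _ _ _
      (hmemS _ _ _ _ (Or.inl rfl) (Or.inr (by ring))) (hmemS _ _ _ _ (Or.inl rfl) (Or.inl rfl))
      (hmemS _ _ _ _ (Or.inr rfl) (Or.inr (by ring))) (hmemS _ _ _ _ (Or.inr rfl) (Or.inl rfl)) h⟩)
    (fun i j h => ⟨Or.inr (Or.inr (Or.inl (by simp))), hedge (i - 1) j i j _ _ _ _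
      (hmemS _ _ _ _ (Or.inr (by ring)) (Or.inl rfl)) (hmemS _ _ _ _ (Or.inl rfl) (Or.inl rfl))
      (hmemS _ _ _ _ (Or.inr (by ring)) (Or.inr rfl)) (hmemS _ _ _ _ (Or.inl rfl) (Or.inr rfl)) h⟩)
    (by exact_mod_cast hnpos)
  obtain ⟨W, L, k, hL, hk, hper, hst, hsim⟩ := simple_walk (by exact_mod_cast hnpos) hsh hex
  have hppos : ∀ a, pos (W (a + L)) = pos (W a) + ((k * n : ℤ) : ℂ) := by
    intro a; rw [hper]; apply Complex.ext <;> simp [pos]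
  have hLr : (0 : ℝ) < L := by exact_mod_cast hL
  refine ⟨fun t => pl (fun a => pos (W a)) (t * L) / n - M * Complex.I, k, ?_, hk, ?_, ?_, ?_⟩
  · have := pl_cont (fun a => pos (W a))
    fun_prop
  · intro t
    simp only
    rw [show (t + 1) * (L : ℝ) = t * L + L by ring, pl_per _ hppos]
    push_cast; field_simp; ring
  · intro t
    simp only
    have h3 := pl_seg (fun a => pos (W a)) (t * L)
    refine (hst ⌊t * L⌋).2 _ ?_
    rw [hPpos, hPpos]
    rw [segment_eq_image'] at h3 ⊢
    obtain ⟨θ, hθ, h4⟩ := h3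
    refine ⟨θ, hθ, ?_⟩
    rw [← h4]; simp; ring
  · intro s t c h
    simp only at h
    have h5 : pl (fun a => pos (W a)) (s * L) = pl (fun a => pos (W a)) (t * L) + ((c * n : ℤ) : ℂ) := by
      push_cast
      set x := pl (fun a => pos (W a)) (s * L)
      set y := pl (fun a => pos (W a)) (t * L)
      have h6 : x / n = y / n + c := by linear_combination h
      field_simp at h6
      linear_combination h6
    obtain ⟨j, hj⟩ := pl_inj (by exact_mod_cast hnpos) hk hper (fun a => (hst a).1) hsim h5
    refine ⟨j, ?_⟩
    have : (s - t - j) * L = 0 := by linear_combination hj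
    rcases mul_eq_zero.1 this with h | h
    · linarith
    · exact absurd h hLr.ne'

end FLC

namespace FLC

theorem iter_homeo (h : ℂ ≃ₜ ℂ) (n : ℕ) : ∃ H : ℂ ≃ₜ ℂ, ∀ z, H z = h^[n] z := by
  induction n with
  | zero => exact ⟨Homeomorph.refl ℂ, fun z => rfl⟩
  | succ n ih =>
    obtain ⟨H, hH⟩ := ih
    exact ⟨h.trans H, fun z => by simp [hH]⟩

theorem int_inv {A : Set ℂ} (h : ∀ z, z ∈ A ↔ z + 1 ∈ A) (m : ℤ) {z : ℂ} (hz : z ∈ interior A) :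
    z + m ∈ interior A := by
  refine mem_interior.2 ⟨(fun w : ℂ => w - m) ⁻¹' interior A, fun w hw => ?_,
    isOpen_interior.preimage (by fun_prop), ?_⟩
  · have := interior_subset hw
    rw [← inv_int h m] at this
    simpa using this
  · simpa using hz

theorem infDist_inv {A : Set ℂ} (h : ∀ z, z ∈ A ↔ z + 1 ∈ A) (z : ℂ) :
    Metric.infDist (z + 1) A = Metric.infDist z A := by
  have h1 : (fun w : ℂ => w + 1) '' A = A := by
    ext w
    constructor
    · rintro ⟨x, hx, rfl⟩; exact (h x).1 hx
    · intro hw; exact ⟨w - 1, (h _).2 (by simpa using hw), by simp⟩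
  have h2 : Isometry (fun w : ℂ => w + 1) := isometry_add_right 1
  have := Metric.infDist_image h2 (x := z) (t := A)
  rwa [h1] at this

theorem out_rescale {G : ℂ ≃ₜ ℂ} (hI : IsoT G) (hf : ∀ z, G z ≠ z) {z1 z2 : ℂ} (hne : z1.im ≠ z2.im)
    (r1 : ∀ N : ℕ, 0 < N → ∀ U ∈ 𝓝 z1, ∃ L : ℕ, ∃ m : ℤ, m < 0 ∧ G^[L + 1] z1 - N * m ∈ U)
    (r2 : ∀ N : ℕ, 0 < N → ∀ U ∈ 𝓝 z2, ∃ L : ℕ, ∃ m : ℤ, 0 < m ∧ G^[L + 1] z2 - N * m ∈ U) : OutV G := by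
  obtain ⟨N, hN⟩ := exists_nat_gt (‖G z1 - z1‖ + ‖G z2 - z2‖)
  have b1 := norm_nonneg (G z1 - z1)
  have b2 := norm_nonneg (G z2 - z2)
  have hNr : (0 : ℝ) < N := by linarith
  have hNpos : 0 < N := by exact_mod_cast hNr
  have hNc : (N : ℂ) ≠ 0 := by exact_mod_cast hNpos.ne'
  set G1 : ℂ ≃ₜ ℂ := ((Homeomorph.mulLeft₀ (N : ℂ) hNc).trans G).trans (Homeomorph.mulLeft₀ (N : ℂ) hNc).symm with hG1
  have e1 : ∀ z, G1 z = G (N * z) / N := by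
    intro z
    simp [hG1, div_eq_inv_mul]
  have e2 : ∀ z, G1 (z / N) = G z / N := fun z => by rw [e1]; congr 2; field_simp
  have e3 : ∀ (k : ℕ) z, G1^[k] (z / N) = G^[k] z / N := by
    intro k
    induction k with
    | zero => intro z; rfl
    | succ k ih => intro z; rw [Function.iterate_succ_apply, e2, ih, Function.iterate_succ_apply]
  have hI1 : IsoT G1 := by
    obtain ⟨H, hc, h0, h1, hi, he⟩ := hI
    refine ⟨fun p => H (p.1, N * p.2) / N, by fun_prop, fun z => ?_, fun z => ?_, fun t a b hab => ?_, fun t z => ?_⟩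
    · simp only [h0]; field_simp
    · simp only [h1, e1]
    · simp only at hab
      have h3 : H (t, N * a) = H (t, N * b) := by field_simp at hab; exact hab
      have h4 := hi t h3
      exact mul_left_cancel₀ hNc h4
    · simp only
      have := comm_int (f := fun z => H (t, z)) (he t) N (N * z)
      simp only [Int.cast_natCast] at this
      rw [mul_add, mul_one, this]; field_simp
  have hE1 := hI1.ends
  have far : ∀ z, ‖G z - z‖ < N → G1 (z / N) ≠ z / N + 1 ∧ G1 (z / N) ≠ z / N + (-1) := by
    intro z hz
    rw [e2]
    constructor
    · intro h
      have : G z - z = N := by field_simp at h; linear_combination h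
      rw [this] at hz; simp at hz
    · intro h
      have : G z - z = -N := by field_simp at h; linear_combination h
      rw [this] at hz; simp at hz
  have hrr : ∀ z U, U ∈ 𝓝 (z / (N : ℂ)) → (fun w : ℂ => w / N) ⁻¹' U ∈ 𝓝 z := by
    intro z U hU
    have : Continuous fun w : ℂ => w / N := by fun_prop
    exact this.continuousAt hU
  have hsub : ∀ z (k : ℕ) (m : ℤ), (G^[k] z - N * m) / N = G1^[k] (z / N) - m := by
    intro z k m; rw [e3]; field_simp
  have hO : OutV G1 := by
    refine core (z1 := z1 / N) (z2 := z2 / N) hI1.iso hI1.comm ?_ hE1 (EndsOK.symm hI1.comm hE1) ?_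
      (far z1 (by linarith)).1 (far z1 (by linarith)).2 (far z2 (by linarith)).1 (far z2 (by linarith)).2 ?_ ?_
    · intro z h
      rw [e1] at h
      apply hf (N * z)
      field_simp at h; exact h
    · intro h
      apply hne
      have h4 : ∀ z : ℂ, (z / N).im = z.im / N := fun z => by simp
      rw [h4, h4] at h
      field_simp at h; exact h
    · intro U hU
      obtain ⟨L, m, hm, h⟩ := r1 N hNpos _ (hrr _ _ hU)
      refine ⟨L, m, hm, ?_⟩
      rw [← hsub]; exact h
    · intro U hU
      obtain ⟨L, m, hm, h⟩ := r2 N hNpos _ (hrr _ _ hU)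
      refine ⟨L, m, hm, ?_⟩
      rw [← hsub]; exact h
  obtain ⟨V, hVc, hVT, hVG, ε, hε, M, hM1, hM2⟩ := hO
  have him : ∀ (z : ℂ) (j : ℤ), ((z + j) / N).im = z.im / N := fun z j => by simp
  refine ⟨{z | ∃ j : ℤ, (z + j) / N ∈ V}, ?_, ?_, ?_, ε, hε, N * M, ?_, ?_⟩
  · have : {z : ℂ | ∃ j : ℤ, (z + j) / N ∈ V} = ⋃ j ∈ Finset.range N, (fun z : ℂ => (z + (j : ℕ)) / N) ⁻¹' V := by
      ext z
      simp only [Set.mem_iUnion, Finset.mem_range, Set.mem_preimage, exists_prop]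
      constructor
      · rintro ⟨j, hj⟩
        have hNz : (0 : ℤ) < N := by exact_mod_cast hNpos
        have m0 := Int.emod_nonneg j hNz.ne'
        have m1 := Int.emod_lt_of_pos j hNz
        have hd := Int.emod_add_mul_ediv j N
        refine ⟨(j % N).toNat, by omega, ?_⟩
        rw [← inv_int hVT (j / N)]
        have hc1 : (((j % N).toNat : ℕ) : ℂ) = ((j % N : ℤ) : ℂ) := by
          rw [← Int.cast_natCast, Int.toNat_of_nonneg m0]
        have hc2 : (j : ℂ) = ((j % N : ℤ) : ℂ) + N * ((j / N : ℤ) : ℂ) := by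
          exact_mod_cast hd.symm
        rw [hc2] at hj
        rw [hc1]
        convert hj using 1
        field_simp
        ring
      · rintro ⟨j, _, hj⟩
        exact ⟨j, by simpa using hj⟩
    rw [this]
    refine isClosed_biUnion_finset fun j _ => hVc.preimage (by fun_prop)
  · intro z
    constructor
    · rintro ⟨j, hj⟩; exact ⟨j - 1, by push_cast; convert hj using 2; ring⟩
    · rintro ⟨j, hj⟩; exact ⟨j + 1, by push_cast; convert hj using 2; ring⟩
  · rintro z ⟨j, hj⟩
    have h3 := hVG _ hj
    rw [e2, comm_int hI.comm] at h3
    exact mem_interior.2 ⟨(fun w : ℂ => (w + j) / N) ⁻¹' interior V, fun w hw => ⟨j, interior_subset hw⟩,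
      isOpen_interior.preimage (by fun_prop), h3⟩
  · intro z hz
    refine ⟨0, hM1 _ ?_⟩
    rw [him, ← mul_div_assoc, div_le_iff₀ hNr]; linarith
  · rintro z hz ⟨j, hj⟩
    refine hM2 _ ?_ hj
    rw [him, ← mul_div_assoc, le_div_iff₀ hNr]; linarith

theorem out_qtrick {h : ℂ ≃ₜ ℂ} (hI : IsoT h) {q : ℕ} (hq : 1 ≤ q) (hO : OutV (h^[q])) : OutV h := by
  obtain ⟨V, hVc, hVT, hVG, ε, hε, M, hM1, hM2⟩ := hO
  have hεε : ε * ε = 1 := by rcases hε with rfl | rfl <;> norm_num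
  have hE := hI.ends
  choose Hn hHn using iter_homeo h
  have hcomm : ∀ (i : ℕ) z, h^[i] (z + 1) = h^[i] z + 1 := fun i => (hI.iterate i).comm
  set O : Set ℂ := (h^[q]) ⁻¹' interior V with hOdef
  have hOo : IsOpen O := isOpen_interior.preimage (h.continuous.iterate q)
  have hVO : V ⊆ O := fun z hz => hVG z hz
  have hiT : ∀ z, z ∈ interior V ↔ z + 1 ∈ interior V := fun z =>
    ⟨fun hz => by simpa using int_inv hVT 1 hz, fun hz => by simpa using int_inv hVT (-1) hz⟩
  have hOT : ∀ z, z ∈ Oᶜ ↔ z + 1 ∈ Oᶜ := fun z => by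
    simp only [hOdef, Set.mem_compl_iff, Set.mem_preimage, hcomm]; rw [hiT]
  choose Mi hMi using fun i : ℕ => (hE.iterate i).eps hε M
  set MM := |M| + ∑ i ∈ Finset.range (q + 1), |Mi i| + 1 with hMM
  have hMle : ∀ i ≤ q, Mi i < MM := by
    intro i hi
    have := Finset.single_le_sum (f := fun i => |Mi i|) (fun i _ => abs_nonneg (Mi i))
      (Finset.mem_range.2 (Nat.lt_succ_of_le hi))
    linarith [le_abs_self (Mi i), abs_nonneg M]
  have hMM1 : M ≤ MM := by
    have : 0 ≤ ∑ i ∈ Finset.range (q + 1), |Mi i| := Finset.sum_nonneg fun i _ => abs_nonneg (Mi i)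
    linarith [le_abs_self M]
  have hfar : ∀ i ≤ q, ∀ w : ℂ, MM ≤ ε * w.im → h^[i] w ∉ V := fun i hi w hw =>
    hM2 _ (hMi i w ((hMle i hi).trans_le hw)).le
  have pt : ∀ c : ℝ, ε * ((⟨0, ε * c⟩ : ℂ)).im = c := fun c => by
    change ε * (ε * c) = c
    rw [← mul_assoc, hεε, one_mul]
  have hneV : V.Nonempty := ⟨⟨0, ε * (-M)⟩, hM1 _ (by rw [pt])⟩
  have hneO : Oᶜ.Nonempty := ⟨⟨0, ε * MM⟩, fun hm => hfar q le_rfl _ (by rw [pt]) (interior_subset hm)⟩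
  set a : ℂ → ℝ := fun z => Metric.infDist z V with ha
  set b : ℂ → ℝ := fun z => Metric.infDist z Oᶜ with hb
  have hac : Continuous a := Metric.continuous_infDist_pt V
  have hbc : Continuous b := Metric.continuous_infDist_pt Oᶜ
  have a0 : ∀ z, 0 ≤ a z := fun z => Metric.infDist_nonneg
  have b0 : ∀ z, 0 ≤ b z := fun z => Metric.infDist_nonneg
  have haV : ∀ z, a z = 0 → z ∈ V := fun z hz => (hVc.mem_iff_infDist_zero hneV).2 hz
  have hbO : ∀ z, b z = 0 → z ∉ O := fun z hz => (hOo.isClosed_compl.mem_iff_infDist_zero hneO).2 hz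
  have hab : ∀ z, 0 < a z + b z := by
    intro z
    rcases (a0 z).lt_or_eq with h1 | h1
    · linarith [b0 z]
    · rcases (b0 z).lt_or_eq with h2 | h2
      · linarith
      · exact absurd (hVO (haV z h1.symm)) (hbO z h2.symm)
  set Vi : ℕ → Set ℂ := fun i => {z | q * a z ≤ i * (a z + b z)} with hVi
  set Oi : ℕ → Set ℂ := fun i => {z | q * a z < i * (a z + b z)} with hOi
  have hVic : ∀ i, IsClosed (Vi i) := fun i => isClosed_le (by fun_prop) (by fun_prop)
  have hOio : ∀ i, IsOpen (Oi i) := fun i => isOpen_lt (by fun_prop) (by fun_prop)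
  have hVOi : ∀ i, Vi i ⊆ Oi (i + 1) := fun i z hz => by
    have hz : q * a z ≤ i * (a z + b z) := hz
    change q * a z < (i + 1 : ℕ) * (a z + b z)
    push_cast; linarith [hab z]
  have hOVi : ∀ i, Oi i ⊆ Vi i := fun i z hz => (show q * a z < i * (a z + b z) from hz).le
  have hqr : (1 : ℝ) ≤ q := by exact_mod_cast hq
  have hViO : ∀ i < q, Vi i ⊆ O := by
    intro i hi z hz
    have hz : q * a z ≤ i * (a z + b z) := hz
    by_contra hcon
    have hb0 : b z = 0 := Metric.infDist_zero_of_mem (s := Oᶜ) hcon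
    have hir : (i : ℝ) + 1 ≤ q := by exact_mod_cast hi
    have : a z = 0 := by
      rw [hb0, add_zero] at hz
      nlinarith [a0 z]
    exact hcon (hVO (haV z this))
  have hV0 : V ⊆ Vi 0 := by
    intro z hz
    change q * a z ≤ (0 : ℕ) * (a z + b z)
    have : a z = 0 := Metric.infDist_zero_of_mem hz
    rw [this]; simp
  have hViT : ∀ i z, z ∈ Vi i ↔ z + 1 ∈ Vi i := by
    intro i z
    change q * a z ≤ i * (a z + b z) ↔ q * a (z + 1) ≤ i * (a (z + 1) + b (z + 1))
    simp only [ha, hb, infDist_inv hVT, infDist_inv hOT]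
  set VV : Set ℂ := ⋃ i ∈ Finset.range q, (Hn i) '' (Vi i) with hVV
  have hmem : ∀ z, z ∈ VV ↔ ∃ i < q, ∃ w ∈ Vi i, h^[i] w = z := by
    intro z
    simp only [hVV, Set.mem_iUnion, Finset.mem_range, Set.mem_image, exists_prop, hHn]
  refine ⟨VV, isClosed_biUnion_finset fun i _ => (Hn i).isClosedMap _ (hVic i), ?_, ?_, ε, hε, MM, ?_, ?_⟩
  · intro z
    rw [hmem, hmem]
    constructor
    · rintro ⟨i, hi, w, hw, rfl⟩
      exact ⟨i, hi, w + 1, (hViT i w).1 hw, hcomm i w⟩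
    · rintro ⟨i, hi, w, hw, hwz⟩
      refine ⟨i, hi, w - 1, (hViT i _).2 (by simpa using hw), ?_⟩
      have := hcomm i (w - 1)
      rw [sub_add_cancel, hwz] at this
      exact (add_right_cancel this).symm
  · intro z hz
    obtain ⟨i, hi, w, hw, rfl⟩ := (hmem z).1 hz
    rw [← Function.iterate_succ_apply' h i w]
    by_cases hi1 : i + 1 < q
    · refine mem_interior.2 ⟨(Hn (i + 1)) '' (Oi (i + 1)), ?_, (Hn (i + 1)).isOpenMap _ (hOio _), w, hVOi i hw, hHn _ _⟩
      rintro _ ⟨x, hx, rfl⟩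
      exact (hmem _).2 ⟨i + 1, hi1, x, hOVi _ hx, (hHn _ _).symm⟩
    · have : i + 1 = q := by omega
      rw [Nat.succ_eq_add_one, this]
      have h3 : h^[q] w ∈ interior V := hViO i hi hw
      refine interior_mono ?_ h3
      intro x hx
      exact (hmem x).2 ⟨0, by omega, x, hV0 hx, rfl⟩
  · intro z hz
    exact (hmem z).2 ⟨0, by omega, z, hV0 (hM1 z (by linarith)), rfl⟩
  · intro z hz hzV
    obtain ⟨i, hi, w, hw, rfl⟩ := (hmem z).1 hzV
    refine hfar (q - i) (by omega) _ hz ?_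
    rw [← Function.iterate_add_apply, Nat.sub_add_cancel hi.le]
    exact interior_subset (hViO i hi hw)

theorem out_curve {h : ℂ ≃ₜ ℂ} (hI : IsoT h) (hO : OutV h) :
    ∃ g : ℝ → ℂ, ∃ k : ℤ, Continuous g ∧ k ≠ 0 ∧ (∀ t, g (t + 1) = g t + k) ∧
      (∀ s t : ℝ, ∀ c : ℤ, g s = g t + c → ∃ j : ℤ, s = t + j) ∧
      ∀ s t : ℝ, ∀ c : ℤ, g s ≠ h (g t) + c := by
  obtain ⟨V, hVc, hVT, hVG, ε, hε, M, hM1, hM2⟩ := hO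
  have hE' := EndsOK.symm hI.comm hI.ends
  have hiT : ∀ z, z ∈ (interior V)ᶜ ↔ z + 1 ∈ (interior V)ᶜ := fun z => not_congr
    ⟨fun hz => by simpa using int_inv hVT 1 hz, fun hz => by simpa using int_inv hVT (-1) hz⟩
  have hhT : ∀ z, z ∈ h '' V ↔ z + 1 ∈ h '' V := by
    intro z
    constructor
    · rintro ⟨w, hw, rfl⟩; exact ⟨w + 1, (hVT w).1 hw, hI.comm w⟩
    · rintro ⟨w, hw, hwz⟩
      refine ⟨w - 1, (hVT _).2 (by simpa using hw), ?_⟩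
      have := hI.comm (w - 1)
      rw [sub_add_cancel, hwz] at this
      exact (add_right_cancel this).symm
  have hhc : IsClosed (h '' V) := h.isClosedMap _ hVc
  have hic : IsClosed (interior V)ᶜ := isOpen_interior.isClosed_compl
  have hdis : ∀ z, z ∈ h '' V → z ∉ (interior V)ᶜ := by
    rintro _ ⟨w, hw, rfl⟩ hn
    exact hn (hVG w hw)
  have fin : (∃ g : ℝ → ℂ, ∃ k : ℤ, Continuous g ∧ k ≠ 0 ∧ (∀ t, g (t + 1) = g t + k) ∧
      (∀ t, g t ∉ h '' V ∧ g t ∉ (interior V)ᶜ) ∧ ∀ s t : ℝ, ∀ c : ℤ, g s = g t + c → ∃ j : ℤ, s = t + j) →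
      ∃ g : ℝ → ℂ, ∃ k : ℤ, Continuous g ∧ k ≠ 0 ∧ (∀ t, g (t + 1) = g t + k) ∧
      (∀ s t : ℝ, ∀ c : ℤ, g s = g t + c → ∃ j : ℤ, s = t + j) ∧
      ∀ s t : ℝ, ∀ c : ℤ, g s ≠ h (g t) + c := by
    rintro ⟨g, k, h1, h2, h3, h4, h5⟩
    refine ⟨g, k, h1, h2, h3, h5, fun s t c hst => (h4 s).1 ?_⟩
    rw [hst, inv_int hhT]
    exact ⟨g t, interior_subset (not_not.1 (h4 t).2), rfl⟩
  apply fin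
  rcases hε with rfl | rfl
  · obtain ⟨M', hM'⟩ := hE'.2 (-M)
    refine sep_curve hhc hic hhT hiT hdis (M0 := max (|M'| + 1) M) ?_ ?_
    · intro z hz
      refine ⟨h.symm z, hM1 _ ?_, by simp⟩
      have := hM' z (by linarith [le_max_left (|M'| + 1) M, neg_abs_le M'])
      linarith
    · intro z hz hzi
      exact hM2 z (by linarith [le_max_right (|M'| + 1) M]) (interior_subset hzi)
  · obtain ⟨M', hM'⟩ := hE'.1 M
    obtain ⟨g, k, h1, h2, h3, h4, h5⟩ := sep_curve hic hhc hiT hhT (fun z h1 h2 => hdis z h2 h1)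
      (M0 := max (|M'| + 1) M) (by
      intro z hz hzi
      exact hM2 z (by linarith [le_max_right (|M'| + 1) M]) (interior_subset hzi)) (by
      intro z hz
      refine ⟨h.symm z, hM1 _ ?_, by simp⟩
      have := hM' z (by linarith [le_max_left (|M'| + 1) M, le_abs_self M'])
      linarith)
    exact ⟨g, k, h1, h2, h3, fun t => (h4 t).symm, h5⟩

end FLC

namespace FLC

def Rec (h : ℂ → ℂ) (z : ℂ) : Prop := ∀ U ∈ 𝓝 z, ∀ N : ℕ, ∃ n ≥ N, ∃ s : ℤ, h^[n] z - s ∈ U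

def Rot (h : ℂ → ℂ) (z : ℂ) (ρ : ℝ) : Prop :=
  ∀ n : ℕ → ℕ, StrictMono n → (∀ j, 0 < n j) → ∀ s : ℕ → ℤ,
    Tendsto (fun j => h^[n j] z - s j) atTop (𝓝 z) →
    Tendsto (fun j => ((h^[n j] z).re - z.re) / (n j : ℝ)) atTop (𝓝 ρ)

theorem ret_mod {h : ℂ → ℂ} (hh : Continuous h) (hc : ∀ z, h (z + 1) = h z + 1) {z : ℂ} (hr : Rec h z)
    {K : ℕ} (hK : 0 < K) : ∀ U ∈ 𝓝 z, ∀ N : ℕ, ∃ n ≥ N, ∃ s : ℤ, K ∣ n ∧ (K : ℤ) ∣ s ∧ h^[n] z - s ∈ U := by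
  haveI : NeZero K := ⟨hK.ne'⟩
  set E : Set (ZMod K × ZMod K) := {g | ∀ U ∈ 𝓝 z, ∀ N : ℕ, ∃ n ≥ N, ∃ s : ℤ,
    (((n : ZMod K), (s : ZMod K)) : ZMod K × ZMod K) = g ∧ h^[n] z - s ∈ U} with hE
  have hci : ∀ (i : ℕ) w, h^[i] (w + 1) = h^[i] w + 1 := by
    intro i
    induction i with
    | zero => intro w; rfl
    | succ i ih => intro w; rw [Function.iterate_succ_apply, hc, ih, Function.iterate_succ_apply]
  have hne : ∃ g, g ∈ E := by
    by_contra hcon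
    push Not at hcon
    have : ∀ g : ZMod K × ZMod K, ∃ U ∈ 𝓝 z, ∃ N : ℕ, ∀ n ≥ N, ∀ s : ℤ,
        (((n : ZMod K), (s : ZMod K)) : ZMod K × ZMod K) = g → h^[n] z - s ∉ U := by
      intro g
      have := hcon g
      simp only [hE, Set.mem_ofPred_eq] at this
      push Not at this
      exact this
    choose U hU N hN using this
    obtain ⟨n, hn, s, hs⟩ := hr (⋂ g, U g) (Filter.iInter_mem.2 hU) (∑ g, N g)
    refine hN ((n : ZMod K), (s : ZMod K)) n ?_ s rfl (Set.mem_iInter.1 hs _)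
    exact (Finset.single_le_sum (f := N) (fun _ _ => Nat.zero_le _) (Finset.mem_univ _)).trans hn
  have hadd : ∀ a ∈ E, ∀ b ∈ E, a + b ∈ E := by
    intro a ha b hb U hU N
    obtain ⟨V, hVU, hVo, hzV⟩ := mem_nhds_iff.1 hU
    obtain ⟨n, hn, s, hns, hs⟩ := ha V (hVo.mem_nhds hzV) N
    have hcont : Continuous fun w => h^[n] w - s := by
      have := hh.iterate n
      fun_prop
    obtain ⟨n', hn', s', hns', hs'⟩ := hb _ ((hVo.preimage hcont).mem_nhds hs) 0
    refine ⟨n + n', by omega, s + s', ?_, hVU ?_⟩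
    · rw [← hns, ← hns']; simp
    · have h1 : h^[n] (h^[n'] z - s') - s ∈ V := hs'
      have h2 := comm_int (hci n) (-s') (h^[n'] z)
      push_cast at h2 ⊢
      rw [← sub_eq_add_neg] at h2
      rw [h2, ← Function.iterate_add_apply] at h1
      convert h1 using 1; ring
  obtain ⟨g, hg⟩ := hne
  have hmul : ∀ m : ℕ, (m + 1) • g ∈ E := by
    intro m
    induction m with
    | zero => simpa using hg
    | succ m ih => rw [succ_nsmul]; exact hadd _ ih _ hg
  have h0 : (0 : ZMod K × ZMod K) ∈ E := by
    have := hmul (K - 1)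
    rw [Nat.sub_add_cancel hK] at this
    have e : K • g = 0 := by ext <;> simp
    rwa [e] at this
  intro U hU N
  obtain ⟨n, hn, s, hns, hs⟩ := h0 U hU N
  refine ⟨n, hn, s, ?_, ?_, hs⟩
  · exact (ZMod.natCast_eq_zero_iff n K).1 (congrArg Prod.fst hns)
  · exact (ZMod.intCast_zmod_eq_zero_iff_dvd s K).1 (congrArg Prod.snd hns)

theorem ret_sign {h : ℂ → ℂ} (hh : Continuous h) (hc : ∀ z, h (z + 1) = h z + 1) {z : ℂ} (hr : Rec h z)
    {ρ : ℝ} (hρ : Rot h z ρ) {p : ℤ} {q : ℕ} (hq : 1 ≤ q) {σ : ℤ} (hσ : σ = 1 ∨ σ = -1)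
    (hlt : (σ : ℝ) * ((p : ℝ) / q) < σ * ρ) {N : ℕ} (hN : 0 < N) (U : Set ℂ) (hU : U ∈ 𝓝 z) :
    ∃ L : ℕ, ∃ m : ℤ, 0 < σ * m ∧ h^[q * (L + 1)] z - p * (L + 1 : ℕ) - N * m ∈ U := by
  by_contra hcon
  push Not at hcon
  have hqr : (0 : ℝ) < q := by exact_mod_cast hq
  have hNr : (0 : ℝ) < N := by exact_mod_cast hN
  have key : ∀ j : ℕ, ∃ᶠ n in atTop, 0 < n ∧ ∃ s : ℤ, h^[n] z - s ∈ Metric.ball z (1 / (j + 1)) ∧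
      (σ : ℝ) * s ≤ σ * (p / q) * n := by
    intro j
    rw [Filter.frequently_atTop]
    intro N0
    have hb : Metric.ball z (1 / ((j : ℝ) + 1)) ∈ 𝓝 z := Metric.ball_mem_nhds _ (by positivity)
    obtain ⟨n, hn, s, ⟨r, hr⟩, ⟨s', hs'⟩, hs⟩ := ret_mod hh hc hr (K := q * N) (by positivity) _
      (Filter.inter_mem hU hb) (N0 + 1)
    have hrpos : 0 < r := by
      rcases Nat.eq_zero_or_pos r with rfl | h
      · omega
      · exact h
    refine ⟨n, by omega, by omega, s, hs.2, ?_⟩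
    have hNrpos : 0 < N * r := by positivity
    have hnot : ¬ (0 < σ * (q * s' - p * r)) := by
      intro hpos
      refine hcon (N * r - 1) (q * s' - p * r) hpos ?_
      rw [Nat.sub_add_cancel hNrpos]
      convert hs.1 using 1
      rw [hs', show q * (N * r) = n by rw [hr]; ring]
      push_cast; ring
    have hle : σ * (q * s' - p * r) ≤ 0 := not_lt.1 hnot
    have hle' : (σ : ℝ) * (q * s' - p * r) ≤ 0 := by exact_mod_cast hle
    rw [hs', hr]; push_cast
    have : (σ : ℝ) * (p / q) * (q * N * r) = σ * p * N * r := by field_simp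
    rw [this]
    nlinarith
  obtain ⟨n, hmono, hn⟩ := Filter.extraction_forall_of_frequently key
  choose hpos s hs hle using hn
  have hlim : Tendsto (fun j => h^[n j] z - s j) atTop (𝓝 z) := by
    rw [tendsto_iff_dist_tendsto_zero]
    refine squeeze_zero (fun _ => dist_nonneg) (fun j => (Metric.mem_ball.1 (hs j)).le)
      tendsto_one_div_add_atTop_nhds_zero_nat
  have h1 := hρ n hmono hpos s hlim
  have h2 : Tendsto (fun j => (σ : ℝ) * (p / q) + 1 / (n j : ℝ)) atTop (𝓝 ((σ : ℝ) * (p / q) + 0)) :=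
    tendsto_const_nhds.add (tendsto_one_div_atTop_nhds_zero_nat.comp hmono.tendsto_atTop)
  have h3 := le_of_tendsto_of_tendsto' (h1.const_mul (σ : ℝ)) h2 (fun j => by
    have hnj : (0 : ℝ) < n j := by exact_mod_cast hpos j
    have d1 := Metric.mem_ball.1 (hs j)
    rw [dist_eq_norm] at d1
    have d2 := Complex.abs_re_le_norm (h^[n j] z - s j - z)
    have d3 : (1 : ℝ) / ((j : ℝ) + 1) ≤ 1 := by
      rw [div_le_one (by positivity)]; linarith [Nat.cast_nonneg (α := ℝ) j]
    have d4 : |(h^[n j] z).re - s j - z.re| ≤ 1 := by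
      simp only [Complex.sub_re, Complex.intCast_re] at d2
      linarith
    have d5 : (σ : ℝ) * ((h^[n j] z).re - s j - z.re) ≤ 1 := by
      obtain ⟨d6, d7⟩ := abs_le.1 d4
      rcases hσ with rfl | rfl
      · simpa using d7
      · push_cast; linarith
    rw [← mul_div_assoc, div_le_iff₀ hnj, add_mul, one_div, inv_mul_cancel₀ hnj.ne']
    linarith [hle j])
  linarith

theorem main_plane {h : ℂ ≃ₜ ℂ} (hI : IsoT h) {p : ℤ} {q : ℕ} (hq : 1 ≤ q) (hno : ∀ z, h^[q] z ≠ z + p)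
    {z1 z2 : ℂ} (hne : z1.im ≠ z2.im) (rec1 : Rec h z1) (rec2 : Rec h z2) {ρ1 ρ2 : ℝ} (rot1 : Rot h z1 ρ1)
    (rot2 : Rot h z2 ρ2) (h1 : ρ1 < (p : ℝ) / q) (h2 : (p : ℝ) / q < ρ2) :
    ∃ g : ℝ → ℂ, ∃ k : ℤ, Continuous g ∧ k ≠ 0 ∧ (∀ t, g (t + 1) = g t + k) ∧
      (∀ s t : ℝ, ∀ c : ℤ, g s = g t + c → ∃ j : ℤ, s = t + j) ∧
      ∀ s t : ℝ, ∀ c : ℤ, g s ≠ h (g t) + c := by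
  obtain ⟨H, hH⟩ := iter_homeo h q
  set G : ℂ ≃ₜ ℂ := H.trans (Homeomorph.addRight (-(p : ℂ))) with hG
  have eG : ∀ z, G z = h^[q] z + (-(p : ℂ)) := fun z => by simp [hG, hH]
  have hGI : IsoT G := by
    have := IsoT.comp (IsoT.translate (-(p : ℂ))) (hI.iterate q)
    convert this using 1
    exact funext eG
  have hcq : ∀ z, h^[q] (z + 1) = h^[q] z + 1 := (hI.iterate q).comm
  have eGk : ∀ (k : ℕ) z, G^[k] z = h^[q * k] z - p * k := by
    intro k
    induction k with
    | zero => intro z; simp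
    | succ k ih =>
      intro z
      rw [Function.iterate_succ_apply', ih, eG]
      have := comm_int hcq (-(p * k)) (h^[q * k] z)
      push_cast at this
      rw [← sub_eq_add_neg] at this
      rw [this, ← Function.iterate_add_apply, show q + q * k = q * (k + 1) by ring]
      push_cast; ring
  have hO : OutV G := by
    refine out_rescale hGI (fun z hz => hno z ?_) hne ?_ ?_
    · rw [eG] at hz; linear_combination hz
    · intro N hN U hU
      obtain ⟨L, m, hm, hmU⟩ := ret_sign (p := p) h.continuous hI.comm rec1 rot1 hq (σ := -1) (Or.inr rfl)
        (by push_cast; linarith) hN U hU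
      exact ⟨L, m, by linarith, by rw [eGk]; exact hmU⟩
    · intro N hN U hU
      obtain ⟨L, m, hm, hmU⟩ := ret_sign (p := p) h.continuous hI.comm rec2 rot2 hq (σ := 1) (Or.inl rfl)
        (by push_cast; linarith) hN U hU
      exact ⟨L, m, by linarith, by rw [eGk]; exact hmU⟩
  have hOq : OutV (h^[q]) := by
    obtain ⟨V, hVc, hVT, hVG, hrest⟩ := hO
    refine ⟨V, hVc, hVT, fun z hz => ?_, hrest⟩
    have := int_inv hVT p (hVG z hz)
    rwa [eG, neg_add_cancel_right] at this
  exact out_curve hI (out_qtrick hI hq hOq)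

end FLC

namespace FLC

noncomputable def logitH : ↥(Set.Ioo (0 : ℝ) 1) ≃ₜ ℝ where
  toFun y := Real.log (y : ℝ) - Real.log (1 - (y : ℝ))
  invFun x := ⟨Real.sigmoid x, Real.sigmoid_pos x, Real.sigmoid_lt_one x⟩
  left_inv y := by
    have h0 : (0 : ℝ) < y := y.2.1
    have h1 : (0 : ℝ) < 1 - y := by linarith [y.2.2]
    apply Subtype.ext
    show Real.sigmoid _ = (y : ℝ)
    rw [Real.sigmoid_def, neg_sub, Real.exp_sub, Real.exp_log h0, Real.exp_log h1]
    field_simp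
    ring
  right_inv x := by
    show Real.log (Real.sigmoid x) - Real.log (1 - Real.sigmoid x) = x
    rw [← Real.sigmoid_neg, ← Real.sigmoid_mul_rexp_neg, Real.log_mul (Real.sigmoid_pos x).ne'
      (Real.exp_pos _).ne', Real.log_exp]
    ring
  continuous_toFun := by
    refine Continuous.sub ?_ ?_
    · exact Continuous.log (by fun_prop) fun y => ne_of_gt y.2.1
    · exact Continuous.log (by fun_prop) fun y => by have := y.2.2; intro h; linarith
  continuous_invFun := by
    exact (_root_.continuous_sigmoid).subtype_mk _

noncomputable def chartH (C a : ℝ) : StripO ≃ₜ ℂ where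
  toFun w := ⟨w.1, logitH w.2 + C * Real.cos (2 * Real.pi * (w.1 - a))⟩
  invFun z := (z.re, logitH.symm (z.im - C * Real.cos (2 * Real.pi * (z.re - a))))
  left_inv w := by simp
  right_inv z := by simp
  continuous_toFun := by
    have : Continuous fun w : StripO => (w.1 : ℂ) +
      ((logitH w.2 + C * Real.cos (2 * Real.pi * (w.1 - a)) : ℝ) : ℂ) * Complex.I := by fun_prop
    convert this using 2 with w
    apply Complex.ext
    · rw [Complex.add_re, Complex.re_ofReal_mul]; simp
    · rw [Complex.add_im, Complex.im_ofReal_mul]; simp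
  continuous_invFun := by fun_prop

theorem coe_int (x : ℝ) (n : ℤ) : ((x + n : ℝ) : Circle1) = x := by
  have : ((n : ℝ) : Circle1) = 0 := (AddCircle.coe_eq_zero_iff (1 : ℝ)).2 ⟨n, by simp⟩
  rw [AddCircle.coe_add, this, add_zero]

theorem coe_eq {x y : ℝ} (h : (x : Circle1) = y) : ∃ n : ℤ, x = y + n := by
  have : ((x - y : ℝ) : Circle1) = 0 := by rw [AddCircle.coe_sub, h, sub_self]
  obtain ⟨n, hn⟩ := (AddCircle.coe_eq_zero_iff (1 : ℝ)).1 this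
  simp at hn
  exact ⟨n, by linarith⟩

theorem proj_eq {w w' : StripO} (h : projO w = projO w') : ∃ n : ℤ, w = (w'.1 + n, w'.2) := by
  have h1 : (w.1 : Circle1) = w'.1 := congrArg (fun a : AnnO => a.1) h
  have h2 : w.2 = w'.2 := congrArg (fun a : AnnO => a.2) h
  obtain ⟨n, hn⟩ := coe_eq h1
  exact ⟨n, Prod.ext hn h2⟩

theorem proj_add (w : StripO) (n : ℤ) : projO (w.1 + n, w.2) = projO w := by
  show (((w.1 + n : ℝ) : Circle1), w.2) = _
  rw [coe_int]; rfl

theorem exists_chart (z1 z2 : StripO) (h : projO z1 ≠ projO z2) : ∃ Φ : StripO ≃ₜ ℂ,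
    (∀ w, (Φ w).re = w.1) ∧ (∀ w, Φ (w.1 + 1, w.2) = Φ w + 1) ∧ (Φ z1).im ≠ (Φ z2).im := by
  have key : ∀ C : ℝ, (∀ w, (chartH C z1.1 w).re = w.1) ∧
      (∀ w, chartH C z1.1 (w.1 + 1, w.2) = chartH C z1.1 w + 1) := by
    intro C
    refine ⟨fun w => rfl, fun w => ?_⟩
    apply Complex.ext
    · simp [chartH]
    · simp only [chartH, Homeomorph.homeomorph_mk_coe, Equiv.coe_fn_mk, Complex.add_im, Complex.one_im, add_zero]
      rw [show 2 * Real.pi * (w.1 + 1 - z1.1) = 2 * Real.pi * (w.1 - z1.1) + 2 * Real.pi by ring,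
        Real.cos_add_two_pi]
  by_cases h2 : z1.2 = z2.2
  · refine ⟨chartH 1 z1.1, (key 1).1, (key 1).2, fun e => h ?_⟩
    have e' : logitH z1.2 + 1 * Real.cos (2 * Real.pi * (z1.1 - z1.1)) =
      logitH z2.2 + 1 * Real.cos (2 * Real.pi * (z2.1 - z1.1)) := e
    rw [h2] at e'
    have e2 : Real.cos (2 * Real.pi * (z2.1 - z1.1)) = 1 := by
      have := add_left_cancel e'
      simpa using this.symm
    obtain ⟨n, hn⟩ := (Real.cos_eq_one_iff _).1 e2
    have : z2 = (z1.1 + n, z1.2) := by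
      refine Prod.ext ?_ h2.symm
      have hp := Real.pi_pos
      have : 2 * Real.pi * (z2.1 - z1.1 - n) = 0 := by linarith
      have := (mul_eq_zero.1 this).resolve_left (by positivity)
      show z2.1 = z1.1 + n
      linarith
    rw [this, proj_add]
  · refine ⟨chartH 0 z1.1, (key 0).1, (key 0).2, fun e => h2 ?_⟩
    have e' : logitH z1.2 + 0 * Real.cos (2 * Real.pi * (z1.1 - z1.1)) =
      logitH z2.2 + 0 * Real.cos (2 * Real.pi * (z2.1 - z1.1)) := e
    simpa using e'

theorem lift_circle {A : Type*} [TopologicalSpace A] (K : C(unitInterval × A, Circle1)) (k : C(A, ℝ))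
    (h : ∀ a, K (0, a) = (k a : Circle1)) :
    ∃ L : C(unitInterval × A, ℝ), (∀ p, ((L p : ℝ) : Circle1) = K p) ∧ ∀ a, L (0, a) = k a := by
  refine ⟨(AddCircle.isCoveringMap_coe (1 : ℝ)).liftHomotopy K k h, fun p => ?_, fun a => ?_⟩
  · exact congrFun ((AddCircle.isCoveringMap_coe (1 : ℝ)).liftHomotopy_lifts K k h) p
  · exact (AddCircle.isCoveringMap_coe (1 : ℝ)).liftHomotopy_zero K k h a

/-- a continuous real function, integer valued, on a connected space is constant -/
theorem int_const {X : Type*} [TopologicalSpace X] [PreconnectedSpace X] {d : X → ℝ} (hd : Continuous d)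
    (hi : ∀ x, ∃ n : ℤ, d x = n) (x y : X) : d x = d y := by
  choose n hn using hi
  have : Continuous fun x => n x := by
    have e := Int.isClosedEmbedding_coe_real.isInducing.continuous_iff (f := n)
    rw [e]
    convert hd using 1
    funext x; exact (hn x).symm
  rw [hn x, hn y, PreconnectedSpace.constant inferInstance this]

end FLC

namespace FLC

theorem continuous_projO : Continuous projO := by
  unfold projO
  exact Continuous.prodMk ((AddCircle.continuous_mk' (1 : ℝ)).comp continuous_fst) continuous_snd

theorem strip_int {Y : Type*} {φ : StripO → Y} {T : ℤ → Y → Y} (h0 : ∀ y, T 0 y = y)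
    (ha : ∀ m n y, T m (T n y) = T (m + n) y)
    (h : ∀ w, φ (w.1 + 1, w.2) = T 1 (φ w)) (n : ℤ) (w : StripO) : φ (w.1 + n, w.2) = T n (φ w) := by
  induction n using Int.induction_on with
  | zero => simp [h0]
  | succ n ih =>
    have := h (w.1 + ((n : ℤ) : ℝ), w.2)
    simp only at this
    rw [ih, ha] at this
    rw [add_comm ((n : ℤ)) 1, ← this]
    congr 2
    push_cast; ring
  | pred n ih =>
    have := h (w.1 + ((-(n : ℤ) - 1 : ℤ) : ℝ), w.2)
    simp only at this
    have e : w.1 + ((-(n : ℤ) - 1 : ℤ) : ℝ) + 1 = w.1 + ((-(n : ℤ) : ℤ) : ℝ) := by push_cast; ring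
    rw [e, ih] at this
    have h2 := congrArg (T (-1)) this
    rw [ha, ha] at h2
    simp only [neg_add_cancel, h0] at h2
    rw [← h2]
    congr 1; ring

theorem chart_int {Φ : StripO ≃ₜ ℂ} (h1 : ∀ w, Φ (w.1 + 1, w.2) = Φ w + 1) (n : ℤ) (w : StripO) :
    Φ (w.1 + n, w.2) = Φ w + n :=
  strip_int (T := fun n z => z + (n : ℂ)) (by simp) (by intros; push_cast; ring) (by simpa using h1) n w

theorem chart_symm_int {Φ : StripO ≃ₜ ℂ} (h1 : ∀ w, Φ (w.1 + 1, w.2) = Φ w + 1) (n : ℤ) (z : ℂ) :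
    Φ.symm (z + n) = ((Φ.symm z).1 + n, (Φ.symm z).2) := by
  rw [Homeomorph.symm_apply_eq, chart_int h1, Homeomorph.apply_symm_apply]

theorem deck_int {F : StripO ≃ₜ StripO} (hcomm : ∀ p, F (deckO p) = deckO (F p)) (n : ℤ) (w : StripO) :
    F (w.1 + n, w.2) = ((F w).1 + n, (F w).2) :=
  strip_int (φ := F) (T := fun n w => (w.1 + n, w.2)) (by simp)
    (by intros; refine Prod.ext ?_ rfl; push_cast; ring) (by
      intro w
      have := hcomm w
      simpa [deckO] using this) n w

theorem isoT_of {f : AnnO ≃ₜ AnnO} (hiso : IsotopicToIdO f) {F : StripO ≃ₜ StripO}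
    (hlift : ∀ p, projO (F p) = f (projO p)) {Φ : StripO ≃ₜ ℂ} (hre : ∀ w, (Φ w).re = w.1)
    (h1 : ∀ w, Φ (w.1 + 1, w.2) = Φ w + 1) :
    IsoT (fun z => Φ (F (Φ.symm z))) := by
  obtain ⟨H, Hc, H0, H1, Hi⟩ := hiso
  have hsre : ∀ z, (Φ.symm z).1 = z.re := fun z => by rw [← hre, Homeomorph.apply_symm_apply]
  let P : unitInterval × ℂ → AnnO := fun p => H (p.1, projO (Φ.symm p.2))
  have Pc : Continuous P := by
    have := continuous_projO
    exact Hc.comp (by fun_prop)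
  have P1 : ∀ t z, P (t, z + 1) = P (t, z) := by
    intro t z
    have := chart_symm_int h1 1 z
    simp only [Int.cast_one] at this
    show H (t, projO (Φ.symm (z + 1))) = H (t, projO (Φ.symm z))
    rw [this]
    have := proj_add (Φ.symm z) 1
    simp only [Int.cast_one] at this
    rw [this]
  obtain ⟨L, hL, hL0⟩ := lift_circle (⟨fun p => (P p).1, by fun_prop⟩ : C(unitInterval × ℂ, Circle1))
    ⟨fun z => z.re, Complex.continuous_re⟩ (by
      intro z
      show (H (⟨0, _⟩, projO (Φ.symm z))).1 = _
      rw [H0]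
      show (((Φ.symm z).1 : ℝ) : Circle1) = _
      rw [hsre]; rfl)
  let W : unitInterval × ℂ → StripO := fun p => (L p, (P p).2)
  have Wc : Continuous W := by fun_prop
  have hW : ∀ p, projO (W p) = P p := fun p => Prod.ext (hL p) rfl
  have W1 : ∀ t z, W (t, z + 1) = ((W (t, z)).1 + 1, (W (t, z)).2) := by
    intro t z
    have hd := int_const (X := unitInterval × ℂ) (d := fun p => L (p.1, p.2 + 1) - L p) (by fun_prop)
      (by
        intro p
        obtain ⟨n, hn⟩ := coe_eq (x := L (p.1, p.2 + 1)) (y := L p) (by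
          rw [hL, hL]
          show (P (p.1, p.2 + 1)).1 = (P (p.1, p.2)).1
          rw [P1])
        exact ⟨n, by rw [hn]; ring⟩) (t, z) (0, z)
    simp only [hL0] at hd
    refine Prod.ext ?_ ?_
    · show L (t, z + 1) = L (t, z) + 1
      simp at hd
      linarith
    · show (P (t, z + 1)).2 = (P (t, z)).2
      rw [P1]
  have G1 : ∀ t z, Φ (W (t, z + 1)) = Φ (W (t, z)) + 1 := fun t z => by rw [W1, h1]
  obtain ⟨k, hk⟩ : ∃ k : ℤ, ∀ z, Φ (W (1, z)) = Φ (F (Φ.symm z)) + k := by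
    have hp : ∀ z, projO (W (1, z)) = projO (F (Φ.symm z)) := fun z => by
      rw [hW, hlift]; exact H1 _
    have hq : ∀ z, ∃ n : ℤ, W (1, z) = ((F (Φ.symm z)).1 + n, (F (Φ.symm z)).2) := fun z => proj_eq (hp z)
    obtain ⟨k, hk⟩ := hq 0
    refine ⟨k, fun z => ?_⟩
    have hd := int_const (d := fun z => (W (1, z)).1 - (F (Φ.symm z)).1) (by fun_prop) (by
      intro z
      obtain ⟨n, hn⟩ := hq z
      exact ⟨n, by rw [hn]; simp⟩) z 0
    obtain ⟨n, hn⟩ := hq z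
    simp only [hk, hn] at hd
    have : (n : ℝ) = k := by linarith
    have : n = k := by exact_mod_cast this
    rw [hn, this, chart_int h1]
  have main : IsoT (fun z => Φ (W (1, z))) := by
    refine ⟨fun p => Φ (W (Set.projIcc 0 1 zero_le_one p.1, p.2)), ?_, ?_, ?_, ?_, ?_⟩
    · have : Continuous (Set.projIcc (0 : ℝ) 1 zero_le_one) := continuous_projIcc
      fun_prop
    · intro z
      show Φ (W (Set.projIcc 0 1 zero_le_one 0, z)) = z
      rw [Set.projIcc_left]
      have : W (0, z) = Φ.symm z := by
        refine Prod.ext ?_ ?_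
        · rw [hsre]; exact hL0 z
        · show (H (⟨0, _⟩, projO (Φ.symm z))).2 = _
          rw [H0]; rfl
      rw [show (⟨0, _⟩ : Set.Icc (0 : ℝ) 1) = (0 : unitInterval) from rfl, this, Homeomorph.apply_symm_apply]
    · intro z
      show Φ (W (Set.projIcc 0 1 zero_le_one 1, z)) = _
      rw [Set.projIcc_right]; rfl
    · intro t z z' e
      set s := Set.projIcc (0 : ℝ) 1 zero_le_one t with hs
      have e1 : Φ (W (s, z)) = Φ (W (s, z')) := e
      have e2 := congrArg projO (Φ.injective e1)
      rw [hW, hW] at e2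
      obtain ⟨g, hg⟩ := Hi s
      have e3 : H (s, projO (Φ.symm z)) = H (s, projO (Φ.symm z')) := e2
      rw [hg, hg] at e3
      obtain ⟨n, hn⟩ := proj_eq (g.injective e3)
      have e4 : z = z' + n := by
        have := congrArg Φ hn
        rwa [chart_int h1, Homeomorph.apply_symm_apply, Homeomorph.apply_symm_apply] at this
      have e5 := comm_int (f := fun z => Φ (W (s, z))) (G1 s) n z'
      rw [← e4, e1] at e5
      have : (n : ℂ) = 0 := by simpa using e5
      rw [e4, this, add_zero]
    · intro t z; exact G1 _ z
  have := IsoT.comp (IsoT.translate (-(k : ℂ))) main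
  simpa [hk] using this

theorem conj_iter (F : StripO ≃ₜ StripO) (Φ : StripO ≃ₜ ℂ) (n : ℕ) (w : StripO) :
    (Φ.symm.trans (F.trans Φ))^[n] (Φ w) = Φ (F^[n] w) := by
  induction n generalizing w with
  | zero => rfl
  | succ n ih =>
    rw [Function.iterate_succ_apply, Function.iterate_succ_apply, ← ih]
    congr 1; simp

theorem proj_iter {f : AnnO ≃ₜ AnnO} {F : StripO ≃ₜ StripO}
    (hlift : ∀ p, projO (F p) = f (projO p)) (n : ℕ) (w : StripO) :
    projO (F^[n] w) = f^[n] (projO w) := by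
  induction n generalizing w with
  | zero => rfl
  | succ n ih => rw [Function.iterate_succ_apply, Function.iterate_succ_apply, ih, hlift]

theorem projO_nhds {w : StripO} {U : Set StripO} (hU : U ∈ 𝓝 w) : projO '' U ∈ 𝓝 (projO w) := by
  have ho : IsOpenMap projO := by
    have h1 : IsOpenMap ((↑) : ℝ → Circle1) := QuotientAddGroup.isOpenMap_coe
    exact h1.prodMap IsOpenMap.id
  exact ho.image_mem_nhds hU

theorem rec_of {f : AnnO ≃ₜ AnnO} {F : StripO ≃ₜ StripO}
    (hlift : ∀ p, projO (F p) = f (projO p)) {Φ : StripO ≃ₜ ℂ}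
    (h1 : ∀ w, Φ (w.1 + 1, w.2) = Φ w + 1) {w : StripO} (hr : PosRecurrentO f (projO w)) :
    Rec (Φ.symm.trans (F.trans Φ)) (Φ w) := by
  intro U hU N
  obtain ⟨n, hn, hm⟩ := hr _ (projO_nhds (Φ.continuous.continuousAt.preimage_mem_nhds hU)) N
  obtain ⟨u, hu, he⟩ := hm
  rw [← proj_iter hlift] at he
  obtain ⟨s, hs⟩ := proj_eq he.symm
  refine ⟨n, hn, s, ?_⟩
  rw [conj_iter, hs, chart_int h1]
  simpa using hu

theorem rot_of {f : AnnO ≃ₜ AnnO} {F : StripO ≃ₜ StripO}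
    (hlift : ∀ p, projO (F p) = f (projO p)) {Φ : StripO ≃ₜ ℂ} (hre : ∀ w, (Φ w).re = w.1)
    (h1 : ∀ w, Φ (w.1 + 1, w.2) = Φ w + 1) {w : StripO} {ρ : ℝ} (hr : HasRotNumO f F (projO w) ρ) :
    Rot (Φ.symm.trans (F.trans Φ)) (Φ w) ρ := by
  intro n hn hp s ht
  have := hr w rfl n hn hp (by
    have h2 : Tendsto (fun j => projO (Φ.symm ((Φ.symm.trans (F.trans Φ))^[n j] (Φ w) - s j))) atTop
        (𝓝 (projO (Φ.symm (Φ w)))) :=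
      ((continuous_projO.comp Φ.symm.continuous).tendsto _).comp ht
    rw [Homeomorph.symm_apply_apply] at h2
    refine h2.congr fun j => ?_
    rw [conj_iter]
    have e : Φ (F^[n j] w) - (s j : ℂ) = Φ (F^[n j] w) + ((-(s j) : ℤ) : ℂ) := by push_cast; ring
    rw [e, chart_symm_int h1, proj_add, Homeomorph.symm_apply_apply, proj_iter hlift])
  refine this.congr fun j => ?_
  rw [conj_iter, hre, hre]

theorem rot_unique {f : AnnO ≃ₜ AnnO} {F : StripO ≃ₜ StripO} {z : AnnO} (hr : PosRecurrentO f z)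
    {ρ ρ' : ℝ} (h : HasRotNumO f F z ρ) (h' : HasRotNumO f F z ρ') : ρ = ρ' := by
  obtain ⟨B, hB⟩ := (𝓝 z).exists_antitone_basis
  obtain ⟨n, hn, hm⟩ := Filter.extraction_forall_of_frequently (P := fun j n => 0 < n ∧ f^[n] z ∈ B j) (by
    intro j
    rw [Filter.frequently_atTop]
    intro N
    obtain ⟨m, hm, hm'⟩ := hr (B j) (hB.mem j) (N + 1)
    exact ⟨m, by omega, by omega, hm'⟩)
  have ht : Tendsto (fun j => f^[n j] z) atTop (𝓝 z) := hB.tendsto fun j => (hm j).2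
  obtain ⟨x, hx⟩ := QuotientAddGroup.mk_surjective z.1
  have e : projO (x, z.2) = z := Prod.ext hx rfl
  exact tendsto_nhds_unique (h _ e n hn (fun j => (hm j).1) ht) (h' _ e n hn (fun j => (hm j).1) ht)

end FLC

namespace FLC

theorem curve_contra {f : AnnO ≃ₜ AnnO}
    (hint : ∀ γ : C(Circle1, AnnO), Function.Injective γ →
      (¬ ∃ c : AnnO, ContinuousMap.Homotopic γ (ContinuousMap.const Circle1 c)) →
      (Set.range γ ∩ (⇑f) '' (Set.range γ)).Nonempty)
    {F : StripO ≃ₜ StripO} (hlift : ∀ p, projO (F p) = f (projO p))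
    {Φ : StripO ≃ₜ ℂ} (hre : ∀ w, (Φ w).re = w.1)
    (h1 : ∀ w, Φ (w.1 + 1, w.2) = Φ w + 1) {g : ℝ → ℂ} {k : ℤ} (hg : Continuous g) (hk : k ≠ 0)
    (hper : ∀ t, g (t + 1) = g t + k) (hinj : ∀ s t : ℝ, ∀ c : ℤ, g s = g t + c → ∃ j : ℤ, s = t + j) :
    ∃ s t : ℝ, ∃ c : ℤ, g s = (Φ.symm.trans (F.trans Φ)) (g t) + c := by
  have hsre : ∀ z, (Φ.symm z).1 = z.re := fun z => by rw [← hre, Homeomorph.apply_symm_apply]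
  have pe : ∀ z z' : ℂ, projO (Φ.symm z) = projO (Φ.symm z') → ∃ c : ℤ, z = z' + c := by
    intro z z' h
    obtain ⟨n, hn⟩ := proj_eq h
    refine ⟨n, ?_⟩
    have := congrArg Φ hn
    rwa [chart_int h1, Homeomorph.apply_symm_apply, Homeomorph.apply_symm_apply] at this
  let G : ℝ → AnnO := fun t => projO (Φ.symm (g t))
  have Gp : Function.Periodic G 1 := by
    intro t
    show projO (Φ.symm (g (t + 1))) = projO (Φ.symm (g t))
    rw [hper, chart_symm_int h1, proj_add]
  have Gc : Continuous G := continuous_projO.comp (Φ.symm.continuous.comp hg)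
  let γ : C(Circle1, AnnO) := ⟨Gp.lift, (QuotientAddGroup.isQuotientMap_mk _).continuous_iff.2 Gc⟩
  have hγ : ∀ t : ℝ, γ (t : Circle1) = G t := fun t => Gp.lift_coe t
  have γi : Function.Injective γ := by
    intro x y e
    obtain ⟨s, rfl⟩ := QuotientAddGroup.mk_surjective x
    obtain ⟨t, rfl⟩ := QuotientAddGroup.mk_surjective y
    have e1 : G s = G t := e
    obtain ⟨c, hc⟩ := pe _ _ e1
    obtain ⟨j, rfl⟩ := hinj _ _ _ hc
    exact coe_int t j
  have γn : ¬ ∃ c : AnnO, ContinuousMap.Homotopic γ (ContinuousMap.const Circle1 c) := by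
    rintro ⟨c, ⟨K⟩⟩
    have hcoe : Continuous ((↑) : ℝ → Circle1) := AddCircle.continuous_mk' (1 : ℝ)
    obtain ⟨L, hL, hL0⟩ := lift_circle
      (⟨fun p => (K (p.1, (p.2 : Circle1))).1, by
        exact continuous_fst.comp (K.continuous.comp (by fun_prop))⟩ : C(unitInterval × ℝ, Circle1))
      ⟨fun t => (g t).re, by fun_prop⟩ (by
        intro t
        show (K (0, (t : Circle1))).1 = _
        rw [K.apply_zero, hγ]
        show (((Φ.symm (g t)).1 : ℝ) : Circle1) = _
        rw [hsre]; rfl)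
    have hd := int_const (X := unitInterval × ℝ) (d := fun p => L (p.1, p.2 + 1) - L p) (by fun_prop)
      (by
        intro p
        obtain ⟨n, hn⟩ := coe_eq (x := L (p.1, p.2 + 1)) (y := L p) (by
          rw [hL, hL]
          show (K (p.1, ((p.2 + 1 : ℝ) : Circle1))).1 = (K (p.1, (p.2 : Circle1))).1
          have := coe_int p.2 1
          rw [Int.cast_one] at this
          rw [this])
        exact ⟨n, by rw [hn]; ring⟩) (0, 0) (1, 0)
    have hd2 := int_const (X := ℝ) (d := fun t => L (1, t) - L (1, 0)) (by fun_prop)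
      (by
        intro t
        obtain ⟨n, hn⟩ := coe_eq (x := L (1, t)) (y := L (1, 0)) (by
          rw [hL, hL]
          show (K (1, (t : Circle1))).1 = (K (1, ((0 : ℝ) : Circle1))).1
          rw [K.apply_one, K.apply_one]; rfl)
        exact ⟨n, by rw [hn]; ring⟩) (0 + 1) 0
    have hp := congrArg Complex.re (hper 0)
    simp only [hL0, ContinuousMap.coe_mk] at hd
    simp only [Complex.add_re, Complex.intCast_re] at hp
    have : (k : ℝ) = 0 := by linarith
    exact hk (by exact_mod_cast this)
  obtain ⟨x, ⟨a, ha⟩, y, ⟨b, hb⟩, hy⟩ := hint γ γi γn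
  obtain ⟨s, rfl⟩ := QuotientAddGroup.mk_surjective a
  obtain ⟨t, rfl⟩ := QuotientAddGroup.mk_surjective b
  have e1 : G s = x := ha
  have e2 : G t = y := hb
  rw [← hy, ← e2] at e1
  have e3 : projO (Φ.symm (g s)) = projO (Φ.symm (Φ (F (Φ.symm (g t))))) := by
    rw [Homeomorph.symm_apply_apply, hlift]; exact e1
  obtain ⟨c, hc⟩ := pe _ _ e3
  exact ⟨s, t, c, hc⟩

theorem period_of {f : AnnO ≃ₜ AnnO} {F : StripO ≃ₜ StripO} (hlift : ∀ p, projO (F p) = f (projO p))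
    (hcomm : ∀ p, F (deckO p) = deckO (F p)) {p : ℤ} {q : ℕ} (hq : 1 ≤ q)
    (hgcd : Int.gcd p (q : ℤ) = 1) {w : StripO} (hw : F^[q] w = (w.1 + (p : ℝ), w.2)) :
    Function.minimalPeriod f (projO w) = q := by
  have hfix : f^[q] (projO w) = projO w := by rw [← proj_iter hlift, hw, proj_add]
  have hper : Function.IsPeriodicPt f q (projO w) := hfix
  obtain ⟨r, hr⟩ := hper.minimalPeriod_dvd
  set m := Function.minimalPeriod f (projO w) with hm
  have hm2 : f^[m] (projO w) = projO w := Function.iterate_minimalPeriod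
  rw [← proj_iter hlift] at hm2
  obtain ⟨a, ha⟩ := proj_eq hm2
  have hci : ∀ (i : ℕ) (n : ℤ) (u : StripO), F^[i] (u.1 + n, u.2) = ((F^[i] u).1 + n, (F^[i] u).2) := by
    intro i n
    induction i with
    | zero => intro u; rfl
    | succ i ih =>
      intro u
      rw [Function.iterate_succ_apply, deck_int hcomm, ih (F u), Function.iterate_succ_apply]
  have hit : ∀ r : ℕ, F^[m * r] w = (w.1 + ((r * a : ℤ) : ℝ), w.2) := by
    intro r
    induction r with
    | zero => simp
    | succ r ih =>
      rw [Nat.mul_succ, Function.iterate_add_apply, ha, hci, ih]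
      refine Prod.ext ?_ rfl
      push_cast; ring
  have h := hit r
  rw [← hr, hw] at h
  have h2 : w.1 + (p : ℝ) = w.1 + ((r * a : ℤ) : ℝ) := congrArg Prod.fst h
  have h3 : p = r * a := by exact_mod_cast add_left_cancel h2
  have h4 : (r : ℤ) ∣ Int.gcd p q := Int.dvd_coe_gcd ⟨a, h3⟩ ⟨m, by rw [hr]; push_cast; ring⟩
  rw [hgcd] at h4
  have h5 : r = 1 := by
    have : r ∣ 1 := by exact_mod_cast h4
    exact Nat.dvd_one.1 this
  rw [hr, h5, mul_one]

theorem final (f : AnnO ≃ₜ AnnO) (hiso : IsotopicToIdO f)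
    (hint : ∀ γ : C(Circle1, AnnO), Function.Injective γ →
      (¬ ∃ c : AnnO, ContinuousMap.Homotopic γ (ContinuousMap.const Circle1 c)) →
      (Set.range γ ∩ (⇑f) '' (Set.range γ)).Nonempty)
    (F : StripO ≃ₜ StripO) (hlift : ∀ p, projO (F p) = f (projO p))
    (hcomm : ∀ p, F (deckO p) = deckO (F p))
    (z₁ z₂ : AnnO) (hrec₁ : PosRecurrentO f z₁) (hrec₂ : PosRecurrentO f z₂)
    (ρ₁ ρ₂ : ℝ) (hρ₁ : HasRotNumO f F z₁ ρ₁) (hρ₂ : HasRotNumO f F z₂ ρ₂)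
    (hlt : ρ₁ < ρ₂) (p : ℤ) (q : ℕ) (hq : 1 ≤ q) (hgcd : Int.gcd p (q : ℤ) = 1)
    (hp1 : ρ₁ < (p : ℝ) / (q : ℝ)) (hp2 : (p : ℝ) / (q : ℝ) < ρ₂) :
      ∃ z : AnnO, Function.minimalPeriod (⇑f) z = q ∧
        ∃ zt : StripO, projO zt = z ∧ (⇑F)^[q] zt = (zt.1 + (p : ℝ), zt.2) := by
  by_contra hcon
  have hno0 : ∀ w : StripO, F^[q] w ≠ (w.1 + (p : ℝ), w.2) := fun w hw =>
    hcon ⟨projO w, period_of hlift hcomm hq hgcd hw, w, rfl, hw⟩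
  have hz : z₁ ≠ z₂ := by
    rintro rfl
    exact hlt.ne (rot_unique hrec₁ hρ₁ hρ₂)
  have hsurj : ∀ z : AnnO, ∃ w, projO w = z := fun z => by
    obtain ⟨x, hx⟩ := QuotientAddGroup.mk_surjective z.1
    exact ⟨(x, z.2), Prod.ext hx rfl⟩
  obtain ⟨w₁, rfl⟩ := hsurj z₁
  obtain ⟨w₂, rfl⟩ := hsurj z₂
  obtain ⟨Φ, hre, h1, him⟩ := exists_chart w₁ w₂ hz
  obtain ⟨g, k, hg, hk, hper, hinj, hdis⟩ := main_plane (h := Φ.symm.trans (F.trans Φ))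
    (isoT_of hiso hlift hre h1) (p := p) hq (by
      intro z hz
      obtain ⟨w, rfl⟩ := Φ.surjective z
      rw [conj_iter, ← chart_int h1] at hz
      exact hno0 w (Φ.injective hz)) him (rec_of hlift h1 hrec₁) (rec_of hlift h1 hrec₂)
    (rot_of hlift hre h1 hρ₁) (rot_of hlift hre h1 hρ₂) hp1 hp2
  obtain ⟨s, t, c, h⟩ := curve_contra hint hlift hre h1 hg hk hper hinj
  exact hdis s t c h

end FLC

/-- Franks–Le Calvez theorem: let `f` be a homeomorphism of the open annulus
isotopic to the identity with the intersection property, and `F` a lift. If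
there are positively recurrent points of rotation numbers `ρ₁ < ρ₂`, then for
every irreducible rational `p/q ∈ (ρ₁, ρ₂)` there is a `q`-prime-periodic point
with rotation number `p/q`. -/
theorem franks_lecalvez (f : AnnO ≃ₜ AnnO) (hiso : IsotopicToIdO f)
    (hint : ∀ γ : C(Circle1, AnnO), Function.Injective γ →
      (¬ ∃ c : AnnO, ContinuousMap.Homotopic γ (ContinuousMap.const Circle1 c)) →
      (Set.range γ ∩ (⇑f) '' (Set.range γ)).Nonempty)
    (F : StripO ≃ₜ StripO) (hlift : ∀ p, projO (F p) = f (projO p))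
    (hcomm : ∀ p, F (deckO p) = deckO (F p))
    (z₁ z₂ : AnnO) (hrec₁ : PosRecurrentO f z₁) (hrec₂ : PosRecurrentO f z₂)
    (ρ₁ ρ₂ : ℝ) (hρ₁ : HasRotNumO f F z₁ ρ₁) (hρ₂ : HasRotNumO f F z₂ ρ₂)
    (hlt : ρ₁ < ρ₂) :
    ∀ p : ℤ, ∀ q : ℕ, 1 ≤ q → Int.gcd p (q : ℤ) = 1 →
      ρ₁ < (p : ℝ) / (q : ℝ) → (p : ℝ) / (q : ℝ) < ρ₂ →
      ∃ z : AnnO, Function.minimalPeriod (⇑f) z = q ∧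
        ∃ zt : StripO, projO zt = z ∧ (⇑F)^[q] zt = (zt.1 + (p : ℝ), zt.2) := by
  intro p q hq hgcd hp1 hp2
  exact FLC.final f hiso hint F hlift hcomm z₁ z₂ hrec₁ hrec₂ ρ₁ ρ₂ hρ₁ hρ₂ hlt p q hq hgcd hp1 hp2
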